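/- Let k be a PAC field. Then every finite Galois embedding problem over k has a geometric Galois solution. Explicitly: for every finite group G, finite Galois extension L/k, and surjective group homomorphism α : G → Gal(L/k), there exist an indeterminate T, a finite Galois extension E of k(T) with L(T) ⊆ E such that every element of E algebraic over k lies in L (i.e., E ∩ k̄ = L), and an isomorphism β : Gal(E/k(T)) → G such that for every σ ∈ Gal(E/k(T)), σ maps L onto itself and σ|_L = α(β(σ)). -/

import Mathlib

set_option synthInstance.maxHeartbeats 1000000
set_option maxHeartbeats 1000000

/-- A field `k` is *PAC* (pseudo algebraically closed) if every finitely generated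
`k`-algebra `A` which is an integral domain and such that `A ⊗_k k̄` is an integral
domain (`k̄` an algebraic closure of `k`) admits a `k`-algebra homomorphism `A → k`. -/
def IsPACField (k : Type) [Field k] : Prop :=
  ∀ (A : Type) [CommRing A] [IsDomain A] [Algebra k A],
    Algebra.FiniteType k A →
    IsDomain (TensorProduct k (AlgebraicClosure k) A) →
    Nonempty (A →ₐ[k] k)

/-! ### A1 : Laurent series basics -/
section A1
open HahnSeries

theorem ls_bdd {R : Type*} [Zero R] (x : LaurentSeries R) : ∃ a : ℤ, ∀ i < a, x.coeff i = 0 := by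
  by_cases hx : x = 0
  · exact ⟨0, fun i _ => by simp [hx]⟩
  · exact ⟨x.order, fun i hi => HahnSeries.coeff_eq_zero_of_lt_order hi⟩

theorem ls_mk {R : Type*} [Zero R] (f : ℤ → R) (a : ℤ) (h : ∀ i < a, f i = 0) :
    ∃ x : LaurentSeries R, ∀ i, x.coeff i = f i := by
  refine ⟨HahnSeries.ofSuppBddBelow f ⟨a, ?_⟩, fun i => rfl⟩
  intro i hi
  by_contra hlt
  exact hi (h i (not_le.mp hlt))

theorem ls_mulc {R : Type*} [CommRing R] (x y : LaurentSeries R) (a b : ℤ)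
    (hx : ∀ i < a, x.coeff i = 0) (hy : ∀ i < b, y.coeff i = 0) (n : ℤ) :
    (x * y).coeff n = ∑ i ∈ Finset.Icc a (n - b), x.coeff i * y.coeff (n - i) := by
  classical
  rw [HahnSeries.coeff_mul]
  refine Finset.sum_bij_ne_zero (fun ij _ _ => ij.1) ?_ ?_ ?_ ?_
  · rintro ⟨i, j⟩ h1 h2
    rw [Finset.mem_antidiagonal] at h1
    obtain ⟨h3, h4, h5⟩ := h1
    simp only [Finset.mem_Icc]
    simp only [HahnSeries.mem_support] at h3 h4
    constructor
    · by_contra hh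
      exact h3 (hx _ (by lia))
    · by_contra hh
      simp only at h5
      exact h4 (hy _ (by lia))
  · rintro ⟨i, j⟩ h1 _ ⟨i', j'⟩ h2 _ h
    rw [Finset.mem_antidiagonal] at h1 h2
    simp only at h h1 h2
    ext <;> simp <;> lia
  · intro i hi hne
    refine ⟨(i, n - i), ?_, hne, rfl⟩
    rw [Finset.mem_antidiagonal]
    refine ⟨?_, ?_, by simp⟩
    · intro h0; apply hne; simp [h0]
    · intro h0; apply hne; simp [h0]
  · rintro ⟨i, j⟩ h1 h2
    rw [Finset.mem_antidiagonal] at h1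
    have : n - i = j := by have := h1.2.2; simp only at this; lia
    simp [this]

/-- coefficientwise map -/
noncomputable def lmap {R S : Type*} [CommRing R] [CommRing S] (f : R →+* S) :
    LaurentSeries R →+* LaurentSeries S where
  toFun x := x.map f
  map_one' := HahnSeries.map_one (f.toMonoidWithZeroHom)
  map_mul' x y := HahnSeries.map_mul (f : R →ₙ+* S)
  map_zero' := by ext; simp
  map_add' x y := by ext; simp

@[simp] theorem lmap_coeff {R S : Type*} [CommRing R] [CommRing S] (f : R →+* S)
    (x : LaurentSeries R) (n : ℤ) : (lmap f x).coeff n = f (x.coeff n) := rfl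

theorem lmap_inj {R S : Type*} [CommRing R] [CommRing S] (f : R →+* S)
    (hf : Function.Injective f) : Function.Injective (lmap f) := by
  intro x y h
  ext n
  apply hf
  rw [← lmap_coeff, ← lmap_coeff, h]

theorem lmap_C {R S : Type*} [CommRing R] [CommRing S] (f : R →+* S) (r : R) :
    lmap f (HahnSeries.C r) = HahnSeries.C (f r) := by
  ext n
  simp only [lmap_coeff, HahnSeries.C_apply, HahnSeries.coeff_single]
  split_ifs <;> simp

/-- general recursion lemma -/
theorem rec_exists {A : Type*} [Inhabited A] (R : ℕ → (ℕ → A) → A → Prop)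
    (h : ∀ m f, ∃ a, R m f a) :
    ∃ q : ℕ → A, ∀ m, R m (fun l => if l < m then q l else default) (q m) := by
  classical
  choose F hF using h
  let q : ℕ → A := (Nat.lt_wfRel.wf).fix
    (fun m ih => F m (fun l => if hl : l < m then ih l hl else default))
  refine ⟨q, fun m => ?_⟩
  have : q m = F m (fun l => if l < m then q l else default) := by
    change (Nat.lt_wfRel.wf).fix _ m = _
    rw [WellFounded.fix_eq]
    congr 1
  rw [this]
  exact hF _ _

/-- independence of characters gives spanning -/
theorem char_span {ι Z W : Type*} [Fintype ι] [DecidableEq ι] [Field Z] [Field W] (θ : ι → (Z →+* W))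
    (hθ : Function.Injective θ) :
    ∃ (n : ℕ) (z : Fin n → Z) (v : Fin n → ι → W),
      ∀ i j, ∑ l, v l j * θ i (z l) = if i = j then 1 else 0 := by
  have key : Submodule.span W (Set.range fun z : Z => (fun i => θ i z : ι → W)) = ⊤ := by
    by_contra hne
    obtain ⟨f, hf0, hf⟩ := Submodule.exists_le_ker_of_lt_top _ (lt_top_iff_ne_top.mpr hne)
    have hli : LinearIndependent W (fun i => ((θ i : Z →* W) : Z → W)) := by
      refine (linearIndependent_monoidHom Z W).comp (fun i => (θ i : Z →* W)) ?_
      intro i j hij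
      apply hθ
      ext z
      exact DFunLike.congr_fun hij z
    rw [Fintype.linearIndependent_iff] at hli
    have h0 := hli (fun i => f (Pi.single i 1)) (by
      ext z
      have h1 : f (fun i => θ i z) = 0 := hf (Submodule.subset_span ⟨z, rfl⟩)
      have h2 : (fun i => θ i z : ι → W) = ∑ i, θ i z • (Pi.single i 1 : ι → W) := by
        ext j
        simp [Finset.sum_apply, Pi.single_apply]
      rw [h2, map_sum] at h1
      simp only [map_smul, smul_eq_mul] at h1
      simp only [Finset.sum_apply, Pi.smul_apply, smul_eq_mul, Pi.zero_apply]
      rw [← h1]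
      refine Finset.sum_congr rfl fun i _ => ?_
      simp [mul_comm])
    apply hf0
    apply LinearMap.pi_ext'
    intro i
    ext
    simpa using h0 i
  -- each Pi.single j 1 is a combination
  have h1 : ∀ j, ∃ c : Z →₀ W, ∀ i, c.sum (fun z w => w * θ i z) = if i = j then 1 else 0 := by
    intro j
    have hm : (Pi.single j 1 : ι → W) ∈
      Submodule.span W (Set.range fun z : Z => (fun i => θ i z : ι → W)) := key ▸ trivial
    rw [Finsupp.mem_span_range_iff_exists_finsupp] at hm
    obtain ⟨c, hc⟩ := hm
    refine ⟨c, fun i => ?_⟩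
    have := congrFun hc i
    rw [Finsupp.sum, Finset.sum_apply] at this
    rw [Finsupp.sum]
    simpa [Pi.single_apply] using this
  choose c hc using h1
  classical
  let s : Finset Z := Finset.univ.biUnion fun j => (c j).support
  refine ⟨s.card, fun l => (s.equivFin.symm l : Z), fun l j => c j (s.equivFin.symm l : Z), ?_⟩
  intro i j
  rw [← hc j i, Finsupp.sum_of_support_subset (s := s)]
  · rw [← Finset.sum_coe_sort s, ← s.equivFin.symm.sum_comp]
  · exact Finset.subset_biUnion_of_mem (fun j => (c j).support) (Finset.mem_univ j)
  · simp

end A1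

/-! ### A2 : local theory -/
section A2
open HahnSeries
open scoped RatFunc

/-- localization of a subring inside a field -/
def locSub {Y : Type*} [Field Y] (S0 S : Subring Y) (h : S0 ≤ S) : Subring Y where
  carrier := {z | ∃ b ∈ S0, b ≠ 0 ∧ b * z ∈ S}
  mul_mem' := by
    rintro x y ⟨b, hb, hb0, hbx⟩ ⟨c, hc, hc0, hcy⟩
    refine ⟨b * c, S0.mul_mem hb hc, mul_ne_zero hb0 hc0, ?_⟩
    have := S.mul_mem hbx hcy
    convert this using 1; ring
  one_mem' := ⟨1, S0.one_mem, one_ne_zero, by simp⟩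
  add_mem' := by
    rintro x y ⟨b, hb, hb0, hbx⟩ ⟨c, hc, hc0, hcy⟩
    refine ⟨b * c, S0.mul_mem hb hc, mul_ne_zero hb0 hc0, ?_⟩
    have := S.add_mem (S.mul_mem (h hc) hbx) (S.mul_mem (h hb) hcy)
    convert this using 1; ring
  zero_mem' := ⟨1, S0.one_mem, one_ne_zero, by simp⟩
  neg_mem' := by
    rintro x ⟨b, hb, hb0, hbx⟩
    exact ⟨b, hb, hb0, by simpa using S.neg_mem hbx⟩

theorem mem_locSub {Y : Type*} [Field Y] {S0 S : Subring Y} {h : S0 ≤ S} {z : Y} :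
    z ∈ locSub S0 S h ↔ ∃ b ∈ S0, b ≠ 0 ∧ b * z ∈ S := Iff.rfl

theorem le_locSub {Y : Type*} [Field Y] {S0 S : Subring Y} {h : S0 ≤ S} : S ≤ locSub S0 S h :=
  fun z hz => ⟨1, S0.one_mem, one_ne_zero, by simpa using hz⟩

/-- common denominators -/
theorem locSub_common {Y : Type*} [Field Y] {S0 S : Subring Y} {h : S0 ≤ S} {ι : Type*}
    (s : Finset ι) (z : ι → Y) (hz : ∀ i ∈ s, z i ∈ locSub S0 S h) :
    ∃ b ∈ S0, b ≠ 0 ∧ ∀ i ∈ s, b * z i ∈ S := by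
  classical
  induction s using Finset.induction_on with
  | empty => exact ⟨1, S0.one_mem, one_ne_zero, by simp⟩
  | insert i s hi ih =>
    obtain ⟨b, hb, hb0, hbz⟩ := ih (fun i hi => hz i (Finset.mem_insert_of_mem hi))
    obtain ⟨c, hc, hc0, hcz⟩ := hz i (Finset.mem_insert_self _ _)
    refine ⟨b * c, S0.mul_mem hb hc, mul_ne_zero hb0 hc0, fun j hj => ?_⟩
    rcases Finset.mem_insert.mp hj with rfl | hj
    · rw [mul_assoc]; exact S.mul_mem (h hb) hcz
    · rw [mul_comm b c, mul_assoc]; exact S.mul_mem (h hc) (hbz j hj)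

/-- power series subring -/
noncomputable def psub (Q : Type*) [Field Q] : Subring (LaurentSeries Q) :=
  (HahnSeries.ofPowerSeries ℤ Q).range

theorem mem_psub {Q : Type*} [Field Q] (x : LaurentSeries Q) :
    x ∈ psub Q ↔ ∀ e < 0, x.coeff e = 0 := by
  constructor
  · rintro ⟨f, rfl⟩ e he
    rw [PowerSeries.coeff_coe, if_pos he]
  · intro h
    refine ⟨PowerSeries.mk fun n => x.coeff n, ?_⟩
    ext e
    rw [PowerSeries.coeff_coe]
    split_ifs with he
    · exact (h e he).symm
    · simp only [PowerSeries.coeff_mk]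
      congr 1; lia

abbrev WW (Q : Type*) [Field Q] := LaurentSeries (LaurentSeries Q)

noncomputable def lsub {R : Type*} [Field R] (S : Subring R) : Subring (LaurentSeries R) where
  carrier := {w | ∀ m, w.coeff m ∈ S}
  mul_mem' := by
    intro x y hx hy m
    rw [HahnSeries.coeff_mul]
    exact S.sum_mem fun i _ => S.mul_mem (hx _) (hy _)
  one_mem' := by
    intro m; rw [HahnSeries.coeff_one]; split_ifs; exacts [S.one_mem, S.zero_mem]
  add_mem' := by
    intro x y hx hy m; exact S.add_mem (hx _) (hy _)
  zero_mem' := fun m => S.zero_mem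
  neg_mem' := by
    intro x hx m; exact S.neg_mem (hx _)

theorem mem_lsub {R : Type*} [Field R] {S : Subring R} {w : LaurentSeries R} :
    w ∈ lsub S ↔ ∀ m, w.coeff m ∈ S := Iff.rfl

noncomputable def OO (Q : Type*) [Field Q] : Subring (WW Q) := lsub (psub Q)

noncomputable def F2 (Q : Type*) [Field Q] : Subfield (WW Q) where
  __ := locSub (OO Q) (OO Q) le_rfl
  inv_mem' := by
    rintro w ⟨b, hb, hb0, hbw⟩
    by_cases hw : w = 0
    · subst hw; exact ⟨1, (OO Q).one_mem, one_ne_zero, by simp⟩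
    · refine ⟨b * w, hbw, mul_ne_zero hb0 hw, ?_⟩
      rwa [mul_assoc, mul_inv_cancel₀ hw, mul_one]

theorem mem_F2 {Q : Type*} [Field Q] {w : WW Q} :
    w ∈ F2 Q ↔ ∃ b ∈ OO Q, b ≠ 0 ∧ b * w ∈ OO Q := Iff.rfl

theorem OO_le_F2 {Q : Type*} [Field Q] {w : WW Q} (h : w ∈ OO Q) : w ∈ F2 Q :=
  ⟨1, (OO Q).one_mem, one_ne_zero, by simpa using h⟩

theorem C_mem_F2 {Q : Type*} [Field Q] (x : LaurentSeries Q) : (HahnSeries.C x : WW Q) ∈ F2 Q := by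
  have hC : ∀ y ∈ psub Q, (HahnSeries.C y : WW Q) ∈ OO Q := by
    intro y hy m
    rw [HahnSeries.C_apply, HahnSeries.coeff_single]
    split_ifs; exacts [hy, (psub Q).zero_mem]
  obtain ⟨a, ha⟩ := ls_bdd x
  refine ⟨HahnSeries.C (HahnSeries.single (max 0 (-a)) 1), hC _ ?_, ?_, ?_⟩
  · rw [mem_psub]; intro e he
    rw [HahnSeries.coeff_single_of_ne]; lia
  · rw [Ne, map_eq_zero]; simp
  · rw [← map_mul]
    apply hC
    rw [mem_psub]; intro e he
    rw [HahnSeries.coeff_single_mul, one_mul]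
    apply ha; lia

theorem single_mem_F2 {Q : Type*} [Field Q] (n : ℤ) (x : LaurentSeries Q) :
    (HahnSeries.single n x : WW Q) ∈ F2 Q := by
  have h1 : (HahnSeries.single n x : WW Q) = HahnSeries.C x * HahnSeries.single n 1 := by
    rw [HahnSeries.C_apply, HahnSeries.single_mul_single]; simp
  rw [h1]
  refine (F2 Q).mul_mem (C_mem_F2 _) (OO_le_F2 ?_)
  intro m
  rw [HahnSeries.coeff_single]
  split_ifs; exacts [(psub Q).one_mem, (psub Q).zero_mem]

theorem coeff_sum_single {R : Type*} [AddCommMonoid R] (s : Finset ℤ) (f : ℤ → R) (m : ℤ) :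
    (∑ i ∈ s, (HahnSeries.single i (f i) : HahnSeries ℤ R)).coeff m = if m ∈ s then f m else 0 := by
  rw [HahnSeries.coeff_sum]
  split_ifs with h
  · rw [Finset.sum_eq_single_of_mem m h]
    · simp
    · intro b _ hb
      rw [HahnSeries.coeff_single_of_ne (Ne.symm hb)]
  · refine Finset.sum_eq_zero fun i hi => ?_
    rw [HahnSeries.coeff_single_of_ne]
    rintro rfl; exact h hi

/-- density of F2 by truncation -/
theorem F2_trunc {Q : Type*} [Field Q] (w : WW Q) (N : ℤ) :
    ∃ w' ∈ F2 Q, ∀ m < N, (w - w').coeff m = 0 := by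
  obtain ⟨a, ha⟩ := ls_bdd w
  refine ⟨∑ m ∈ Finset.Ico a N, HahnSeries.single m (w.coeff m),
    (F2 Q).sum_mem fun m _ => single_mem_F2 _ _, fun m hm => ?_⟩
  rw [HahnSeries.coeff_sub, coeff_sum_single]
  split_ifs with h
  · simp
  · rw [ha, sub_zero]
    simp at h; lia

/-- `X ↦ t / π` -/
noncomputable def tau (Q : Type*) [Field Q] : LaurentSeries Q →+* WW Q where
  toFun z := HahnSeries.ofSuppBddBelow (fun l => HahnSeries.single (-l) (z.coeff l)) (by
    obtain ⟨a, ha⟩ := ls_bdd z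
    refine ⟨a, fun l hl => ?_⟩
    by_contra hlt
    exact hl (by simp [ha l (not_le.mp hlt)]))
  map_zero' := by ext; simp [HahnSeries.ofSuppBddBelow]
  map_one' := by
    ext l e
    simp only [HahnSeries.ofSuppBddBelow, HahnSeries.coeff_one, HahnSeries.coeff_single]
    by_cases hl : l = 0
    · subst hl; simp [HahnSeries.coeff_one]
    · simp [hl]
  map_add' x y := by
    ext l e
    simp [HahnSeries.ofSuppBddBelow]
  map_mul' x y := by
    obtain ⟨a, ha⟩ := ls_bdd x
    obtain ⟨b, hb⟩ := ls_bdd y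
    ext1; funext l
    rw [ls_mulc _ _ a b (fun i hi => by simp [HahnSeries.ofSuppBddBelow, ha i hi])
      (fun i hi => by simp [HahnSeries.ofSuppBddBelow, hb i hi])]
    simp only [HahnSeries.ofSuppBddBelow, HahnSeries.single_mul_single]
    rw [ls_mulc x y a b ha hb]
    erw [map_sum (HahnSeries.single.addMonoidHom (-l))]
    refine Finset.sum_congr rfl fun i _ => ?_
    have : -i + -(l - i) = -l := by ring
    rw [this]; rfl

theorem tau_coeff {Q : Type*} [Field Q] (z : LaurentSeries Q) (l : ℤ) :
    (tau Q z).coeff l = HahnSeries.single (-l) (z.coeff l) := rfl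

/-- total degree `d` part -/
noncomputable def delt {Q : Type*} [Field Q] (d : ℤ) : WW Q →+ LaurentSeries Q where
  toFun w := HahnSeries.ofSuppBddBelow (fun m => (w.coeff m).coeff (d - m)) (by
    obtain ⟨a, ha⟩ := ls_bdd w
    refine ⟨a, fun l hl => ?_⟩
    by_contra hlt
    exact hl (by simp [ha l (not_le.mp hlt)]))
  map_zero' := by ext; simp [HahnSeries.ofSuppBddBelow]
  map_add' x y := by ext; simp [HahnSeries.ofSuppBddBelow]

theorem delt_coeff {Q : Type*} [Field Q] (d : ℤ) (w : WW Q) (m : ℤ) :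
    (delt d w).coeff m = (w.coeff m).coeff (d - m) := rfl

theorem delt_mul {Q : Type*} [Field Q] (d : ℤ) (w : WW Q) (z : LaurentSeries Q) :
    delt d (w * tau Q z) = delt d w * z := by
  obtain ⟨a, ha⟩ := ls_bdd w
  obtain ⟨b, hb⟩ := ls_bdd z
  ext m
  rw [delt_coeff, ls_mulc _ _ a b ha (fun i hi => by rw [tau_coeff, hb i hi]; simp),
    ls_mulc _ _ a b (fun i hi => by rw [delt_coeff, ha i hi]; simp) hb, HahnSeries.coeff_sum]
  refine Finset.sum_congr rfl fun i _ => ?_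
  rw [tau_coeff, delt_coeff, HahnSeries.coeff_mul_single]
  congr 2; ring

theorem rl_poly {Q : Type*} [Field Q] (p : Polynomial Q) :
    algebraMap (RatFunc Q) (LaurentSeries Q) (algebraMap (Polynomial Q) (RatFunc Q) p)
      = HahnSeries.ofPowerSeries ℤ Q (p : PowerSeries Q) := (RatFunc.coe_coe p).symm

/-- finitely supported Laurent series are rational -/
theorem fin_supp_ratFunc {Q : Type*} [Field Q] (x : LaurentSeries Q) (N : ℤ)
    (h : ∀ m > N, x.coeff m = 0) : ∃ r : RatFunc Q, algebraMap (RatFunc Q) (LaurentSeries Q) r = x := by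
  obtain ⟨a, ha⟩ := ls_bdd x
  have hx : x = ∑ m ∈ Finset.Icc a N, HahnSeries.single m (x.coeff m) := by
    ext m
    rw [coeff_sum_single]
    split_ifs with hm
    · rfl
    · simp at hm
      by_cases h1 : m < a
      · exact ha m h1
      · exact h m (by lia)
  have h2 : ∀ (m : ℤ) (q : Q), (HahnSeries.single m q : LaurentSeries Q) ∈
      (algebraMap (RatFunc Q) (LaurentSeries Q)).fieldRange := by
    intro m q
    have h3 : (HahnSeries.single m q : LaurentSeries Q) =
        HahnSeries.C q * (HahnSeries.single 1 1) ^ m := by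
      rw [← RatFunc.single_zpow m, HahnSeries.C_apply, HahnSeries.single_mul_single]; simp
    rw [h3]
    have h4 : (HahnSeries.single 1 1 : LaurentSeries Q) ∈
      (algebraMap (RatFunc Q) (LaurentSeries Q)).fieldRange := ⟨RatFunc.X, RatFunc.coe_X⟩
    refine mul_mem ⟨RatFunc.C q, ?_⟩ (zpow_mem h4 m)
    rw [← RatFunc.algebraMap_C, rl_poly]; simp
  rw [hx]
  exact (algebraMap (RatFunc Q) (LaurentSeries Q)).fieldRange.sum_mem fun m _ => h2 _ _

theorem tau_lin {Q : Type*} [Field Q] {ι : Type*} [Fintype ι] (z : ι → LaurentSeries Q)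
    (hz : LinearIndependent (RatFunc Q) z) (c : ι → WW Q) (hc : ∀ i, c i ∈ F2 Q)
    (h0 : ∑ i, c i * tau Q (z i) = 0) : ∀ i, c i = 0 := by
  obtain ⟨b, hb, hb0, hbc⟩ := locSub_common (h := le_rfl) Finset.univ c (fun i _ => hc i)
  have h1 : ∑ i, (b * c i) * tau Q (z i) = 0 := by
    have := congrArg (b * ·) h0
    simpa [Finset.mul_sum, mul_assoc] using this
  have h2 : ∀ i d, delt d (b * c i) = 0 := by
    intro i d
    have h3 : ∀ i, ∃ r : RatFunc Q, algebraMap (RatFunc Q) (LaurentSeries Q) r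
        = delt d (b * c i) := fun i => by
      refine fin_supp_ratFunc _ d fun m hm => ?_
      rw [delt_coeff]
      exact (mem_psub _).mp (hbc i (Finset.mem_univ i) m) _ (by lia)
    choose r hr using h3
    have h4 := congrArg (delt d) h1
    rw [map_sum, map_zero] at h4
    simp only [delt_mul, ← hr, ← Algebra.smul_def] at h4
    rw [Fintype.linearIndependent_iff] at hz
    rw [← hr, hz r h4 i, map_zero]
  intro i
  have h5 : b * c i = 0 := by
    ext m e
    have := congrArg (fun x => HahnSeries.coeff x m) (h2 i (e + m))
    simpa [delt_coeff] using this
  exact (mul_eq_zero.mp h5).resolve_left hb0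

theorem tau_ratFunc {Q : Type*} [Field Q] (r : RatFunc Q) :
    tau Q (algebraMap (RatFunc Q) (LaurentSeries Q) r) ∈ F2 Q := by
  have hp : ∀ p : Polynomial Q, tau Q (algebraMap (RatFunc Q) (LaurentSeries Q)
      (algebraMap (Polynomial Q) (RatFunc Q) p)) ∈ F2 Q := by
    intro p
    induction p using Polynomial.induction_on' with
    | add p q hp hq => simp only [map_add]; exact (F2 Q).add_mem hp hq
    | monomial n a =>
      have : algebraMap (RatFunc Q) (LaurentSeries Q)
        (algebraMap (Polynomial Q) (RatFunc Q) (Polynomial.monomial n a)) = HahnSeries.single (n : ℤ) a := by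
        rw [rl_poly, Polynomial.coe_monomial]
        ext m
        rw [PowerSeries.coeff_coe, HahnSeries.coeff_single, PowerSeries.coeff_monomial]
        split_ifs <;> first | rfl | (exfalso; lia)
      rw [this]
      have h2 : tau Q (HahnSeries.single (n : ℤ) a) = HahnSeries.single (n : ℤ) (HahnSeries.single (-n : ℤ) a) := by
        ext m e
        rw [tau_coeff, HahnSeries.coeff_single, HahnSeries.coeff_single]
        by_cases h : m = n <;> simp [h, HahnSeries.coeff_single]
      rw [h2]
      exact single_mem_F2 _ _
  rw [← RatFunc.num_div_denom r, map_div₀, map_div₀]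
  exact (F2 Q).div_mem (hp _) (hp _)

end A2

/-! ### A3 : local algebras -/
section A3
open HahnSeries

open Classical in
structure IsLoc {G Q : Type} [Group G] [Field Q] (C : Subgroup G) (S : Subring (G → WW Q)) :
    Prop where
  const : ∀ f : G → WW Q, (∀ g, f g ∈ F2 Q) → (∀ c ∈ C, ∀ g, f (c * g) = f g) → f ∈ S
  trans : ∀ f ∈ S, ∀ g0, (fun g => f (g * g0)) ∈ S
  inv : ∀ f ∈ S, ∀ g, (∀ c ∈ C, f (c * g) = f g) → f g ∈ F2 Q
  const' : ∀ f ∈ S, ∀ g, f g ∈ F2 Q → ∀ c ∈ C, f (c * g) = f g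
  dens : ∃ u : G → (G → WW Q), ∀ h, u h ∈ S ∧
    ∀ g m, m ≤ 0 → (u h g).coeff m = if m = 0 ∧ g = h then 1 else 0

variable {R W : Type} (Z : Type) [Field R] [Field Z] [Algebra R Z] [Field W] (F : Subfield W)
  (τ : Z →+* W)

noncomputable def Thet (z : Z) : (Z ≃ₐ[R] Z) → W := fun η => τ (η z)

noncomputable def DD : Submodule (F) ((Z ≃ₐ[R] Z) → W) :=
  Submodule.span (F) (Set.range (Thet (R := R) Z τ))

theorem Thet_mul (y z : Z) : Thet (R := R) Z τ (y * z) = Thet (R := R) Z τ y * Thet (R := R) Z τ z := by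
  ext1 η; simp [Thet]

theorem DD_mul {f g : (Z ≃ₐ[R] Z) → W} (hf : f ∈ DD (R := R) Z F τ) (hg : g ∈ DD (R := R) Z F τ) :
    f * g ∈ DD (R := R) Z F τ := by
  have : f * g ∈ DD (R := R) Z F τ * DD (R := R) Z F τ := Submodule.mul_mem_mul hf hg
  rw [DD, Submodule.span_mul_span] at this
  refine Submodule.span_mono ?_ this
  rintro _ ⟨_, ⟨y, rfl⟩, _, ⟨z, rfl⟩, rfl⟩
  exact ⟨y * z, Thet_mul Z τ y z⟩

theorem DD_const (w : W) (hw : w ∈ F) : (fun _ => w) ∈ DD (R := R) Z F τ := by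
  have h : (fun _ => w) = (⟨w, hw⟩ : F) • Thet (R := R) Z τ 1 := by
    ext1 η; simp [Thet, Subfield.smul_def]
  rw [h]
  exact Submodule.smul_mem _ _ (Submodule.subset_span ⟨1, rfl⟩)

theorem DD_trans {f : (Z ≃ₐ[R] Z) → W} (hf : f ∈ DD (R := R) Z F τ) (η0 : Z ≃ₐ[R] Z) :
    (fun η => f (η * η0)) ∈ DD (R := R) Z F τ := by
  induction hf using Submodule.span_induction with
  | mem x hx =>
    obtain ⟨z, rfl⟩ := hx
    exact Submodule.subset_span ⟨η0 z, rfl⟩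
  | zero => exact Submodule.zero_mem _
  | add x y _ _ hx hy => exact Submodule.add_mem _ hx hy
  | smul a x _ hx => exact Submodule.smul_mem _ a hx

theorem Thet_smul (hR : ∀ r : R, τ (algebraMap R Z r) ∈ F) (r : R) (z : Z) : Thet (R := R) Z τ (r • z) =
    (⟨_, hR r⟩ : F) • Thet (R := R) Z τ z := by
  ext1 η
  simp only [Thet, Pi.smul_apply, Subfield.smul_def, map_smul, smul_eq_mul, ← map_mul]
  rw [Algebra.smul_def]

/-- elements of DD in terms of a basis -/
theorem DD_basis (hR : ∀ r : R, τ (algebraMap R Z r) ∈ F) {f : (Z ≃ₐ[R] Z) → W} (hf : f ∈ DD (R := R) Z F τ) {ι : Type*} [Fintype ι]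
    (b : Module.Basis ι (R) Z) :
    ∃ c : ι → F, f = ∑ i, c i • Thet (R := R) Z τ (b i) := by
  induction hf using Submodule.span_induction with
  | mem x hx =>
    obtain ⟨z, rfl⟩ := hx
    refine ⟨fun i => ⟨_, hR (b.repr z i)⟩, ?_⟩
    have hadd : ∀ (s : Finset ι) (y : ι → Z), Thet (R := R) Z τ (∑ i ∈ s, y i) = ∑ i ∈ s, Thet (R := R) Z τ (y i) := by
      intro s y
      ext1 η
      simp [Thet, Finset.sum_apply]
    conv_lhs => rw [← b.sum_repr z, hadd]
    exact Finset.sum_congr rfl fun i _ => Thet_smul Z F τ hR _ _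
  | zero => exact ⟨0, by simp⟩
  | add x y _ _ hx hy =>
    obtain ⟨c, rfl⟩ := hx
    obtain ⟨d, rfl⟩ := hy
    refine ⟨c + d, ?_⟩
    rw [← Finset.sum_add_distrib]
    exact Finset.sum_congr rfl fun i _ => (add_smul _ _ _).symm
  | smul a x _ hx =>
    obtain ⟨c, rfl⟩ := hx
    refine ⟨a • c, ?_⟩
    rw [Finset.smul_sum]
    exact Finset.sum_congr rfl fun i _ => (mul_smul _ _ _).symm

variable [FiniteDimensional R Z]

theorem DD_P1 (hR : ∀ r : R, τ (algebraMap R Z r) ∈ F) (hlin : ∀ {ι : Type} [Fintype ι] (z : ι → Z), LinearIndependent R z → ∀ c : ι → W,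
      (∀ i, c i ∈ F) → ∑ i, c i * τ (z i) = 0 → ∀ i, c i = 0) {f : (Z ≃ₐ[R] Z) → W} (hf : f ∈ DD (R := R) Z F τ) (h1 : f 1 ∈ F) :
    ∀ η, f η = f 1 := by
  classical
  have hli : LinearIndepOn (R) id ({1} : Set Z) :=
    LinearIndepOn.singleton (v := id) (by simp)
  let b := Module.Basis.extend hli
  have h1m : (1 : Z) ∈ hli.extend (Set.subset_univ _) := hli.subset_extend _ (Set.mem_singleton _)
  have : Fintype (hli.extend (Set.subset_univ _)) := FiniteDimensional.fintypeBasisIndex b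
  let i0 : hli.extend (Set.subset_univ _) := ⟨1, h1m⟩
  have hb0 : b i0 = 1 := by simp [b, i0]
  obtain ⟨c, hc⟩ := DD_basis Z F τ hR hf b
  have hT1 : Thet (R := R) Z τ (1 : Z) = fun _ => 1 := by ext1 η; simp [Thet]
  have hsum := hlin b b.linearIndependent
    (fun i => (c i : W) - if i = i0 then f 1 else 0) (fun i => by
      refine (F).sub_mem (c i).2 ?_
      split_ifs; exacts [h1, (F).zero_mem]) (by
      simp only [sub_mul, Finset.sum_sub_distrib]
      have e1 : ∑ i, (c i : W) * τ (b i) = f 1 := by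
        conv_rhs => rw [hc]
        simp [Finset.sum_apply, Thet, Subfield.smul_def]
      rw [e1]
      simp [ite_mul, hb0])
  intro η
  have e2 : ∀ η, f η = c i0 := by
    intro η
    rw [hc, Finset.sum_apply, Finset.sum_eq_single i0]
    · simp [hb0, hT1, Subfield.smul_def]
    · intro i _ hi
      have := hsum i
      simp only [hi, if_false, sub_zero] at this
      simp [Subfield.smul_def, this]
    · simp
  rw [e2, e2]

variable [IsGalois (R) Z]

theorem Thet_sum (z : Z) [Fintype (Z ≃ₐ[R] Z)] :
    ∑ η, Thet (R := R) Z τ z η = τ (algebraMap R Z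
          (Algebra.trace (R) Z z)) := by
  simp only [Thet, ← map_sum]
  congr 1
  rw [trace_eq_sum_automorphisms]
  refine Finset.sum_congr ?_ fun _ _ => rfl
  ext; simp

theorem DD_P2 (hR : ∀ r : R, τ (algebraMap R Z r) ∈ F) (w : W) (hf : (fun _ => w) ∈ DD (R := R) Z F τ) : w ∈ F := by
  classical
  have : Fintype (Z ≃ₐ[R] Z) := Fintype.ofFinite _
  have hmem : ∀ f ∈ DD (R := R) Z F τ, ∑ η, f η ∈ F := by
    intro f hf
    induction hf using Submodule.span_induction with
    | mem x hx =>
      obtain ⟨z, rfl⟩ := hx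
      rw [Thet_sum]
      exact hR _
    | zero => simp
    | add x y _ _ hx hy =>
      simpa [Finset.sum_add_distrib] using (F).add_mem hx hy
    | smul a x _ hx =>
      have : ∑ η, (a • x) η = a * ∑ η, x η := by
        simp [Finset.mul_sum, Subfield.smul_def]
      rw [this]
      exact (F).mul_mem a.2 hx
  obtain ⟨δ, hδ⟩ : ∃ δ, Algebra.trace (R) Z δ ≠ 0 := by
    by_contra h
    push Not at h
    exact Algebra.trace_ne_zero (R) Z (LinearMap.ext h)
  have h1 := hmem _ (DD_mul Z F τ hf (Submodule.subset_span ⟨δ, rfl⟩ : Thet (R := R) Z τ δ ∈ DD (R := R) Z F τ))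
  simp only [Pi.mul_apply, ← Finset.mul_sum, Thet_sum] at h1
  have h3 : τ (algebraMap R Z
          (Algebra.trace (R) Z δ)) ≠ 0 := by
    rw [Ne, map_eq_zero, map_eq_zero]; exact hδ
  have := (F).div_mem h1 (hR (Algebra.trace (R) Z δ))
  rwa [mul_div_assoc, div_self h3, mul_one] at this

theorem loc_exists {G Q : Type} [Group G] [Finite G] [Field Q] (τ : Z →+* WW Q)
    (hR : ∀ r : R, τ (algebraMap R Z r) ∈ F2 Q)
    (hlin : ∀ {ι : Type} [Fintype ι] (z : ι → Z), LinearIndependent R z → ∀ c : ι → WW Q,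
      (∀ i, c i ∈ F2 Q) → ∑ i, c i * τ (z i) = 0 → ∀ i, c i = 0) (κ : (Z ≃ₐ[R] Z) →* G)
    (hκ : Function.Injective κ) : ∃ S : Subring (G → WW Q), IsLoc κ.range S := by
  classical
  have : Fintype (Z ≃ₐ[R] Z) := Fintype.ofFinite _
  have : Fintype G := Fintype.ofFinite _
  let S : Subring (G → WW Q) :=
  { carrier := {f | ∀ g, (fun η => f (κ η * g)) ∈ DD (R := R) Z (F2 Q) τ}
    mul_mem' := fun hx hy g => DD_mul Z (F2 Q) τ (hx g) (hy g)
    one_mem' := fun g => DD_const Z (F2 Q) τ 1 (F2 Q).one_mem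
    add_mem' := fun hx hy g => Submodule.add_mem _ (hx g) (hy g)
    zero_mem' := fun g => Submodule.zero_mem _
    neg_mem' := fun hx g => Submodule.neg_mem _ (hx g) }
  have hS : ∀ f, f ∈ S ↔ ∀ g, (fun η => f (κ η * g)) ∈ DD (R := R) Z (F2 Q) τ := fun f => Iff.rfl
  have hconst : ∀ f : G → WW Q, (∀ g, f g ∈ F2 Q) → (∀ c ∈ κ.range, ∀ g, f (c * g) = f g) → f ∈ S := by
    intro f h1 h2 g
    have : (fun η => f (κ η * g)) = fun _ => f g := by
      ext1 η; exact h2 _ ⟨η, rfl⟩ g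
    rw [this]
    exact DD_const Z (F2 Q) τ _ (h1 g)
  refine ⟨S, hconst, ?_, ?_, ?_, ?_⟩
  · intro f hf g0 g
    simpa [mul_assoc] using hf (g * g0)
  · intro f hf g h
    apply DD_P2 (R := R) Z (F2 Q) τ hR
    convert hf g using 2 with η
    exact (h _ ⟨η, rfl⟩).symm
  · rintro f hf g h _ ⟨η, rfl⟩
    have := DD_P1 Z (F2 Q) τ hR hlin (hf g) (by simpa using h) η
    simpa using this
  · -- density
    let θ : (Z ≃ₐ[R] Z) → (Z →+* WW Q) := fun η =>
      τ.comp (η : Z →+* Z)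
    have hθ : Function.Injective θ := by
      intro η η' h
      refine AlgEquiv.ext fun z => ?_
      have := DFunLike.congr_fun h z
      exact τ.injective this
    obtain ⟨n, z, v, hv⟩ := char_span θ hθ
    have hmain : ∀ h : G, ∃ u : G → WW Q, u ∈ S ∧
        ∀ g m, m ≤ 0 → (u g).coeff m = if m = 0 ∧ g = h then 1 else 0 := by
      intro h
      have hbd : ∃ a : ℤ, ∀ l η, ∀ i < a, (θ η (z l)).coeff i = 0 := by
        have : ∀ p : Fin n × (Z ≃ₐ[R] Z), ∃ a : ℤ, ∀ i < a, (θ p.2 (z p.1)).coeff i = 0 :=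
          fun p => ls_bdd _
        choose a ha using this
        obtain ⟨a0, ha0⟩ := (Set.finite_range a).bddBelow
        exact ⟨a0, fun l η i hi => ha (l, η) i (lt_of_lt_of_le hi (ha0 ⟨(l, η), rfl⟩))⟩
      obtain ⟨a, ha⟩ := hbd
      have htr := fun l => F2_trunc (v l 1) (1 - a)
      choose v' hv' hvv using htr
      let d : (Z ≃ₐ[R] Z) → WW Q := fun η => ∑ l, v' l * θ η (z l)
      have hd : d ∈ DD (R := R) Z (F2 Q) τ := by
        have : d = ∑ l, (⟨v' l, hv' l⟩ : F2 Q) • Thet (R := R) Z τ (z l) := by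
          ext1 η; simp [d, Finset.sum_apply, Subfield.smul_def, Thet, θ]
        rw [this]
        exact Submodule.sum_mem _ fun l _ => Submodule.smul_mem _ _ (Submodule.subset_span ⟨_, rfl⟩)
      have hdc : ∀ η m, m ≤ 0 → (d η).coeff m = if m = 0 ∧ η = 1 then 1 else 0 := by
        intro η m hm
        have h1 : (d η).coeff m = (∑ l, v l 1 * θ η (z l)).coeff m := by
          rw [← sub_eq_zero, ← HahnSeries.coeff_sub, ← Finset.sum_sub_distrib, HahnSeries.coeff_sum]
          refine Finset.sum_eq_zero fun l _ => ?_
          rw [← sub_mul, ls_mulc _ _ (1 - a) a _ (ha l η)]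
          · rw [Finset.Icc_eq_empty (by lia), Finset.sum_empty]
          · intro i hi
            rw [← neg_sub, HahnSeries.coeff_neg, hvv l i hi, neg_zero]
        rw [h1, hv η 1]
        by_cases hη : η = 1
        · simp [hη, HahnSeries.coeff_one]
        · simp [hη]
      let u : G → WW Q := fun g => if hg : ∃ η, κ η * h = g then d hg.choose else 0
      have hu1 : ∀ η, u (κ η * h) = d η := by
        intro η
        have hex : ∃ η', κ η' * h = κ η * h := ⟨η, rfl⟩
        simp only [u, dif_pos hex]
        congr 1
        exact hκ (mul_right_cancel hex.choose_spec)
      refine ⟨u, ?_, ?_⟩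
      · intro g
        by_cases hg : ∃ η, κ η * h = g
        · obtain ⟨η0, rfl⟩ := hg
          have : (fun η => u (κ η * (κ η0 * h))) = fun η => d (η * η0) := by
            ext1 η
            rw [← mul_assoc, ← map_mul, hu1]
          rw [this]
          exact DD_trans Z (F2 Q) τ hd η0
        · have : (fun η => u (κ η * g)) = 0 := by
            ext1 η
            have hne : ¬ ∃ η', κ η' * h = κ η * g := by
              rintro ⟨η', h'⟩
              apply hg
              refine ⟨η⁻¹ * η', ?_⟩
              rw [map_mul, mul_assoc, h', map_inv, inv_mul_cancel_left]
            simp only [u, dif_neg hne, Pi.zero_apply]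
          rw [this]
          exact Submodule.zero_mem _
      · intro g m hm
        by_cases hg : ∃ η, κ η * h = g
        · obtain ⟨η, rfl⟩ := hg
          rw [hu1, hdc η m hm]
          have : κ η * h = h ↔ η = 1 := by
            rw [mul_eq_right, map_eq_one_iff _ hκ]
          simp [this]
        · have h2 : g ≠ h := by rintro rfl; exact hg ⟨1, by simp⟩
          simp only [u, dif_neg hg, h2]
          simp
    choose u hu using hmain
    exact ⟨u, hu⟩

open scoped RatFunc in
theorem loc_exists' {G Q : Type} [Group G] [Finite G] [Field Q]
    (Z : IntermediateField (RatFunc Q) (LaurentSeries Q)) [FiniteDimensional (RatFunc Q) Z]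
    [IsGalois (RatFunc Q) Z] (κ : (Z ≃ₐ[RatFunc Q] Z) →* G)
    (hκ : Function.Injective κ) : ∃ S : Subring (G → WW Q), IsLoc κ.range S := by
  refine loc_exists (R := RatFunc Q) Z ((tau Q).comp (algebraMap Z (LaurentSeries Q))) ?_ ?_ κ hκ
  · intro r
    exact tau_ratFunc r
  · intro ι _ z hz c hc h0
    exact tau_lin (fun i => ((z i : Z) : LaurentSeries Q))
      (hz.map' (Z.val.toLinearMap) (LinearMap.ker_eq_bot_of_injective Z.val.injective)) c hc h0

end A3

section A4
open HahnSeries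

theorem ls_ord {R : Type*} [Field R] (x : LaurentSeries R) (hx : x ≠ 0) :
    ∃ a : ℤ, x.coeff a ≠ 0 ∧ (∀ i < a, x.coeff i = 0) ∧ (∀ i < -a, (x⁻¹).coeff i = 0) := by
  refine ⟨x.order, ?_, fun i hi => HahnSeries.coeff_eq_zero_of_lt_order hi, fun i hi => ?_⟩
  · exact HahnSeries.coeff_order_eq_zero.not.2 hx
  · apply HahnSeries.coeff_eq_zero_of_lt_order
    have := HahnSeries.order_mul hx (inv_ne_zero hx)
    rw [mul_inv_cancel₀ hx, HahnSeries.order_one] at this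
    omega

theorem ls_mul_bdd {R : Type*} [CommRing R] (x y : LaurentSeries R) (a b : ℤ)
    (hx : ∀ i < a, x.coeff i = 0) (hy : ∀ i < b, y.coeff i = 0) : ∀ i < a + b, (x * y).coeff i = 0 := by
  intro i hi
  rw [ls_mulc x y a b hx hy, Finset.Icc_eq_empty (by omega), Finset.sum_empty]

theorem div1 {Q : Type*} [Field Q] (b : LaurentSeries Q) (hb : b ≠ 0) (hb' : b ∈ psub Q) :
    ∃ d : ℕ, ∀ u : LaurentSeries Q, ∃ q ∈ psub Q, ∀ i ≥ (d:ℤ), (u - q * b).coeff i = 0 := by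
  obtain ⟨a, ha, ha1, ha2⟩ := ls_ord b hb
  have ha0 : 0 ≤ a := by
    by_contra h
    exact ha ((mem_psub b).1 hb' a (by omega))
  refine ⟨a.toNat, fun u => ?_⟩
  obtain ⟨v, hv⟩ := ls_mk (fun i => if a ≤ i then u.coeff i else 0) a (fun i hi => by simp; omega)
  refine ⟨v * b⁻¹, ?_, fun i hi => ?_⟩
  · rw [mem_psub]
    intro e he
    exact ls_mul_bdd v _ a (-a) (fun i hi => by rw [hv, if_neg (by omega)]) ha2 _ (by omega)
  · rw [mul_assoc, inv_mul_cancel₀ hb, mul_one, HahnSeries.coeff_sub, hv, if_pos (by omega), sub_self]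

theorem div2 {Q : Type*} [Field Q] (b : WW Q) (hb : b ≠ 0) (hb' : b ∈ OO Q) :
    ∃ d : ℕ, ∀ w : WW Q, ∃ q ∈ OO Q, ∀ m, ∀ i ≥ (d:ℤ), ((w - b * q).coeff m).coeff i = 0 := by
  obtain ⟨a, ha, ha1, -⟩ := ls_ord b hb
  obtain ⟨d, hd⟩ := div1 (b.coeff a) ha (mem_lsub.1 hb' a)
  refine ⟨d, fun w => ?_⟩
  obtain ⟨w0, hw0⟩ := ls_bdd w
  obtain ⟨q, hq⟩ := rec_exists (A := LaurentSeries Q) (fun m f x => x ∈ psub Q ∧ ∀ i ≥ (d:ℤ),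
    ((w.coeff (w0 + m) - ∑ l ∈ Finset.range m, f l * b.coeff (a + m - l)) - x * b.coeff a).coeff i = 0)
    (fun m f => by
      obtain ⟨x, hx, hx'⟩ := hd (w.coeff (w0 + m) - ∑ l ∈ Finset.range m, f l * b.coeff (a + m - l))
      exact ⟨x, hx, hx'⟩)
  obtain ⟨z, hz⟩ := ls_mk (fun i => if w0 - a ≤ i then q (i - (w0 - a)).toNat else 0) (w0 - a)
    (fun i hi => by simp; omega)
  have hz0 : ∀ i < w0 - a, z.coeff i = 0 := fun i hi => by rw [hz, if_neg (by omega)]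
  refine ⟨z, mem_lsub.2 fun i => ?_, fun m i hi => ?_⟩
  · rw [hz]; split_ifs
    · exact (hq _).1
    · exact zero_mem _
  · by_cases hm : m < w0
    · rw [HahnSeries.coeff_sub, hw0 m hm, ls_mul_bdd b z a (w0 - a) ha1 hz0 m (by omega)]; simp
    · obtain ⟨n, rfl⟩ : ∃ n : ℕ, m = w0 + n := ⟨(m - w0).toNat, by omega⟩
      have h1 := (hq n).2 i hi
      rw [← h1]; congr 1
      rw [HahnSeries.coeff_sub, sub_sub]; congr 1
      rw [mul_comm b z, ls_mulc z b (w0 - a) a hz0 ha1]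
      have : (∑ l ∈ Finset.range n, (if l < n then q l else default) * b.coeff (a + n - l)) + q n * b.coeff a
         = ∑ l ∈ Finset.range (n+1), q l * b.coeff (a + n - l) := by
        rw [Finset.sum_range_succ]
        congr 1
        · refine Finset.sum_congr rfl fun l hl => ?_
          rw [if_pos (Finset.mem_range.1 hl)]
        · congr 2; omega
      rw [this]
      symm
      refine Finset.sum_bij (fun l _ => (w0 - a) + (l:ℤ)) ?_ ?_ ?_ ?_
      · intro l hl; simp at hl ⊢; omega
      · intro l _ l' _ h; simpa using h
      · intro j hj; simp at hj
        exact ⟨(j - (w0 - a)).toNat, by simp; omega, by omega⟩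
      · intro l hl
        rw [hz, if_pos (by omega)]
        congr 2
        · congr 1; omega
        · omega

/-- scalar embedding -/
noncomputable def iK (F Q : Type*) [Field F] [Field Q] [Algebra F Q] : LaurentSeries F →+* WW Q :=
  lmap ((HahnSeries.C : Q →+* LaurentSeries Q).comp (algebraMap F Q))

theorem iK_coeff {F Q : Type*} [Field F] [Field Q] [Algebra F Q] (f : LaurentSeries F) (m : ℤ) :
    (iK F Q f).coeff m = HahnSeries.C (algebraMap F Q (f.coeff m)) := rfl

theorem rho_ex {F Q : Type*} [Field F] [Field Q] [Algebra F Q] (l : Q →ₗ[F] F) (i : ℤ) :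
    ∃ ρ : WW Q →+ LaurentSeries F, (∀ w m, (ρ w).coeff m = l ((w.coeff m).coeff i)) ∧
      ∀ f w, ρ (iK F Q f * w) = f * ρ w := by
  have hc : ∀ w : WW Q, ∃ x : LaurentSeries F, ∀ m, x.coeff m = l ((w.coeff m).coeff i) := fun w => by
    obtain ⟨a, ha⟩ := ls_bdd w
    exact ls_mk _ a fun m hm => by rw [ha m hm]; simp
  choose ρ hρ using hc
  refine ⟨AddMonoidHom.mk' ρ fun x y => ?_, hρ, fun f w => ?_⟩
  · ext m; simp [hρ]
  · obtain ⟨a, ha⟩ := ls_bdd w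
    obtain ⟨b, hb⟩ := ls_bdd f
    ext m
    change (ρ _).coeff m = (f * ρ w).coeff m
    rw [hρ, ls_mulc f (ρ w) b a hb (fun i hi => by rw [hρ, ha i hi]; simp), ls_mulc (iK F Q f) w b a
      (fun i hi => by rw [iK_coeff, hb i hi]; simp) ha]
    rw [HahnSeries.coeff_sum, map_sum]
    refine Finset.sum_congr rfl fun j _ => ?_
    rw [hρ, iK_coeff, HahnSeries.C_mul_eq_smul, HahnSeries.coeff_smul, smul_eq_mul, ← Algebra.smul_def, map_smul, smul_eq_mul]

theorem DIV {F Q : Type*} [Field F] [Field Q] [Algebra F Q] [FiniteDimensional F Q] (x : WW Q)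
    (hx : x ∈ OO Q) (b : WW Q) (hb : b ≠ 0) (hb' : b ∈ OO Q) :
    ∃ B : Polynomial (LaurentSeries F), B ≠ 0 ∧ ∃ o ∈ OO Q, B.eval₂ (iK F Q) x = b * o := by
  obtain ⟨d, hd⟩ := div2 b hb hb'
  let e := Module.finBasis F Q
  choose ρ hρ hρ' using fun (p : Fin (Module.finrank F Q) × Fin d) => rho_ex (e.coord p.1) (p.2 : ℤ)
  choose q hq hqd using hd
  let N := Fintype.card (Fin (Module.finrank F Q) × Fin d)
  let v : Fin (N+1) → (Fin (Module.finrank F Q) × Fin d → LaurentSeries F) :=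
    fun j p => ρ p (x ^ (j:ℕ) - b * q (x ^ (j:ℕ)))
  have hv : ¬ LinearIndependent (LaurentSeries F) v := by
    intro h
    have := h.fintype_card_le_finrank
    simp [N] at this
  rw [Fintype.not_linearIndependent_iff] at hv
  obtain ⟨g, hg, j0, hj0⟩ := hv
  have hS : ∑ j, iK F Q (g j) * (x ^ (j:ℕ) - b * q (x ^ (j:ℕ))) = 0 := by
    have hOO : ∀ j : Fin (N+1), x ^ (j:ℕ) - b * q (x ^ (j:ℕ)) ∈ OO Q := fun j =>
      sub_mem (pow_mem hx _) (mul_mem hb' (hq _))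
    have hI : ∀ f, iK F Q f ∈ OO Q := fun f => mem_lsub.2 fun i => by
      rw [iK_coeff, mem_psub]; intro e he
      rw [HahnSeries.C_apply, HahnSeries.coeff_single_of_ne (by omega)]
    ext m i
    by_cases hi : i < 0
    · have := (mem_psub _).1 (mem_lsub.1 (sum_mem fun j (_ : j ∈ Finset.univ) => mul_mem (hI (g j)) (hOO j)) m) i hi
      rw [this]; rfl
    · by_cases hi2 : i < d
      · obtain ⟨i', rfl⟩ : ∃ i' : Fin d, i = (i' : ℤ) := ⟨⟨i.toNat, by omega⟩, by simp; omega⟩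
        apply e.ext_elem
        intro s
        have h1 := congrFun hg (s, i')
        have h2 := congrArg (fun y : LaurentSeries F => y.coeff m) ((map_sum (ρ (s, i')) (fun j => iK F Q (g j) * (x ^ (j:ℕ) - b * q (x ^ (j:ℕ)))) Finset.univ))
        simp only [hρ'] at h2
        simp only [Finset.sum_apply, Pi.smul_apply, smul_eq_mul, v] at h1
        rw [h1, hρ] at h2
        simpa using h2
      · rw [HahnSeries.coeff_sum, HahnSeries.coeff_sum]
        refine Finset.sum_eq_zero fun j _ => ?_
        obtain ⟨a, ha⟩ := ls_bdd (x ^ (j:ℕ) - b * q (x ^ (j:ℕ)))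
        obtain ⟨a', ha'⟩ := ls_bdd (g j)
        rw [ls_mulc (iK F Q (g j)) _ a' a (fun i hi => by rw [iK_coeff, ha' i hi]; simp) ha, HahnSeries.coeff_sum]
        refine Finset.sum_eq_zero fun l _ => ?_
        rw [iK_coeff, HahnSeries.C_mul_eq_smul, HahnSeries.coeff_smul, hqd _ _ _ (by omega), smul_zero]
  have hS2 : ∑ j, iK F Q (g j) * x ^ (j:ℕ) = b * ∑ j, iK F Q (g j) * q (x ^ (j:ℕ)) := by
    rw [← sub_eq_zero, Finset.mul_sum, ← Finset.sum_sub_distrib, ← hS]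
    refine Finset.sum_congr rfl fun j _ => by ring
  refine ⟨∑ j : Fin (N+1), Polynomial.monomial (j:ℕ) (g j), ?_, ∑ j, iK F Q (g j) * q (x ^ (j:ℕ)), ?_, ?_⟩
  · intro h
    apply hj0
    have := congrArg (fun p => p.coeff (j0:ℕ)) h
    simp only [Polynomial.finsetSum_coeff, Polynomial.coeff_monomial, Polynomial.coeff_zero] at this
    rw [← this, Finset.sum_eq_single j0]
    · simp
    · intro j _ hj; rw [if_neg]; exact fun h => hj (Fin.ext h)
    · simp
  · refine sum_mem fun j _ => mul_mem ?_ (hq _)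
    refine mem_lsub.2 fun i => ?_
    rw [iK_coeff, mem_psub]; intro e he
    rw [HahnSeries.C_apply, HahnSeries.coeff_single_of_ne (by omega)]
  · rw [← hS2, Polynomial.eval₂_finsetSum]
    simp [Polynomial.eval₂_monomial]

end A4

section A5
open Polynomial

theorem sepdvd {F Q : Type*} [Field F] [Field Q] [Algebra F Q] (p : F[X]) (hp : Irreducible p)
    (hs : p.Separable) (c : Q) (hc : p.aeval c = 0) (a : ℕ) (q : F[X])
    (h : (X - C c) ^ a ∣ q.map (algebraMap F Q)) : p ^ a ∣ q := by
  induction a generalizing q with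
  | zero => simp
  | succ a ih =>
    obtain ⟨q', rfl⟩ := ih q (dvd_trans (pow_dvd_pow _ (Nat.le_succ a)) h)
    have hr : (X - C c) ∣ p.map (algebraMap F Q) := by
      rw [dvd_iff_isRoot, IsRoot, eval_map_algebraMap, hc]
    obtain ⟨r, hr⟩ := hr
    have hrc : r.eval c ≠ 0 := by
      intro h0
      obtain ⟨r', rfl⟩ := (dvd_iff_isRoot.2 h0 : (X - C c) ∣ r)
      have h2 := hs.map (f := algebraMap F Q)
      have := h2.squarefree (X - C c) ⟨r', by rw [hr]; ring⟩
      exact not_isUnit_X_sub_C c this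
    rw [Polynomial.map_mul, Polynomial.map_pow, hr, mul_pow, pow_succ, mul_assoc] at h
    have h3 := (mul_dvd_mul_iff_left (pow_ne_zero a (X_sub_C_ne_zero c))).1 h
    rw [dvd_iff_isRoot, IsRoot, eval_mul, eval_pow, mul_eq_zero, or_iff_right (pow_ne_zero _ hrc), eval_map_algebraMap] at h3
    rw [pow_succ]
    refine mul_dvd_mul_left _ ?_
    rcases (em (p ∣ q')).symm.imp_left (hp.coprime_iff_not_dvd.2) with h4 | h4
    · obtain ⟨u, v, huv⟩ := h4
      have := congrArg (aeval c) huv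
      simp [hc, h3] at this
    · exact h4

/-- evaluation at `c + π` -/
noncomputable def evP {F Q : Type*} [Field F] [Field Q] (f : F →+* Q) (c : Q) : F[X] →+* LaurentSeries Q :=
  eval₂RingHom ((HahnSeries.C : Q →+* LaurentSeries Q).comp f) (HahnSeries.C c + HahnSeries.single 1 1)

theorem evP_eq {F Q : Type*} [Field F] [Field Q] (f : F →+* Q) (c : Q) (q : F[X]) (m : ℤ) :
    (evP f c q).coeff m = if m < 0 then 0 else (taylor c (q.map f)).coeff m.toNat := by
  have h : evP f c q = HahnSeries.ofPowerSeries ℤ Q ((taylor c (q.map f) : Q[X]) : PowerSeries Q) := by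
    have : evP f c = ((HahnSeries.ofPowerSeries ℤ Q).comp (Polynomial.coeToPowerSeries.ringHom)).comp
        ((taylorAlgHom c : Q[X] →ₐ[Q] Q[X]).toRingHom.comp (mapRingHom f)) := by
      apply Polynomial.ringHom_ext
      · intro a; simp [evP]
      · simp [evP, add_comm]
    rw [this]; rfl
  rw [h, PowerSeries.coeff_coe]
  split_ifs with h1
  · rfl
  · simp [show m.natAbs = m.toNat by omega]

theorem evP_psub {F Q : Type*} [Field F] [Field Q] (f : F →+* Q) (c : Q) (q : F[X]) : evP f c q ∈ psub Q := by
  rw [mem_psub]; intro e he; rw [evP_eq, if_pos he]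

theorem evP_inj {F Q : Type*} [Field F] [Field Q] (f : F →+* Q) (c : Q) :
    Function.Injective (evP f c) := by
  rw [injective_iff_map_eq_zero]
  intro q hq
  have : taylor c (q.map f) = 0 := by
    ext n
    have := evP_eq f c q n
    rw [hq, if_neg (by omega)] at this
    simpa using this.symm
  rw [taylor_eq_zero, Polynomial.map_eq_zero] at this
  exact this

theorem evP_dvd {F Q : Type*} [Field F] [Field Q] (f : F →+* Q) (c : Q) (q : F[X]) (a : ℕ)
    (h : ∀ m < (a:ℤ), (evP f c q).coeff m = 0) : (X - C c) ^ a ∣ q.map f := by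
  rw [X_sub_C_pow_dvd_iff, X_pow_dvd_iff]
  intro d hd
  have := h d (by omega)
  rw [evP_eq, if_neg (by omega)] at this
  simpa [taylor_apply] using this

section
variable {F Q : Type*} [Field F] [Field Q] [Algebra F Q] [FiniteDimensional F Q]
  [Algebra.IsSeparable F Q] {ι : Type*} [Fintype ι]

noncomputable def PP (F : Type*) {Q : Type*} [Field F] [Field Q] [Algebra F Q] {ι : Type*} [Fintype ι] (c : ι → Q) : F[X] := ∏ i, minpoly F (c i)

theorem mp_coprime (c : ι → Q) (hc : ∀ i j, i ≠ j → minpoly F (c i) ≠ minpoly F (c j)) (i j : ι) (hij : i ≠ j) :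
    IsCoprime (minpoly F (c i)) (minpoly F (c j)) := by
  have hi := minpoly.irreducible (Algebra.IsIntegral.isIntegral (R := F) (c i))
  have hj := minpoly.irreducible (Algebra.IsIntegral.isIntegral (R := F) (c j))
  rcases (em (minpoly F (c i) ∣ minpoly F (c j))).symm.imp_left (hi.coprime_iff_not_dvd.2) with h | h
  · exact h
  · exact absurd (eq_of_monic_of_associated (minpoly.monic (Algebra.IsIntegral.isIntegral (c i)))
      (minpoly.monic (Algebra.IsIntegral.isIntegral (c j))) (hi.associated_of_dvd hj h)) (hc i j hij)

theorem PP_monic (c : ι → Q) : (PP F c).Monic :=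
  monic_prod_of_monic _ _ fun i _ => minpoly.monic (Algebra.IsIntegral.isIntegral (c i))

theorem PP_dvd (c : ι → Q) (hc : ∀ i j, i ≠ j → minpoly F (c i) ≠ minpoly F (c j)) (a : ℕ) (q : F[X])
    (h : ∀ i, (X - C (c i)) ^ a ∣ q.map (algebraMap F Q)) : (PP F c) ^ a ∣ q := by
  rw [PP, ← Finset.prod_pow]
  refine Finset.prod_dvd_of_coprime ?_ ?_
  · intro i _ j _ hij
    exact (mp_coprime c hc i j hij).pow
  · intro i _
    exact sepdvd _ (minpoly.irreducible (Algebra.IsIntegral.isIntegral (c i)))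
      (Algebra.IsSeparable.isSeparable F (c i)) (c i) (minpoly.aeval _ _) a q (h i)

theorem PP_sep (c : ι → Q) (hc : ∀ i j, i ≠ j → minpoly F (c i) ≠ minpoly F (c j)) : (PP F c).Separable := by
  refine separable_prod' ?_ ?_
  · intro i _ j _ hij
    exact (mp_coprime c hc i j hij)
  · intro i _
    exact (Algebra.IsSeparable.isSeparable F (c i))

theorem evP_PP (c : ι → Q) (hc : ∀ i j, i ≠ j → minpoly F (c i) ≠ minpoly F (c j)) (i : ι) :
    (∀ m < 1, (evP (algebraMap F Q) (c i) (PP F c)).coeff m = 0) ∧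
    (∀ m < -1, ((evP (algebraMap F Q) (c i) (PP F c))⁻¹).coeff m = 0) := by
  have h0 : evP (algebraMap F Q) (c i) (PP F c) ≠ 0 := by
    rw [Ne, map_eq_zero_iff _ (evP_inj _ _)]; exact (PP_monic c).ne_zero
  obtain ⟨a, ha, ha1, ha2⟩ := ls_ord _ h0
  have hr : (PP F c).aeval (c i) = 0 := by
    rw [PP, map_prod]
    exact Finset.prod_eq_zero (Finset.mem_univ i) (minpoly.aeval _ _)
  have h1 : 1 ≤ a := by
    by_contra h
    apply ha
    rw [evP_eq]
    split_ifs with h2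
    · rfl
    · rw [show a.toNat = 0 by omega, taylor_coeff_zero, eval_map_algebraMap, hr]
  have h2 : a ≤ 1 := by
    by_contra h
    have h3 := evP_dvd (algebraMap F Q) (c i) (PP F c) 2 (fun m hm => ha1 m (by push_cast at hm; omega))
    have h4 := ((PP_sep c hc).map (f := algebraMap F Q)).squarefree (X - C (c i)) (by rw [← pow_two]; exact h3)
    exact not_isUnit_X_sub_C (c i) h4
  obtain rfl : a = 1 := by omega
  exact ⟨ha1, ha2⟩

theorem ls_pow_bdd {R : Type*} [CommRing R] (x : LaurentSeries R) (a : ℤ)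
    (hx : ∀ i < a, x.coeff i = 0) (n : ℕ) : ∀ i < n * a, (x ^ n).coeff i = 0 := by
  induction n with
  | zero => intro i hi; simp at hi; simp [HahnSeries.coeff_one]; omega
  | succ n ih =>
    rw [pow_succ]
    intro i hi
    exact ls_mul_bdd _ _ (n*a) a ih hx i (by push_cast at hi; linarith)

theorem pp_scalar (c : ι → Q) (hc : ∀ i j, i ≠ j → minpoly F (c i) ≠ minpoly F (c j))
    (hg : ∀ i, (minpoly F (c i)).natDegree = Module.finrank F Q) (τ : ι → LaurentSeries Q) :
    ∃ (a : ℕ) (q : F[X]), q.natDegree ≤ a * (PP F c).natDegree ∧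
      ∀ i, evP (algebraMap F Q) (c i) q * ((evP (algebraMap F Q) (c i) (PP F c))⁻¹) ^ a - τ i ∈ psub Q := by
  classical
  obtain ⟨a, ha⟩ : ∃ a : ℕ, ∀ i, ∀ m < -(a:ℤ), (τ i).coeff m = 0 := by
    choose b hb using fun i => ls_bdd (τ i)
    refine ⟨∑ i, (b i).natAbs, fun i m hm => hb i m ?_⟩
    have := Finset.single_le_sum (f := fun i => (b i).natAbs) (fun _ _ => Nat.zero_le _) (Finset.mem_univ i)

    omega
  have hP0 : ∀ i, evP (algebraMap F Q) (c i) (PP F c) ≠ 0 := fun i => by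
    rw [Ne, map_eq_zero_iff _ (evP_inj _ _)]; exact (PP_monic c).ne_zero
  let φ : degreeLT F (a * (PP F c).natDegree) →ₗ[F] (ι → Fin a → Q) :=
    { toFun := fun q i j => (taylor (c i) ((q : F[X]).map (algebraMap F Q))).coeff j
      map_add' := fun x y => by ext i j; simp
      map_smul' := fun x y => by ext i j; simp [Algebra.smul_def, Polynomial.smul_eq_C_mul] }
  have hφ : Function.Injective φ := by
    rw [injective_iff_map_eq_zero]
    rintro ⟨q, hq⟩ h
    rw [mem_degreeLT] at hq
    have hd := PP_dvd c hc a q (fun i => evP_dvd _ _ _ _ fun m hm => by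
      rw [evP_eq]
      split_ifs with h1
      · rfl
      · exact congrFun (congrFun h i) ⟨m.toNat, by omega⟩)
    by_contra h0
    have hq0 : q ≠ 0 := fun h => h0 (Subtype.ext h)
    have := natDegree_le_of_dvd hd hq0
    rw [natDegree_pow] at this
    rw [degree_eq_natDegree hq0] at hq
    have : q.natDegree < a * (PP F c).natDegree := by exact_mod_cast hq
    omega
  have hfr : Module.finrank F (degreeLT F (a * (PP F c).natDegree)) = Module.finrank F (ι → Fin a → Q) := by
    rw [(degreeLTEquiv F _).finrank_eq, Module.finrank_fin_fun, Module.finrank_pi_fintype]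
    simp only [Module.finrank_pi_fintype, Finset.sum_const, Finset.card_univ, Fintype.card_fin, smul_eq_mul]
    rw [PP, natDegree_prod_of_monic _ _ (fun i _ => minpoly.monic (Algebra.IsIntegral.isIntegral (c i))),
      Finset.sum_congr rfl (fun i _ => hg i)]
    simp; ring
  haveI : FiniteDimensional F (degreeLT F (a * (PP F c).natDegree)) :=
    Module.Finite.equiv (degreeLTEquiv F _).symm
  have hs : Function.Surjective φ := (LinearMap.injective_iff_surjective_of_finrank_eq_finrank hfr).1 hφ
  obtain ⟨⟨q, hq⟩, hq'⟩ := hs (fun i j => (τ i * evP (algebraMap F Q) (c i) (PP F c) ^ a).coeff (j:ℕ))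
  have hqd : q.natDegree ≤ a * (PP F c).natDegree := by
    rw [mem_degreeLT] at hq
    exact natDegree_le_of_degree_le hq.le
  refine ⟨a, q, hqd, fun i => ?_⟩
  obtain ⟨h1, h2⟩ := evP_PP c hc i
  have h3 : evP (algebraMap F Q) (c i) q * ((evP (algebraMap F Q) (c i) (PP F c))⁻¹) ^ a - τ i =
    (evP (algebraMap F Q) (c i) q - τ i * evP (algebraMap F Q) (c i) (PP F c) ^ a) * ((evP (algebraMap F Q) (c i) (PP F c))⁻¹) ^ a := by
    rw [sub_mul, mul_assoc, ← mul_pow, mul_inv_cancel₀ (hP0 i), one_pow, mul_one]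
  rw [h3, mem_psub]
  intro e he
  refine ls_mul_bdd _ _ a (-a) ?_ ?_ e (by omega)
  · intro m hm
    rw [HahnSeries.coeff_sub, sub_eq_zero, evP_eq]
    split_ifs with h4
    · symm
      have := ls_mul_bdd (τ i) (evP (algebraMap F Q) (c i) (PP F c) ^ a) (-a) a (ha i) (by
        have := ls_pow_bdd _ 1 h1 a; rwa [mul_one] at this)
      exact this m (by omega)
    · have := congrFun (congrFun hq' i) ⟨m.toNat, by omega⟩
      simp only [φ, LinearMap.coe_mk, AddHom.coe_mk] at this
      rw [this]; congr 1; omega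
  · have := ls_pow_bdd _ (-1) h2 a
    rwa [mul_neg_one] at this
end
end A5

section A6
open Polynomial

section
variable {G M R Q : Type} [Field M] [Field R] [Field Q] [Group G] [MulSemiringAction G M]
  [Algebra M[X] R] [IsFractionRing M[X] R] [Algebra M Q]

theorem aR_inj (R : Type) [Field R] [Algebra M[X] R] [IsFractionRing M[X] R] (g : G) : Function.Injective ((algebraMap M[X] R).comp (mapRingHom (MulSemiringAction.toRingHom G M g))) :=
  (IsFractionRing.injective M[X] R).comp (map_injective _ (MulSemiringAction.toRingHom G M g).injective)

noncomputable def aR (M : Type) {G R : Type} [Field M] [Field R] [Group G] [MulSemiringAction G M]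
    [Algebra M[X] R] [IsFractionRing M[X] R] (g : G) : R →+* R :=
  IsFractionRing.lift (A := M[X]) (aR_inj R g)

theorem aR_apply (g : G) (q : M[X]) : aR M g (algebraMap M[X] R q) =
    algebraMap M[X] R (q.map (MulSemiringAction.toRingHom G M g)) :=
  IsFractionRing.lift_algebraMap (aR_inj R g) q

theorem R_hom_ext {S : Type} [Field S] {f g : R →+* S} (h : ∀ q : M[X], f (algebraMap M[X] R q) = g (algebraMap M[X] R q)) : f = g :=
  IsLocalization.ringHom_ext (nonZeroDivisors M[X]) (RingHom.ext h)

theorem aR_one : aR M (1 : G) = RingHom.id R := by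
  apply R_hom_ext (M := M); intro q
  rw [aR_apply]
  have : MulSemiringAction.toRingHom G M 1 = RingHom.id M := by ext; simp
  rw [this]; simp

theorem aR_mul (g h : G) : aR M (g * h) = ((aR M g).comp (aR M h) : R →+* R) := by
  apply R_hom_ext (M := M); intro q
  rw [RingHom.comp_apply, aR_apply, aR_apply, aR_apply, Polynomial.map_map]
  congr 2; ext; simp [mul_smul]

noncomputable def eR (M : Type) {R Q : Type} [Field M] [Field R] [Field Q] [Algebra M[X] R]
    [IsFractionRing M[X] R] [Algebra M Q] (c : Q) : R →+* LaurentSeries Q :=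
  IsFractionRing.lift (A := M[X]) (evP_inj (algebraMap M Q) c)

theorem eR_apply (c : Q) (q : M[X]) : eR M c (algebraMap M[X] R q) = evP (algebraMap M Q) c q :=
  IsFractionRing.lift_algebraMap (evP_inj (algebraMap M Q) c) q

/-- bounded-degree functions with poles only along `P` -/
def TT (R : Type) [Field R] [Algebra M[X] R] (P : M[X]) (D : ℕ) : AddSubgroup R where
  carrier := {s | ∃ (a : ℕ) (q : M[X]), s * (algebraMap M[X] R P) ^ a = algebraMap M[X] R q ∧
    q.natDegree ≤ a * P.natDegree + D}
  add_mem' := by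
    rintro s s' ⟨a, q, h, hd⟩ ⟨a', q', h', hd'⟩
    refine ⟨a + a', q * P ^ a' + q' * P ^ a, ?_, ?_⟩
    · rw [map_add, map_mul, map_mul, ← h, ← h', map_pow, map_pow]; ring
    · have e1 := natDegree_mul_le (p := q) (q := P ^ a')
      have e2 := natDegree_mul_le (p := q') (q := P ^ a)
      have e3 := natDegree_pow_le (p := P) (n := a)
      have e4 := natDegree_pow_le (p := P) (n := a')
      refine natDegree_add_le_of_degree_le ?_ ?_ <;> rw [add_mul] <;> omega
  zero_mem' := ⟨0, 0, by simp, by simp⟩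
  neg_mem' := by
    rintro s ⟨a, q, h, hd⟩
    exact ⟨a, -q, by rw [map_neg, ← h]; ring, by rwa [natDegree_neg]⟩

theorem TT_mono {P : M[X]} {D D' : ℕ} (h : D ≤ D') {s : R} (hs : s ∈ TT R P D) : s ∈ TT R P D' := by
  obtain ⟨a, q, h1, h2⟩ := hs
  exact ⟨a, q, h1, by omega⟩

theorem TT_mul {P : M[X]} {D D' : ℕ} {s s' : R} (hs : s ∈ TT R P D) (hs' : s' ∈ TT R P D') :
    s * s' ∈ TT R P (D + D') := by
  obtain ⟨a, q, h, hd⟩ := hs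
  obtain ⟨a', q', h', hd'⟩ := hs'
  refine ⟨a + a', q * q', ?_, ?_⟩
  · rw [map_mul, ← h, ← h']; ring
  · refine natDegree_mul_le.trans ?_; rw [add_mul]; omega

theorem TT_poly {P : M[X]} {D : ℕ} (q : M[X]) (hq : q.natDegree ≤ D) : algebraMap M[X] R q ∈ TT R P D :=
  ⟨0, q, by simp, by omega⟩

theorem TT_act {P : M[X]} (g : G) (hP : P.map (MulSemiringAction.toRingHom G M g) = P) {D : ℕ} {s : R}
    (hs : s ∈ TT R P D) : aR M g s ∈ TT R P D := by
  obtain ⟨a, q, h, hd⟩ := hs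
  refine ⟨a, q.map (MulSemiringAction.toRingHom G M g), ?_, (natDegree_map_le).trans hd⟩
  rw [← aR_apply, ← h, map_mul, map_pow, aR_apply, hP]

variable {F ι : Type} [Field F] [Algebra F M] [Algebra F Q] [IsScalarTower F M Q] [FiniteDimensional F Q]
  [Algebra.IsSeparable F Q] [Fintype ι] [Finite G] [FaithfulSMul G M]

theorem pp_lemma (hfix : ∀ (g : G) (f : F), g • algebraMap F M f = algebraMap F M f)
    (c : ι → Q) (hc : ∀ i j, i ≠ j → minpoly F (c i) ≠ minpoly F (c j))
    (hg : ∀ i, (minpoly F (c i)).natDegree = Module.finrank F Q)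
    (φ : ι → G → LaurentSeries Q) :
    ∃ ε ∈ TT R ((PP F c).map (algebraMap F M)) 0, ∀ i g, eR M (c i) (aR M g ε) - φ i g ∈ psub Q := by
  classical
  have := Fintype.ofFinite G
  let θ : G → (M →+* Q) := fun g => (algebraMap M Q).comp (MulSemiringAction.toRingHom G M g)
  have hθ : Function.Injective θ := by
    intro g h hgh
    apply FaithfulSMul.eq_of_smul_eq_smul (α := M)
    intro m
    exact (algebraMap M Q).injective (RingHom.congr_fun hgh m)
  obtain ⟨n, z, v, hv⟩ := char_span θ hθ
  choose a q hq hqp using fun l : Fin n => pp_scalar (F := F) c hc hg (fun i => ∑ h, HahnSeries.C (v l h) * φ i h)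
  let PR : R := algebraMap M[X] R ((PP F c).map (algebraMap F M))
  have hPR0 : PR ≠ 0 := by
    rw [Ne, map_eq_zero_iff _ (IsFractionRing.injective M[X] R)]
    exact ((PP_monic c).map _).ne_zero
  let s : Fin n → R := fun l => algebraMap M[X] R ((q l).map (algebraMap F M)) * (PR⁻¹) ^ a l
  have hs : ∀ l, s l ∈ TT R ((PP F c).map (algebraMap F M)) 0 := fun l => by
    refine ⟨a l, (q l).map (algebraMap F M), ?_, ?_⟩
    · simp only [s]
      rw [mul_assoc, ← mul_pow, inv_mul_cancel₀ hPR0, one_pow, mul_one]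
    · rw [natDegree_map, natDegree_map]; exact hq l
  have hpol : ∀ (g : G) (p : F[X]), (p.map (algebraMap F M)).map (MulSemiringAction.toRingHom G M g) = p.map (algebraMap F M) := by
    intro g p
    rw [Polynomial.map_map]; congr 1
    ext f; exact hfix g f
  have hsa : ∀ g l, aR M g (s l) = s l := fun (g : G) l => by
    simp only [s, PR, map_mul, map_pow, map_inv₀, aR_apply, hpol]
  have hee : ∀ i (p : F[X]), eR M (c i) (algebraMap M[X] R (p.map (algebraMap F M))) = evP (algebraMap F Q) (c i) p := by
    intro i p
    rw [eR_apply]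
    simp only [evP, coe_eval₂RingHom, eval₂_map]
    rw [RingHom.comp_assoc, IsScalarTower.algebraMap_eq F M Q]
  have hse : ∀ i l, eR M (c i) (s l) = evP (algebraMap F Q) (c i) (q l) * ((evP (algebraMap F Q) (c i) (PP F c))⁻¹) ^ a l := by
    intro i l
    simp only [s, PR, map_mul, map_pow, map_inv₀, hee]
  refine ⟨∑ l, algebraMap M[X] R (C (z l)) * s l, sum_mem fun l _ => ?_, fun i g => ?_⟩
  · have := TT_mul (TT_poly (R := R) (P := (PP F c).map (algebraMap F M)) (D := 0) (C (z l)) (by simp)) (hs l)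
    simpa using this
  · have h1 : eR M (c i) (aR M g (∑ l, algebraMap M[X] R (C (z l)) * s l)) =
        ∑ l, HahnSeries.C (θ g (z l)) * eR M (c i) (s l) := by
      rw [map_sum, map_sum]
      refine Finset.sum_congr rfl fun l _ => ?_
      rw [map_mul, map_mul, hsa, aR_apply, map_C, eR_apply]
      congr 1
      simp [evP, θ]
    have h2 : φ i g = ∑ l, HahnSeries.C (θ g (z l)) * ∑ h, HahnSeries.C (v l h) * φ i h := by
      simp_rw [Finset.mul_sum]
      rw [Finset.sum_comm]
      have : ∀ h, ∑ l, HahnSeries.C (θ g (z l)) * (HahnSeries.C (v l h) * φ i h) = (if g = h then 1 else 0) * φ i h := by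
        intro h
        have := congrArg (HahnSeries.C : Q →+* LaurentSeries Q) (hv g h)
        rw [map_sum] at this
        simp_rw [← mul_assoc, ← map_mul]
        rw [← Finset.sum_mul]
        simp_rw [mul_comm (θ g _)]
        rw [this]; split_ifs <;> simp
      rw [Finset.sum_congr rfl fun h _ => this h]
      simp [ite_mul]
    rw [h1, h2]
    rw [← Finset.sum_sub_distrib]
    refine sum_mem fun l _ => ?_
    rw [← mul_sub]
    refine mul_mem ?_ ?_
    · rw [mem_psub]; intro e he; rw [HahnSeries.C_apply, HahnSeries.coeff_single_of_ne (by omega)]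
    · rw [hse]; exact hqp l i

theorem eps_exists (hfix : ∀ (g : G) (f : F), g • algebraMap F M f = algebraMap F M f)
    (c : ι → Q) (hc : ∀ i j, i ≠ j → minpoly F (c i) ≠ minpoly F (c j))
    (hg : ∀ i, (minpoly F (c i)).natDegree = Module.finrank F Q)
    (Cs : ι → Subgroup G) (S : ι → Subring (G → WW Q)) (hS : ∀ i, IsLoc (Cs i) (S i)) (m0 : M) :
    ∃ ε : LaurentSeries R, (∀ m, ε.coeff m ∈ TT R ((PP F c).map (algebraMap F M)) 0) ∧
      ε.coeff 0 = algebraMap M[X] R (C m0) ∧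
      ∀ i, (fun g => lmap (eR M (c i)) (lmap (aR M g) ε)) ∈ S i := by
  classical
  have := Fintype.ofFinite G
  choose u hu using fun i => (hS i).dens
  have : Inhabited R := ⟨0⟩
  have : Inhabited (LaurentSeries Q) := ⟨0⟩
  obtain ⟨q, hq⟩ := rec_exists (A := R × (ι → G → LaurentSeries Q)) (fun m f x =>
    x.1 ∈ TT R ((PP F c).map (algebraMap F M)) 0 ∧ (m = 0 → x.1 = algebraMap M[X] R (C m0)) ∧ ∀ i g, x.2 i g ∈ psub Q ∧
      eR M (c i) (aR M g x.1) = x.2 i g + ∑ l ∈ Finset.range m, ∑ h, (f l).2 i h * (u i h g).coeff ((m:ℤ) - l)) (by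
    intro m f
    rcases Nat.eq_zero_or_pos m with rfl | hm
    · refine ⟨(algebraMap M[X] R (C m0), fun i g => eR M (c i) (aR M g (algebraMap M[X] R (C m0)))), TT_poly _ (by simp), fun _ => rfl, fun i g => ⟨?_, by simp⟩⟩
      simp only
      rw [aR_apply, eR_apply]; exact evP_psub _ _ _
    · obtain ⟨ε, hε, hε'⟩ := pp_lemma (R := R) hfix c hc hg (fun i g => ∑ l ∈ Finset.range m, ∑ h, (f l).2 i h * (u i h g).coeff ((m:ℤ) - l))
      refine ⟨(ε, fun i g => eR M (c i) (aR M g ε) - ∑ l ∈ Finset.range m, ∑ h, (f l).2 i h * (u i h g).coeff ((m:ℤ) - l)), hε, fun h => by omega, fun i g => ⟨hε' i g, by simp⟩⟩)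
  obtain ⟨ε, hε⟩ := ls_mk (fun i => if 0 ≤ i then (q i.toNat).1 else 0) 0 (fun i hi => by simp; omega)
  refine ⟨ε, fun m => ?_, ?_, fun i => ?_⟩
  · rw [hε]; split_ifs
    · exact (hq _).1
    · exact zero_mem _
  · rw [hε, if_pos le_rfl]; exact (hq 0).2.1 rfl
  · choose o ho using fun h : G => ls_mk (fun j => if 0 ≤ j then (q j.toNat).2 i h else 0) 0 (fun i hi => by simp; omega)
    have ho0 : ∀ h, ∀ j < 0, (o h).coeff j = 0 := fun h j hj => by rw [ho, if_neg (by omega)]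
    have hoO : ∀ h, o h ∈ OO Q := fun h => mem_lsub.2 fun j => by
      rw [ho]; split_ifs
      · exact ((hq _).2.2 i h).1
      · exact zero_mem _
    have key : (fun g => lmap (eR M (c i)) (lmap (aR M g) ε)) = ∑ h, (fun _ => o h) * u i h := by
      funext g
      rw [Finset.sum_apply]
      have hu0 : ∀ h, ∀ j < 0, (u i h g).coeff j = 0 := fun h j hj => by
        rw [(hu i h).2 g j hj.le, if_neg (by omega)]
      ext1; funext j
      rw [HahnSeries.coeff_sum, lmap_coeff, lmap_coeff, hε]
      by_cases hj : 0 ≤ j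
      · obtain ⟨n, rfl⟩ : ∃ n : ℕ, j = n := ⟨j.toNat, by omega⟩
        rw [if_pos hj, Int.toNat_natCast]
        have h1 := ((hq n).2.2 i g).2
        have h2 : ∀ h, (((fun _ => o h) * u i h : G → WW Q) g).coeff (n:ℤ) =
            ∑ l ∈ Finset.range (n+1), (q l).2 i h * (u i h g).coeff ((n:ℤ) - l) := by
          intro h
          rw [Pi.mul_apply, ls_mulc (o h) (u i h g) 0 0 (ho0 h) (hu0 h)]
          symm
          refine Finset.sum_bij (fun l _ => (l:ℤ)) ?_ ?_ ?_ ?_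
          · intro l hl; simp at hl ⊢; omega
          · intro l _ l' _ h; simpa using h
          · intro j hj; simp at hj
            exact ⟨j.toNat, by simp; omega, by omega⟩
          · intro l hl
            rw [ho, if_pos (by omega)]; simp
        rw [h1, Finset.sum_congr rfl fun h _ => h2 h]
        conv_rhs => rw [Finset.sum_comm]
        rw [Finset.sum_range_succ, add_comm]
        congr 1
        · refine Finset.sum_congr rfl fun l hl => ?_
          beta_reduce; rw [if_pos (Finset.mem_range.1 hl)]
        · have : ∀ h, (q n).2 i h * (u i h g).coeff ((n:ℤ) - n) = if g = h then (q n).2 i h else 0 := by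
            intro h
            rw [sub_self, (hu i h).2 g 0 le_rfl]; simp
          rw [Finset.sum_congr rfl fun h _ => this h]; simp
      · rw [if_neg hj, map_zero, map_zero]
        symm
        refine Finset.sum_eq_zero fun h _ => ?_
        exact ls_mul_bdd (o h) (u i h g) 0 0 (ho0 h) (hu0 h) j (by omega)
    rw [key]
    refine sum_mem fun h _ => mul_mem ?_ (hu i h).1
    exact (hS i).const _ (fun _ => OO_le_F2 (hoO h)) (fun _ _ _ => rfl)

end
end A6

section A7
open Polynomial

/-! algebraic elements have constant coefficients -/
noncomputable def psi (Q : Type) [Field Q] : LaurentSeries Q →+* LaurentSeries Q :=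
  HahnSeries.embDomainRingHom (AddMonoidHom.mulLeft (2:ℤ)) (fun a b h => by simpa using h) (fun a b => by simp)

theorem psi_coeff {Q : Type} [Field Q] (x : LaurentSeries Q) (e : ℤ) : (psi Q x).coeff (2 * e) = x.coeff e := by
  unfold psi HahnSeries.embDomainRingHom
  exact HahnSeries.embDomain_coeff

theorem psi_C {Q : Type} [Field Q] (q : Q) : psi Q (HahnSeries.C q) = HahnSeries.C q :=
  HahnSeries.embDomainRingHom_C

theorem alg_OO {F Q : Type} [Field F] [Field Q] [Algebra F Q] (w : WW Q) (p : (LaurentSeries F)[X]) (hp : p ≠ 0)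
    (hw : p.eval₂ (iK F Q) w = 0) : w ∈ OO Q := by
  classical
  let Ψ : WW Q →+* WW Q := lmap (psi Q)
  have hΨK : ∀ f, Ψ (iK F Q f) = iK F Q f := fun f => by
    ext1; funext m
    change psi Q ((iK F Q f).coeff m) = _
    rw [iK_coeff, psi_C]
  have hΨi : Function.Injective Ψ := Ψ.injective
  have hroot : ∀ n : ℕ, p.eval₂ (iK F Q) (Ψ^[n] w) = 0 := by
    intro n
    induction n with
    | zero => exact hw
    | succ n ih =>
      rw [Function.iterate_succ_apply']
      have : iK F Q = Ψ.comp (iK F Q) := by ext1 f; exact (hΨK f).symm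
      rw [this, ← Polynomial.hom_eval₂, ih, map_zero]
  have hfin : {x : WW Q | p.eval₂ (iK F Q) x = 0}.Finite := by
    refine ((p.map (iK F Q)).roots.toFinset : Finset (WW Q)).finite_toSet.subset ?_
    intro x hx
    have : p.map (iK F Q) ≠ 0 := (Polynomial.map_ne_zero_iff (iK F Q).injective).2 hp
    simp only [Finset.mem_coe, Multiset.mem_toFinset, mem_roots this, IsRoot, eval_map]
    exact hx
  have hni : ¬ Function.Injective (fun n : ℕ => Ψ^[n] w) := by
    intro h
    exact Set.infinite_of_injective_forall_mem h hroot hfin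
  obtain ⟨d, hd0, hd⟩ : ∃ d : ℕ, 0 < d ∧ Ψ^[d] w = w := by
    rw [Function.Injective] at hni
    push Not at hni
    obtain ⟨a, b, hab, hne⟩ := hni
    rcases lt_or_gt_of_ne hne with h | h
    · refine ⟨b - a, by omega, ?_⟩
      apply hΨi.iterate a
      rw [← Function.iterate_add_apply, show a + (b - a) = b by omega]; exact hab.symm
    · refine ⟨a - b, by omega, ?_⟩
      apply hΨi.iterate b
      rw [← Function.iterate_add_apply, show b + (a - b) = a by omega]; exact hab
  have hc : ∀ (d : ℕ) (w : WW Q) m e, ((Ψ^[d] w).coeff m).coeff (2 ^ d * e) = (w.coeff m).coeff e := by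
    intro d
    induction d with
    | zero => intro w m e; simp
    | succ d ih =>
      intro w m e
      rw [Function.iterate_succ_apply']
      change (psi Q ((Ψ^[d] w).coeff m)).coeff _ = _
      rw [pow_succ', mul_assoc, psi_coeff, ih]
  refine mem_lsub.2 fun m => (mem_psub _).2 fun e he => ?_
  by_cases h0 : w.coeff m = 0
  · rw [h0]; rfl
  · obtain ⟨a, ha, ha1, -⟩ := ls_ord _ h0
    apply ha1
    have h1 := hc d w m a
    rw [hd] at h1
    have h2 : ¬ (2 ^ d * a < a) := fun h => ha (by rw [← h1]; exact ha1 _ h)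
    have h3 : (2:ℤ) ≤ 2 ^ d := by
      calc (2:ℤ) = 2^1 := by norm_num
        _ ≤ 2 ^ d := pow_le_pow_right₀ (by norm_num) hd0
    by_contra h4
    apply h2
    nlinarith

section
variable {G M R Q F ι : Type} [Field M] [Field R] [Field Q] [Group G] [MulSemiringAction G M]
  [Algebra M[X] R] [IsFractionRing M[X] R] [Algebra M Q]
  [Field F] [Algebra F M] [Algebra F Q] [IsScalarTower F M Q] 

noncomputable def iF (F M R : Type) [Field M] [Field R] [Algebra M[X] R] [Field F] [Algebra F M] : F →+* R :=
  (algebraMap M[X] R).comp ((C : M →+* M[X]).comp (algebraMap F M))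

noncomputable def pY (F M R : Type) [Field M] [Field R] [Algebra M[X] R] [Field F] [Algebra F M] : (LaurentSeries F)[X] →+* LaurentSeries R :=
  eval₂RingHom (lmap (iF F M R)) (HahnSeries.C (algebraMap M[X] R X))

theorem pY_coeff (B : (LaurentSeries F)[X]) (m : ℤ) : ∃ p : F[X], p.natDegree ≤ B.natDegree ∧ (∀ j, p.coeff j = (B.coeff j).coeff m) ∧
    (pY F M R B).coeff m = algebraMap M[X] R (p.map (algebraMap F M)) := by
  have hc : ∀ j, (∑ j ∈ Finset.range (B.natDegree + 1), monomial j ((B.coeff j).coeff m)).coeff j = (B.coeff j).coeff m := by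
    intro j
    simp only [finsetSum_coeff, coeff_monomial]
    rw [Finset.sum_ite_eq']
    split_ifs with h
    · rfl
    · rw [coeff_eq_zero_of_natDegree_lt (by simpa using h)]; simp
  refine ⟨∑ j ∈ Finset.range (B.natDegree + 1), monomial j ((B.coeff j).coeff m), ?_, hc, ?_⟩
  · rw [natDegree_le_iff_coeff_eq_zero]
    intro N hN
    rw [hc, coeff_eq_zero_of_natDegree_lt hN]; simp
  · rw [pY, coe_eval₂RingHom, eval₂_eq_sum_range, HahnSeries.coeff_sum, Polynomial.map_sum, map_sum]
    refine Finset.sum_congr rfl fun j _ => ?_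
    rw [← map_pow, mul_comm, HahnSeries.C_mul_eq_smul, HahnSeries.coeff_smul, lmap_coeff, map_monomial, ← C_mul_X_pow_eq_monomial,
      map_mul, map_pow, smul_eq_mul, mul_comm]
    rfl

theorem pY_inj : Function.Injective (pY F M R) := by
  rw [injective_iff_map_eq_zero]
  intro B hB
  ext j m
  obtain ⟨p, -, hp, hp2⟩ := pY_coeff (M := M) (R := R) B m
  rw [hB, HahnSeries.coeff_zero] at hp2
  have := (map_eq_zero_iff _ (IsFractionRing.injective M[X] R)).1 hp2.symm
  rw [Polynomial.map_eq_zero] at this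
  rw [← hp, this]; simp

theorem pY_range (w : LaurentSeries R) (D : ℕ)
    (h : ∀ m, ∃ p : F[X], p.natDegree ≤ D ∧ w.coeff m = algebraMap M[X] R (p.map (algebraMap F M))) :
    w ∈ (pY F M R).range := by
  choose p hp hw using h
  obtain ⟨a, ha⟩ := ls_bdd w
  choose b hb using fun j : ℕ => ls_mk (fun m => (p m).coeff j) a (fun m hm => by
    have h1 := hw m
    rw [ha m hm] at h1
    have := (map_eq_zero_iff _ (IsFractionRing.injective M[X] R)).1 h1.symm
    rw [Polynomial.map_eq_zero] at this
    rw [this]; simp)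
  refine ⟨∑ j ∈ Finset.range (D + 1), monomial j (b j), ?_⟩
  ext m
  obtain ⟨q, -, hq, hq2⟩ := pY_coeff (M := M) (R := R) (∑ j ∈ Finset.range (D + 1), monomial j (b j)) m
  rw [hq2, hw]
  congr 2
  ext j
  rw [hq]
  simp only [finsetSum_coeff, coeff_monomial]
  rw [Finset.sum_ite_eq']
  split_ifs with h
  · exact hb j m
  · rw [coeff_eq_zero_of_natDegree_lt (lt_of_le_of_lt (hp m) (by simp at h; omega))]; simp

def BB (R : Type) [Field R] [Algebra M[X] R] [IsFractionRing M[X] R] (P : M[X]) : Subring (LaurentSeries R) where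
  carrier := {z | ∃ D, ∀ m, z.coeff m ∈ TT R P D}
  mul_mem' := by
    rintro x y ⟨D, hD⟩ ⟨D', hD'⟩
    obtain ⟨a, ha⟩ := ls_bdd x
    obtain ⟨b, hb⟩ := ls_bdd y
    refine ⟨D + D', fun m => ?_⟩
    rw [ls_mulc x y a b ha hb]
    exact sum_mem fun i _ => TT_mul (hD _) (hD' _)
  one_mem' := ⟨0, fun m => by
    rw [HahnSeries.coeff_one]; split_ifs
    · have := TT_poly (R := R) (P := P) (D := 0) 1 (by simp); rwa [map_one] at this
    · exact zero_mem _⟩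
  add_mem' := by
    rintro x y ⟨D, hD⟩ ⟨D', hD'⟩
    exact ⟨max D D', fun m => add_mem (TT_mono (le_max_left _ _) (hD m)) (TT_mono (le_max_right _ _) (hD' m))⟩
  zero_mem' := ⟨0, fun m => zero_mem _⟩
  neg_mem' := by
    rintro x ⟨D, hD⟩
    exact ⟨D, fun m => neg_mem (hD m)⟩

theorem pY_BB (P : M[X]) : (pY F M R).range ≤ BB R P := by
  rintro _ ⟨B, rfl⟩
  refine ⟨B.natDegree, fun m => ?_⟩
  obtain ⟨p, hp, -, h⟩ := pY_coeff (M := M) (R := R) B m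
  rw [h]
  exact TT_poly _ (natDegree_map_le.trans hp)

theorem actY_pY (hfix : ∀ (g : G) (f : F), g • algebraMap F M f = algebraMap F M f) (g : G) (B : (LaurentSeries F)[X]) :
    lmap (aR M g) (pY F M R B) = pY F M R B := by
  ext m
  obtain ⟨p, hp, -, h⟩ := pY_coeff (M := M) (R := R) B m
  rw [lmap_coeff, h, aR_apply, Polynomial.map_map]
  congr 2
  ext f; exact hfix g f

theorem evY_pY (c : Q) (B : (LaurentSeries F)[X]) : lmap (eR M c) (pY F M R B) =
    B.eval₂ (iK F Q) (HahnSeries.C (HahnSeries.C c + HahnSeries.single 1 1)) := by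
  rw [pY, coe_eval₂RingHom, Polynomial.hom_eval₂]
  congr 1
  · ext1 f; ext1; funext m
    rw [RingHom.comp_apply, lmap_coeff, lmap_coeff, iK_coeff, iF, RingHom.comp_apply, eR_apply]
    simp [evP, ← IsScalarTower.algebraMap_apply]
  · rw [lmap_C, eR_apply]; simp [evP]

theorem xOO (c : Q) : (HahnSeries.C (HahnSeries.C c + HahnSeries.single 1 1) : WW Q) ∈ OO Q := by
  refine mem_lsub.2 fun m => ?_
  rw [HahnSeries.C_apply, HahnSeries.coeff_single]
  split_ifs
  · rw [mem_psub]; intro e he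
    rw [HahnSeries.coeff_add, HahnSeries.C_apply, HahnSeries.coeff_single_of_ne (by omega), HahnSeries.coeff_single_of_ne (by omega), add_zero]
  · exact zero_mem _

theorem iK_OO (f : LaurentSeries F) : iK F Q f ∈ OO Q := by
  refine mem_lsub.2 fun i => ?_
  rw [iK_coeff, mem_psub]; intro e he
  rw [HahnSeries.C_apply, HahnSeries.coeff_single_of_ne (by omega)]

theorem evY_pY_OO (c : Q) (B : (LaurentSeries F)[X]) : lmap (eR M c) (pY F M R B) ∈ OO Q := by
  rw [evY_pY, eval₂_eq_sum_range]
  exact sum_mem fun j _ => mul_mem (iK_OO _) (pow_mem (xOO c) _)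

variable [FiniteDimensional F Q] [Algebra.IsSeparable F Q] [Fintype ι]

theorem evP_map (c : Q) (p : F[X]) : evP (algebraMap M Q) c (p.map (algebraMap F M)) = evP (algebraMap F Q) c p := by
  simp only [evP, coe_eval₂RingHom, eval₂_map]
  rw [RingHom.comp_assoc, IsScalarTower.algebraMap_eq F M Q]

theorem T_fixed (hF : ∀ m : M, (∀ g : G, g • m = m) → ∃ f : F, algebraMap F M f = m)
    (hfix : ∀ (g : G) (f : F), g • algebraMap F M f = algebraMap F M f)
    (c : ι → Q) (hc : ∀ i j, i ≠ j → minpoly F (c i) ≠ minpoly F (c j)) (D : ℕ) (s : R)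
    (hs : s ∈ TT R ((PP F c).map (algebraMap F M)) D) (hsg : ∀ g : G, aR M g s = s)
    (hse : ∀ i, eR M (c i) s ∈ psub Q) :
    ∃ p : F[X], p.natDegree ≤ D ∧ s = algebraMap M[X] R (p.map (algebraMap F M)) := by
  obtain ⟨a, q, h, hd⟩ := hs
  have hPg : ∀ g : G, ((PP F c).map (algebraMap F M)).map (MulSemiringAction.toRingHom G M g) = (PP F c).map (algebraMap F M) := by
    intro g
    rw [Polynomial.map_map]; congr 1; ext f; exact hfix g f
  have hqg : ∀ g : G, q.map (MulSemiringAction.toRingHom G M g) = q := by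
    intro g
    apply IsFractionRing.injective M[X] R
    rw [← aR_apply, ← h, map_mul, hsg, map_pow, aR_apply, hPg]
  obtain ⟨q0, rfl⟩ : ∃ q0 : F[X], q0.map (algebraMap F M) = q := by
    rw [← mem_lifts, lifts_iff_coeff_lifts]
    intro n
    obtain ⟨f, hf⟩ := hF (q.coeff n) (fun g => by
      have := congrArg (fun p => p.coeff n) (hqg g)
      simpa [coeff_map] using this)
    exact ⟨f, hf⟩
  have hdv : PP F c ^ a ∣ q0 := by
    refine PP_dvd c hc a q0 fun i => evP_dvd _ _ _ _ fun m hm => ?_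
    have h1 := congrArg (eR M (c i)) h
    rw [map_mul, map_pow, eR_apply, eR_apply, evP_map, evP_map] at h1
    rw [← h1]
    have h2 := ls_pow_bdd _ 1 (evP_PP c hc i).1 a
    exact ls_mul_bdd _ _ 0 (a*1) ((mem_psub _).1 (hse i)) h2 m (by omega)
  obtain ⟨p, rfl⟩ := hdv
  have hm := (PP_monic (F := F) c)
  refine ⟨p, ?_, ?_⟩
  · by_cases hp0 : p = 0
    · simp [hp0]
    · rw [natDegree_map, natDegree_map, (hm.pow a).natDegree_mul' hp0, natDegree_pow] at hd
      omega
  · rw [Polynomial.map_mul, Polynomial.map_pow, map_mul, map_pow, mul_comm] at h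
    refine mul_left_cancel₀ (pow_ne_zero a ?_) h
    rw [Ne, map_eq_zero_iff _ (IsFractionRing.injective M[X] R)]
    exact (hm.map _).ne_zero

theorem Y_fixed (hF : ∀ m : M, (∀ g : G, g • m = m) → ∃ f : F, algebraMap F M f = m)
    (hfix : ∀ (g : G) (f : F), g • algebraMap F M f = algebraMap F M f)
    (c : ι → Q) (hc : ∀ i j, i ≠ j → minpoly F (c i) ≠ minpoly F (c j))
    (z : LaurentSeries R) (hz : z ∈ locSub (pY F M R).range (BB R ((PP F c).map (algebraMap F M))) (pY_BB _))
    (hzg : ∀ g : G, lmap (aR M g) z = z) (hze : ∀ i, lmap (eR M (c i)) z ∈ F2 Q) :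
    ∃ A B, B ≠ 0 ∧ pY F M R B * z = pY F M R A := by
  classical
  obtain ⟨_, ⟨B0, rfl⟩, hB0, hB0z⟩ := mem_locSub.1 hz
  choose b hb hb0 hbz using fun i => mem_F2.1 (hze i)
  choose Bi hBi o ho hBo using fun i => DIV (F := F) _ (xOO (c i)) (b i) (hb0 i) (hb i)
  have hB00 : B0 ≠ 0 := fun h => hB0 (by rw [h, map_zero])
  let B := B0 * ∏ i, Bi i
  have hB : B ≠ 0 := mul_ne_zero hB00 (Finset.prod_ne_zero_iff.2 fun i _ => hBi i)
  suffices h : pY F M R B * z ∈ (pY F M R).range by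
    obtain ⟨A, hA⟩ := h
    exact ⟨A, B, hB, hA.symm⟩
  have hwB : pY F M R B * z ∈ BB R ((PP F c).map (algebraMap F M)) := by
    have : pY F M R B * z = pY F M R (∏ i, Bi i) * (pY F M R B0 * z) := by
      simp only [B, map_mul]; ring
    rw [this]
    exact mul_mem (pY_BB _ ⟨_, rfl⟩) hB0z
  obtain ⟨D, hD⟩ := hwB
  refine pY_range _ D fun m => ?_
  refine T_fixed hF hfix c hc D _ (hD m) ?_ ?_
  · intro g
    rw [← lmap_coeff, map_mul, hzg, actY_pY hfix]
  · intro i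
    rw [← lmap_coeff]
    refine mem_lsub.1 (?_ : _ ∈ OO Q) m
    have : B = (B0 * ∏ j ∈ Finset.univ.erase i, Bi j) * Bi i := by
      simp only [B]
      rw [mul_assoc, Finset.prod_erase_mul _ _ (Finset.mem_univ i)]
    rw [this, map_mul, map_mul, map_mul, evY_pY _ (Bi i), hBo i]
    have h2 := mul_mem (mul_mem (evY_pY_OO (M := M) (R := R) (c i) (B0 * ∏ j ∈ Finset.univ.erase i, Bi j)) (ho i)) (hbz i)
    convert h2 using 1
    ring

end
end A7

section A8
open Polynomial

section
variable {G M R Q F ι : Type} [Field M] [Field R] [Field Q] [Group G] [MulSemiringAction G M]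
  [Algebra M[X] R] [IsFractionRing M[X] R] [Algebra M Q]
  [Field F] [Algebra F M] [Algebra F Q] [IsScalarTower F M Q] 

theorem lY_one (z : LaurentSeries R) : lmap (aR M (1:G)) z = z := by
  ext m; rw [lmap_coeff, aR_one]; rfl

theorem lY_mul (g h : G) (z : LaurentSeries R) : lmap (aR M (g * h)) z = lmap (aR M g) (lmap (aR M h) z) := by
  ext m; rw [lmap_coeff, aR_mul]; rfl

variable [FiniteDimensional F Q] [Algebra.IsSeparable F Q] [Fintype ι]

/-- the patched ring -/
def ER (hfix : ∀ (g : G) (f : F), g • algebraMap F M f = algebraMap F M f)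
    (c : ι → Q) (S : ι → Subring (G → WW Q)) : Subring (LaurentSeries R) where
  carrier := {z | z ∈ locSub (pY F M R).range (BB R ((PP F c).map (algebraMap F M))) (pY_BB _) ∧
    ∀ i, (fun g => lmap (eR M (c i)) (lmap (aR M g) z)) ∈ S i}
  mul_mem' := by
    rintro x y ⟨h1, h2⟩ ⟨h3, h4⟩
    refine ⟨mul_mem h1 h3, fun i => ?_⟩
    convert mul_mem (h2 i) (h4 i) using 1
    funext g; simp
  one_mem' := ⟨one_mem _, fun i => by
    convert one_mem (S i) using 1
    funext g; simp⟩
  add_mem' := by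
    rintro x y ⟨h1, h2⟩ ⟨h3, h4⟩
    refine ⟨add_mem h1 h3, fun i => ?_⟩
    convert add_mem (h2 i) (h4 i) using 1
    funext g; simp
  zero_mem' := ⟨zero_mem _, fun i => by
    convert zero_mem (S i) using 1
    funext g; simp⟩
  neg_mem' := by
    rintro x ⟨h1, h2⟩
    refine ⟨neg_mem h1, fun i => ?_⟩
    convert neg_mem (h2 i) using 1
    funext g; simp

theorem mem_ER (hfix : ∀ (g : G) (f : F), g • algebraMap F M f = algebraMap F M f)
    (c : ι → Q) (S : ι → Subring (G → WW Q)) (z : LaurentSeries R) : z ∈ ER hfix c S ↔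
    z ∈ locSub (pY F M R).range (BB R ((PP F c).map (algebraMap F M))) (pY_BB _) ∧
    ∀ i, (fun g => lmap (eR M (c i)) (lmap (aR M g) z)) ∈ S i := Iff.rfl

variable (hF : ∀ m : M, (∀ g : G, g • m = m) → ∃ f : F, algebraMap F M f = m)
  (hfix : ∀ (g : G) (f : F), g • algebraMap F M f = algebraMap F M f)
  (c : ι → Q) (hc : ∀ i j, i ≠ j → minpoly F (c i) ≠ minpoly F (c j))
  (Cs : ι → Subgroup G) (S : ι → Subring (G → WW Q)) (hS : ∀ i, IsLoc (Cs i) (S i))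

theorem ER_act (hS : ∀ i, IsLoc (Cs i) (S i)) (g : G) (z : LaurentSeries R) (hz : z ∈ ER hfix c S) : lmap (aR M g) z ∈ ER hfix c S := by
  rw [mem_ER] at hz ⊢
  refine ⟨?_, fun i => ?_⟩
  · obtain ⟨_, ⟨B, rfl⟩, hB0, D, hD⟩ := mem_locSub.1 hz.1
    refine ⟨_, ⟨B, rfl⟩, hB0, D, fun m => ?_⟩
    rw [← actY_pY hfix g, ← map_mul, lmap_coeff]
    refine TT_act g ?_ (hD m)
    rw [Polynomial.map_map]; congr 1; ext f; exact hfix g f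
  · have := (hS i).trans _ (hz.2 i) g
    convert this using 1
    funext h
    rw [lY_mul]

theorem ER_pY_quot (hS : ∀ i, IsLoc (Cs i) (S i)) (A B : (LaurentSeries F)[X]) (hB : B ≠ 0) (z : LaurentSeries R)
    (h : pY F M R B * z = pY F M R A) : z ∈ ER hfix c S := by
  have hB0 : pY F M R B ≠ 0 := by
    rwa [Ne, map_eq_zero_iff _ pY_inj]
  rw [mem_ER]
  refine ⟨⟨_, ⟨B, rfl⟩, hB0, ?_⟩, fun i => ?_⟩
  · rw [h]; exact pY_BB _ ⟨A, rfl⟩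
  · have hz : z = pY F M R A * (pY F M R B)⁻¹ := by
      rw [← h, mul_comm, inv_mul_cancel_left₀ hB0]
    have hg : ∀ g : G, lmap (aR M g) z = z := fun g => by
      rw [hz, map_mul, map_inv₀, actY_pY hfix, actY_pY hfix]
    simp only [hg]
    refine (hS i).const _ (fun _ => ?_) (fun _ _ _ => rfl)
    rw [hz, map_mul, map_inv₀]
    exact mul_mem (OO_le_F2 (evY_pY_OO _ _)) (inv_mem (OO_le_F2 (evY_pY_OO _ _)))

theorem ER_fixed (hF : ∀ m : M, (∀ g : G, g • m = m) → ∃ f : F, algebraMap F M f = m)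
    (hc : ∀ i j, i ≠ j → minpoly F (c i) ≠ minpoly F (c j))
    (hS : ∀ i, IsLoc (Cs i) (S i)) (z : LaurentSeries R) (hz : z ∈ ER hfix c S) (hg : ∀ g : G, lmap (aR M g) z = z) :
    ∃ A B, B ≠ 0 ∧ pY F M R B * z = pY F M R A := by
  rw [mem_ER] at hz
  refine Y_fixed hF hfix c hc z hz.1 hg fun i => ?_
  have := (hS i).inv _ (hz.2 i) 1 (fun _ _ => by simp only [hg])
  simpa only [hg] using this

theorem ER_inv [Finite G] (hF : ∀ m : M, (∀ g : G, g • m = m) → ∃ f : F, algebraMap F M f = m)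
    (hc : ∀ i j, i ≠ j → minpoly F (c i) ≠ minpoly F (c j))
    (hS : ∀ i, IsLoc (Cs i) (S i)) (z : LaurentSeries R) (hz : z ∈ ER hfix c S) : z⁻¹ ∈ ER hfix c S := by
  classical
  by_cases hz0 : z = 0
  · rw [hz0, inv_zero]; exact zero_mem _
  have := Fintype.ofFinite G
  let n := ∏ g : G, lmap (aR M g) z
  have hn : n ∈ ER hfix c S := prod_mem fun g _ => ER_act hfix c Cs S hS g z hz
  have hn0 : n ≠ 0 := Finset.prod_ne_zero_iff.2 fun g _ => by
    rwa [Ne, map_eq_zero]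
  have hng : ∀ g, lmap (aR M g) n = n := fun g => by
    rw [show lmap (aR M g) n = ∏ h : G, lmap (aR M (g * h)) z from
      (map_prod _ _ _).trans (Finset.prod_congr rfl fun h _ => (lY_mul g h z).symm)]
    exact Equiv.prod_comp (Equiv.mulLeft g) (fun h => lmap (aR M h) z)
  obtain ⟨A, B, hB, h⟩ := ER_fixed hfix c Cs S hF hc hS n hn hng
  have hA : A ≠ 0 := by
    rintro rfl
    rw [map_zero, mul_eq_zero, map_eq_zero_iff _ pY_inj] at h
    tauto
  have hni : n⁻¹ ∈ ER hfix c S := ER_pY_quot hfix c Cs S hS B A hA _ (by rw [← h, mul_assoc, mul_inv_cancel₀ hn0, mul_one])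
  have : z⁻¹ = n⁻¹ * ∏ g ∈ Finset.univ.erase (1:G), lmap (aR M g) z := by
    have h1 : n = z * ∏ g ∈ Finset.univ.erase (1:G), lmap (aR M g) z := by
      simp only [n]
      rw [← Finset.mul_prod_erase _ _ (Finset.mem_univ (1:G)), lY_one]
    field_simp
    exact h1
  rw [this]
  exact mul_mem hni (prod_mem fun g _ => ER_act hfix c Cs S hS g z hz)

def EF [Finite G] (hF : ∀ m : M, (∀ g : G, g • m = m) → ∃ f : F, algebraMap F M f = m)
    (hc : ∀ i j, i ≠ j → minpoly F (c i) ≠ minpoly F (c j))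
    (hS : ∀ i, IsLoc (Cs i) (S i)) : Subfield (LaurentSeries R) :=
  { ER hfix c S with inv_mem' := fun z hz => ER_inv hfix c Cs S hF hc hS z hz }

theorem patch [Finite G] [FaithfulSMul G M] (hF : ∀ m : M, (∀ g : G, g • m = m) → ∃ f : F, algebraMap F M f = m)
    (hfix : ∀ (g : G) (f : F), g • algebraMap F M f = algebraMap F M f)
    (c : ι → Q) 
    (hc : ∀ i j, i ≠ j → minpoly F (c i) ≠ minpoly F (c j))
    (hg : ∀ i, (minpoly F (c i)).natDegree = Module.finrank F Q)
    (Cs : ι → Subgroup G) (S : ι → Subring (G → WW Q)) (hS : ∀ i, IsLoc (Cs i) (S i)) (N : Subgroup G) [N.Normal]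
    (hN : ⨆ i, Cs i = N) (L : Type) [Field L] (lam : L →+* M) (hlam : ∀ n ∈ N, ∀ l, n • lam l = lam l) :
    ∃ (E : Type) (_ : Field E) (_ : MulSemiringAction G E) (i0 : (LaurentSeries F)[X] →+* E) (j : L →+* E),
      Function.Injective i0 ∧ FaithfulSMul G E ∧ (∀ (g : G) B, g • i0 B = i0 B) ∧
      (∀ z : E, (∀ g : G, g • z = z) → ∃ A B, B ≠ 0 ∧ i0 B * z = i0 A) ∧
      (∀ (g : G) l l', g • lam l = lam l' → g • j l = j l') ∧
      (∀ l f, lam l = algebraMap F M f → j l = i0 (C (HahnSeries.C f))) ∧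
      (∀ z : E, (∃ p : (LaurentSeries F)[X], p ≠ 0 ∧ p.eval₂ (i0.comp C) z = 0) → ∀ n ∈ N, n • z = z) := by
  let R := RatFunc M
  let E : Subfield (LaurentSeries R) := EF hfix c Cs S hF hc hS
  have hEm : ∀ z, z ∈ E ↔ z ∈ ER hfix c S := fun z => Iff.rfl
  let act : MulSemiringAction G E :=
    { smul := fun g z => ⟨lmap (aR M g) z.1, ER_act hfix c Cs S hS g _ z.2⟩
      one_smul := fun z => Subtype.ext (lY_one _)
      mul_smul := fun g h z => Subtype.ext (lY_mul _ _ _)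
      smul_zero := fun g => Subtype.ext (map_zero _)
      smul_add := fun g x y => Subtype.ext (map_add _ _ _)
      smul_one := fun g => Subtype.ext (map_one _)
      smul_mul := fun g x y => Subtype.ext (map_mul _ _ _) }
  have hact : ∀ (g : G) (z : E), ((g • z : E) : LaurentSeries R) = lmap (aR M g) z.1 := fun g z => rfl
  let i0 : (LaurentSeries F)[X] →+* E := (pY F M R).codRestrict E.toSubring (fun B =>
    ER_pY_quot hfix c Cs S hS B 1 one_ne_zero _ (by rw [map_one, one_mul]))
  have hi0 : ∀ B, ((i0 B : E) : LaurentSeries R) = pY F M R B := fun B => rfl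
  let jY : L →+* LaurentSeries R := (HahnSeries.C : R →+* _).comp (((algebraMap M[X] R).comp C).comp lam)
  have hjY : ∀ l, jY l = HahnSeries.C (algebraMap M[X] R (C (lam l))) := fun l => rfl
  have hjYa : ∀ (g : G) l, lmap (aR M g) (jY l) = HahnSeries.C (algebraMap M[X] R (C (g • lam l))) := fun g l => by
    rw [hjY, lmap_C, aR_apply, map_C]; rfl
  let j : L →+* E := jY.codRestrict E.toSubring (fun l => by
    refine (mem_ER hfix c S _).2 ⟨?_, fun i => ?_⟩
    · refine le_locSub ⟨0, fun m => ?_⟩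
      rw [hjY, HahnSeries.C_apply, HahnSeries.coeff_single]
      split_ifs
      · exact TT_poly _ (by simp)
      · exact zero_mem _
    · simp only [hjYa]
      refine (hS i).const _ (fun g => ?_) (fun n hn g => ?_)
      · rw [lmap_C]; exact C_mem_F2 _
      · have hnN : n ∈ N := hN ▸ Subgroup.mem_iSup_of_mem i hn
        have h1 : g⁻¹ * n * g ∈ N := by
          have := Subgroup.Normal.conj_mem (inferInstance : N.Normal) n hnN g⁻¹
          rwa [inv_inv] at this
        have h2 := hlam _ h1 l
        have h3 : (n * g) • lam l = g • lam l := by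
          rw [show n * g = g * (g⁻¹ * n * g) by group, mul_smul, h2]
        rw [h3])
  have hj : ∀ l, ((j l : E) : LaurentSeries R) = HahnSeries.C (algebraMap M[X] R (C (lam l))) := fun B => rfl
  refine ⟨E, inferInstance, act, i0, j, ?_, ?_, ?_, ?_, ?_, ?_, ?_⟩
  · intro x y h
    exact pY_inj (congrArg Subtype.val h)
  · refine ⟨fun {g h} hgh => ?_⟩
    apply FaithfulSMul.eq_of_smul_eq_smul (α := M)
    intro m
    obtain ⟨ε, h1, h2, h3⟩ := eps_exists (R := R) hfix c hc hg Cs S hS m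
    have h4 := congrArg (fun z : E => (z.1).coeff 0) (hgh ⟨ε, (mem_ER hfix c S _).2 ⟨le_locSub ⟨0, h1⟩, h3⟩⟩)
    simp only [hact, lmap_coeff, h2, aR_apply, map_C] at h4
    exact C_injective (IsFractionRing.injective M[X] R h4)
  · intro g B
    apply Subtype.ext
    rw [hact, hi0, actY_pY hfix]
  · intro z hz
    obtain ⟨A, B, hB, h⟩ := ER_fixed hfix c Cs S hF hc hS z.1 z.2 (fun g => by rw [← hact, hz])
    exact ⟨A, B, hB, Subtype.ext h⟩
  · intro g l l' h
    apply Subtype.ext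
    rw [hact, hj, hj, ← h, lmap_C, aR_apply, map_C]; rfl
  · intro l f h
    apply Subtype.ext
    rw [hj, hi0, h, pY, coe_eval₂RingHom, eval₂_C, lmap_C]; rfl
  · rintro z ⟨p, hp, hpz⟩
    have h1 : p.eval₂ (lmap (iF F M R)) z.1 = 0 := by
      have := congrArg (E.subtype) hpz
      rw [Polynomial.hom_eval₂, map_zero] at this
      convert this using 2
      ext1 f
      · change _ = pY F M R (C f)
        rw [pY, coe_eval₂RingHom, eval₂_C]
      · rfl
    suffices hsub : ∀ i, Cs i ≤ MulAction.stabilizer G z by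
      intro n hn
      rw [← hN] at hn
      exact (iSup_le hsub) hn
    intro i n hn
    have h2 : p.eval₂ (iK F Q) (lmap (eR M (c i)) z.1) = 0 := by
      have := congrArg (lmap (eR M (c i))) h1
      rw [Polynomial.hom_eval₂, map_zero] at this
      convert this using 2
      ext1 f
      have := evY_pY (M := M) (R := R) (c i) (C f)
      rw [eval₂_C, pY, coe_eval₂RingHom, eval₂_C] at this
      exact this.symm
    have h3 := (hS i).const' _ (((mem_ER hfix c S _).1 z.2).2 i) 1 (by
      rw [lY_one]; exact OO_le_F2 (alg_OO _ p hp h2)) n hn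
    rw [mul_one, lY_one] at h3
    rw [MulAction.mem_stabilizer_iff]
    apply Subtype.ext
    rw [hact]
    exact (lmap (eR M (c i))).injective h3

end
end A8

section A9
open Polynomial

theorem ps_hensel {Q : Type} [Field Q] (φ : (PowerSeries Q)[X]) (y0 : Q)
    (h0 : (φ.map (PowerSeries.constantCoeff (R := Q))).eval y0 = 0)
    (h1 : ((derivative φ).map (PowerSeries.constantCoeff (R := Q))).eval y0 ≠ 0) :
    ∃ y : PowerSeries Q, φ.eval y = 0 := by
  classical
  have hcc : ∀ (ψ : (PowerSeries Q)[X]) (P : PowerSeries Q),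
      PowerSeries.constantCoeff (ψ.eval P)
       = (ψ.map (PowerSeries.constantCoeff (R := Q))).eval (PowerSeries.constantCoeff P) := by
    intro ψ P
    rw [eval_map, ← coe_evalRingHom, eval₂_hom]; rfl
  let _ : Inhabited Q := ⟨0⟩
  obtain ⟨q, hq⟩ := rec_exists (A := Q) (fun m f a => (m = 0 → a = y0) ∧ (0 < m → f 0 = y0 →
     PowerSeries.coeff m (φ.eval (PowerSeries.mk f + PowerSeries.C a * PowerSeries.X ^ m)) = 0)) (by
    intro m f
    rcases Nat.eq_zero_or_pos m with rfl | hm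
    · exact ⟨y0, fun _ => rfl, fun h => absurd h (lt_irrefl _)⟩
    by_cases hf : f 0 = y0
    swap
    · exact ⟨0, fun h => absurd h hm.ne', fun _ h => absurd h hf⟩
    set P := PowerSeries.mk f
    set d := PowerSeries.constantCoeff ((derivative φ).eval P) with hd
    have hd0 : d ≠ 0 := by
      rw [hd, hcc]
      have : PowerSeries.constantCoeff P = y0 := by simp [P, hf]
      rw [this]; exact h1
    refine ⟨- PowerSeries.coeff m (φ.eval P) / d, fun h => absurd h hm.ne', fun _ _ => ?_⟩
    obtain ⟨k, hk⟩ := binomExpansion φ P (PowerSeries.C (- PowerSeries.coeff m (φ.eval P) / d) * PowerSeries.X ^ m)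
    rw [hk, map_add, map_add]
    have e1 : PowerSeries.coeff m ((derivative φ).eval P * (PowerSeries.C (- PowerSeries.coeff m (φ.eval P) / d) * PowerSeries.X ^ m)) = d * (- PowerSeries.coeff m (φ.eval P) / d) := by
      rw [← mul_assoc, PowerSeries.coeff_mul_X_pow', if_pos le_rfl, Nat.sub_self]
      simp [hd]
    have e2 : PowerSeries.coeff m (k * (PowerSeries.C (- PowerSeries.coeff m (φ.eval P) / d) * PowerSeries.X ^ m)^2) = 0 := by
      rw [mul_pow, ← mul_assoc, ← pow_mul, PowerSeries.coeff_mul_X_pow', if_neg (by lia)]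
    rw [e1, e2]
    field_simp
    ring)
  have hq0 : q 0 = y0 := (hq 0).1 rfl
  refine ⟨PowerSeries.mk q, ?_⟩
  ext m
  rw [map_zero]
  rcases Nat.eq_zero_or_pos m with rfl | hm
  · rw [PowerSeries.coeff_zero_eq_constantCoeff, hcc]
    simp [hq0, h0]
  have h2 := (hq m).2 hm (by simp only [if_pos hm, hq0])
  have h3 : (PowerSeries.X : PowerSeries Q) ^ (m+1) ∣ PowerSeries.mk q - (PowerSeries.mk (fun l => if l < m then q l else default) + PowerSeries.C (q m) * PowerSeries.X ^ m) := by
    rw [PowerSeries.X_pow_dvd_iff]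
    intro l hl
    rw [map_sub, map_add, PowerSeries.coeff_mk, PowerSeries.coeff_mk, PowerSeries.coeff_C_mul_X_pow]
    rcases lt_or_eq_of_le (Nat.lt_succ_iff.1 hl) with h | rfl
    · simp [h, h.ne]
    · have : (default : Q) = 0 := rfl
      simp [this]
  have h4 := h3.trans (sub_dvd_eval_sub _ _ φ)
  rw [PowerSeries.X_pow_dvd_iff] at h4
  have h5 := h4 m (Nat.lt_succ_self m)
  rw [map_sub, h2, sub_zero] at h5
  exact h5


theorem as1 {K L : Type} [Field K] [Field L] [Algebra K L] (p : ℕ) [Fact p.Prime] [CharP L p]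
    (x : K) (y : ℕ → L) (hy0 : y 0 = 1)
    (hy : ∀ i, y (i+1) ^ p = y (i+1) + algebraMap K L x * y i) :
    ∃ a : (L ≃ₐ[K] L) →* PowerSeries L,
      (∀ σ : L ≃ₐ[K] L, PowerSeries.map (σ : L →+* L) (PowerSeries.mk y) = a σ * PowerSeries.mk y) ∧
      (∀ σ, PowerSeries.constantCoeff (a σ) = 1) ∧
      (∀ σ i, PowerSeries.coeff i (a σ) ∈ (⊥ : Subfield L)) := by
  set u := PowerSeries.mk y with hu
  have hu0 : PowerSeries.constantCoeff u = 1 := by simp [hu, hy0]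
  have hun : u ≠ 0 := by
    intro h; rw [h] at hu0; simp at hu0
  set w : PowerSeries L := 1 + PowerSeries.C (algebraMap K L x) * PowerSeries.X with hw
  have hw0 : w ≠ 0 := by
    intro h
    have := congrArg (PowerSeries.constantCoeff (R := L)) h
    simp [hw] at this
  have hfu : PowerSeries.map (frobenius L p) u = u * w := by
    ext i
    cases i with
    | zero => simp [hu, hw, hy0]
    | succ i =>
      rw [hw, mul_add, mul_one, map_add, ← mul_assoc, PowerSeries.coeff_succ_mul_X, PowerSeries.coeff_mul_C]
      simp [hu, frobenius_def, hy, mul_comm]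
  have hcomm : ∀ (σ : L →+* L) (v : PowerSeries L), PowerSeries.map (frobenius L p) (PowerSeries.map σ v) =
      PowerSeries.map σ (PowerSeries.map (frobenius L p) v) := by
    intro σ v; ext i; simp [frobenius_def]
  have hwf : ∀ σ : L ≃ₐ[K] L, PowerSeries.map (σ : L →+* L) w = w := by
    intro σ; rw [hw, map_add, map_mul, map_one, PowerSeries.map_X, PowerSeries.map_C]; congr 3; exact σ.commutes x
  have hfix : ∀ σ : L ≃ₐ[K] L, ∀ i, PowerSeries.coeff i (PowerSeries.map (σ : L →+* L) u * u⁻¹) ∈ (⊥ : Subfield L) := by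
    intro σ i
    rw [Subfield.mem_bot_iff_pow_eq_self L p]
    set a := PowerSeries.map (σ : L →+* L) u * u⁻¹ with ha
    have h1 : PowerSeries.map (σ : L →+* L) u = a * u := by
      rw [ha, mul_assoc, PowerSeries.inv_mul_cancel _ (by rw [hu0]; exact one_ne_zero), mul_one]
    have h2 := congrArg (PowerSeries.map (frobenius L p)) h1
    rw [hcomm, hfu, map_mul, hwf, h1, map_mul, hfu] at h2
    have h3 : a = PowerSeries.map (frobenius L p) a := by
      apply mul_right_cancel₀ (mul_ne_zero hun hw0)
      linear_combination h2
    conv_rhs => rw [h3]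
    rw [PowerSeries.coeff_map, frobenius_def]
  have hfix2 : ∀ σ τ : L ≃ₐ[K] L, PowerSeries.map (τ : L →+* L) (PowerSeries.map (σ : L →+* L) u * u⁻¹) = PowerSeries.map (σ : L →+* L) u * u⁻¹ := by
    intro σ τ
    ext i
    rw [PowerSeries.coeff_map]
    have := hfix σ i
    have h4 : (⊥ : Subfield L) ≤ (RingHom.eqLocusField (τ : L →+* L) (RingHom.id L)) := bot_le
    exact h4 this
  have hm : ∀ σ : L ≃ₐ[K] L, PowerSeries.map (σ : L →+* L) u = (PowerSeries.map (σ : L →+* L) u * u⁻¹) * u := by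
    intro σ
    rw [mul_assoc, PowerSeries.inv_mul_cancel _ (by rw [hu0]; exact one_ne_zero), mul_one]
  refine ⟨⟨⟨fun σ => PowerSeries.map (σ : L →+* L) u * u⁻¹, ?_⟩, ?_⟩, hm, ?_, hfix⟩
  · have : PowerSeries.map ((1 : L ≃ₐ[K] L) : L →+* L) u = u := by ext i; simp
    rw [this, PowerSeries.mul_inv_cancel _ (by rw [hu0]; exact one_ne_zero)]
  · intro σ τ
    apply mul_right_cancel₀ hun
    dsimp only
    rw [← hm]
    have : PowerSeries.map ((σ * τ : L ≃ₐ[K] L) : L →+* L) u = PowerSeries.map (σ : L →+* L) (PowerSeries.map (τ : L →+* L) u) := by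
      ext i; simp
    rw [this]
    conv_lhs => rw [hm τ, map_mul, hfix2, hm σ]
    ring
  · intro σ
    have := hm σ
    have h2 := congrArg (PowerSeries.constantCoeff (R := L)) this
    rw [map_mul, hu0, mul_one] at h2
    change PowerSeries.constantCoeff (PowerSeries.map (σ : L →+* L) u * u⁻¹) = 1
    rw [← h2, ← PowerSeries.coeff_zero_eq_constantCoeff_apply, PowerSeries.coeff_map,
      PowerSeries.coeff_zero_eq_constantCoeff_apply, hu0, map_one]

end A9

section B1
open Polynomial

theorem as_sep0 {F L : Type} [Field F] [Field L] [Algebra F L] (p : ℕ) [CharP F p]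
    (b : F) (z : L) (h : z ^ p = z + algebraMap F L b) : IsSeparable F z := by
  have key : (X ^ p - X - C b : F[X]).Separable → minpoly F z ∣ (X ^ p - X - C b : F[X]) → (minpoly F z).Separable :=
    fun h1 h2 => h1.of_dvd h2
  refine key ?_ (minpoly.dvd _ _ ?_)
  · rw [separable_def]
    simp only [derivative_sub, derivative_X_pow, derivative_X, derivative_C, CharP.cast_eq_zero, map_zero, zero_mul, zero_sub, sub_zero]
    exact isCoprime_one_right.neg_right
  · simp only [map_sub, map_pow, aeval_X, aeval_C, h]
    ring

theorem as_sep {K L : Type} [Field K] [Field L] [Algebra K L] (p : ℕ) [CharP K p]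
    (x : K) (y : ℕ → L) (hy0 : y 0 = 1)
    (hy : ∀ i, y (i+1) ^ p = y (i+1) + algebraMap K L x * y i) : ∀ i, IsSeparable K (y i) := by
  intro i
  induction i with
  | zero => rw [hy0, ← map_one (algebraMap K L)]; exact isSeparable_algebraMap 1
  | succ i ih =>
    have := (IntermediateField.isSeparable_adjoin_simple_iff_isSeparable K L).2 ih
    apply IsSeparable.of_algebra_isSeparable_of_isSeparable (E := IntermediateField.adjoin K {y i}) K
    have : CharP (IntermediateField.adjoin K {y i}) p := charP_of_injective_algebraMap (algebraMap K _).injective p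
    apply as_sep0 p (algebraMap K _ x * ⟨y i, IntermediateField.mem_adjoin_simple_self K _⟩)
    exact hy i

theorem as2 {K L : Type} [Field K] [Field L] [Algebra K L] [Normal K L] (p : ℕ) [Fact p.Prime] [CharP K p]
    (x : K) (y : ℕ → L) (hy0 : y 0 = 1)
    (hy : ∀ i, y (i+1) ^ p = y (i+1) + algebraMap K L x * y i) (hx : ∀ w : K, w ^ p ≠ w + x) (e : ℕ) :
    ∃ Z : IntermediateField K L, Z ≤ IntermediateField.adjoin K (Set.range y) ∧ FiniteDimensional K Z ∧
      IsGalois K Z ∧ (∀ σ τ : Z ≃ₐ[K] Z, σ * τ = τ * σ) ∧ (∀ σ : Z ≃ₐ[K] Z, σ ^ (p ^ (e+1)) = 1) ∧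
      (∃ τ : Z ≃ₐ[K] Z, τ ^ (p ^ e) ≠ 1) := by
  have hp := (Fact.out : p.Prime)
  have : CharP L p := charP_of_injective_algebraMap (algebraMap K L).injective p
  obtain ⟨a, ha, ha1, hab⟩ := as1 p x y hy0 hy
  have hsep := as_sep p x y hy0 hy
  set m := p ^ e with hm
  set Z := IntermediateField.adjoin K (y '' (Set.Iic m)) with hZ
  have hyZ : ∀ i ≤ m, y i ∈ Z := fun i hi => IntermediateField.subset_adjoin _ _ ⟨i, hi, rfl⟩
  have hbotZ : ∀ z ∈ (⊥ : Subfield L), z ∈ Z := by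
    intro z hz
    have : (⊥ : Subfield L) ≤ Z.toSubfield := bot_le
    exact this hz
  have hact : ∀ (σ : L ≃ₐ[K] L) i, σ (y i) = ∑ q ∈ Finset.HasAntidiagonal.antidiagonal i, PowerSeries.coeff q.1 (a σ) * y q.2 := by
    intro σ i
    have := congrArg (PowerSeries.coeff i) (ha σ)
    rw [PowerSeries.coeff_map, PowerSeries.coeff_mul] at this
    simpa using this
  have hfd : FiniteDimensional K Z := by
    have : Finite (y '' (Set.Iic m)) := ((Set.finite_Iic m).image y).to_subtype
    exact IntermediateField.finiteDimensional_adjoin (by rintro _ ⟨i, _, rfl⟩; exact (hsep i).isIntegral)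
  have hs : Algebra.IsSeparable K Z := by
    rw [IntermediateField.isSeparable_adjoin_iff_isSeparable]
    rintro _ ⟨i, _, rfl⟩; exact hsep i
  have hn : Normal K Z := by
    rw [IntermediateField.normal_iff_forall_map_le']
    intro σ
    rw [hZ, IntermediateField.adjoin_map, IntermediateField.adjoin_le_iff]
    rintro _ ⟨_, ⟨i, hi, rfl⟩, rfl⟩
    change σ (y i) ∈ Z
    rw [hact]
    refine sum_mem fun q hq => mul_mem (hbotZ _ (hab _ _)) (hyZ _ ?_)
    rw [Finset.HasAntidiagonal.mem_antidiagonal] at hq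
    have : i ≤ m := hi
    lia
  have hG : IsGalois K Z := { }
  have hext : ∀ σ τ : Z ≃ₐ[K] Z, (∀ i (hi : i ≤ m), σ ⟨y i, hyZ i hi⟩ = τ ⟨y i, hyZ i hi⟩) → σ = τ := by
    intro σ τ h
    have : (σ : Z →ₐ[K] Z) = τ := by
      apply IntermediateField.algHom_ext_of_eq_adjoin K hZ
      rintro _ ⟨i, hi, rfl⟩
      exact h i hi
    ext z
    exact congrArg Subtype.val (DFunLike.congr_fun this z)
  choose lf hlf using fun σ : Z ≃ₐ[K] Z => (AlgEquiv.restrictNormalHom_surjective (F := K) (K₁ := Z) L σ)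
  have hlf' : ∀ σ : L ≃ₐ[K] L, ∀ z : Z, ((AlgEquiv.restrictNormalHom Z σ) z : L) = σ z :=
    fun σ z => AlgEquiv.restrictNormal_commutes σ Z z
  have key : ∀ σ τ : L ≃ₐ[K] L, (∀ i ≤ m, PowerSeries.coeff i (a σ) = PowerSeries.coeff i (a τ)) →
      AlgEquiv.restrictNormalHom Z σ = AlgEquiv.restrictNormalHom Z τ := by
    intro σ τ h
    apply hext
    intro i hi
    apply Subtype.ext
    rw [hlf', hlf']
    change σ (y i) = τ (y i)
    rw [hact, hact]
    refine Finset.sum_congr rfl fun q hq => ?_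
    rw [Finset.HasAntidiagonal.mem_antidiagonal] at hq
    rw [h _ (by lia)]
  have key2 : ∀ σ τ : L ≃ₐ[K] L, AlgEquiv.restrictNormalHom Z σ = AlgEquiv.restrictNormalHom Z τ → 
     (∀ i ≤ m, PowerSeries.coeff i (a σ) = PowerSeries.coeff i (a τ)) := by
    intro σ τ h i
    induction i using Nat.strong_induction_on with
    | _ i ih =>
      intro hi
      have h1 : σ (y i) = τ (y i) := by
        have := hlf' σ ⟨y i, hyZ i hi⟩
        rw [h, hlf'] at this
        exact this.symm
      rw [hact, hact, Finset.Nat.antidiagonal_eq_map', Finset.sum_map, Finset.sum_map, Finset.sum_range_succ', Finset.sum_range_succ'] at h1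
      rw [Finset.sum_congr rfl (g := fun j => PowerSeries.coeff (i - (j+1)) (a τ) * y (j+1)) fun j hj => ?_] at h1
      · have h2 := add_left_cancel h1
        change PowerSeries.coeff (i - 0) (a σ) * y 0 = PowerSeries.coeff (i - 0) (a τ) * y 0 at h2
        simpa [hy0] using h2
      · rw [Finset.mem_range] at hj
        change PowerSeries.coeff (i - (j+1)) (a σ) * y (j+1) = _
        rw [ih _ (by lia) (by lia)]
  have hb : ∀ σ, ∃ b, a σ = 1 + PowerSeries.X * b := by
    intro σ
    have : PowerSeries.X ∣ a σ - 1 := by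
      rw [PowerSeries.X_dvd_iff, map_sub, ha1, map_one, sub_self]
    obtain ⟨b, hb⟩ := this
    exact ⟨b, by rw [← hb]; ring⟩
  have : CharP (PowerSeries L) p := charP_of_injective_algebraMap (PowerSeries.C_injective (R := L)) p
  have hpow : ∀ σ b, a σ = 1 + PowerSeries.X * b → ∀ j, a (σ ^ p ^ j) = 1 + PowerSeries.X ^ (p ^ j) * b ^ (p ^ j) := by
    intro σ b h j
    rw [map_pow, h, add_pow_char_pow, one_pow, mul_pow]
  refine ⟨Z, IntermediateField.adjoin.mono _ _ _ (Set.image_subset_range _ _), hfd, hG, ?_, ?_, ?_⟩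
  · intro σ τ
    rw [← hlf σ, ← hlf τ, ← map_mul, ← map_mul]
    apply key
    intro i _
    rw [map_mul a, map_mul a, mul_comm]
  · intro σ
    rw [← hlf σ, ← map_pow, ← map_one (AlgEquiv.restrictNormalHom (F := K) (K₁ := L) Z)]
    apply key
    intro i hi
    obtain ⟨b, hb⟩ := hb (lf σ)
    rw [hpow _ b hb, map_add, PowerSeries.coeff_X_pow_mul', if_neg, add_zero, map_one a]
    have : p ^ e < p ^ (e+1) := Nat.pow_lt_pow_right hp.one_lt (Nat.lt_succ_self e)
    lia
  · have hm1 : 1 ≤ m := Nat.one_le_pow _ _ hp.pos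
    have : ∃ τ : Z ≃ₐ[K] Z, τ ⟨y 1, hyZ 1 hm1⟩ ≠ ⟨y 1, hyZ 1 hm1⟩ := by
      by_contra hcon
      push Not at hcon
      obtain ⟨w, hw⟩ := (IsGalois.mem_range_algebraMap_iff_fixed (F := K) (E := Z) ⟨y 1, hyZ 1 hm1⟩).2 hcon
      apply hx w
      apply (algebraMap K L).injective
      have h1 : algebraMap K L w = y 1 := congrArg Subtype.val hw
      rw [map_pow, map_add, h1, hy 0, hy0, mul_one]
    obtain ⟨τ, hτ⟩ := this
    refine ⟨τ, fun h => ?_⟩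
    rw [← hlf τ, ← map_pow, ← map_one (AlgEquiv.restrictNormalHom (F := K) (K₁ := L) Z)] at h
    have h2 := key2 _ _ h m le_rfl
    obtain ⟨b, hb⟩ := hb (lf τ)
    rw [hm, hpow _ b hb, map_add, map_one a, PowerSeries.coeff_X_pow_mul', if_pos le_rfl, Nat.sub_self] at h2
    have h3 : PowerSeries.constantCoeff b = 0 := by
      rw [PowerSeries.coeff_zero_eq_constantCoeff_apply, map_pow] at h2
      exact pow_eq_zero_iff (by positivity) |>.1 (left_eq_add.1 h2.symm)
    apply hτ
    apply Subtype.ext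
    have h4 := hlf' (lf τ) ⟨y 1, hyZ 1 hm1⟩
    rw [hlf] at h4
    rw [h4]
    change lf τ (y 1) = y 1
    rw [hact, Finset.Nat.antidiagonal_succ]
    have h5 : PowerSeries.coeff 1 (a (lf τ)) = 0 := by
      rw [hb, map_add, ← pow_one PowerSeries.X, PowerSeries.coeff_X_pow_mul', if_pos le_rfl, PowerSeries.coeff_one]
      simp [h3]
    simp [ha1, h5]

end B1

section B2
open Polynomial

theorem grp_cyc {Γ : Type} [CommGroup Γ] [Finite Γ] (p e : ℕ) (hp : p.Prime)
    (h1 : ∀ σ : Γ, σ ^ (p ^ (e+1)) = 1) (τ : Γ) (h2 : τ ^ (p ^ e) ≠ 1) :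
    ∃ H : Subgroup Γ, IsCyclic (Γ ⧸ H) ∧ Nat.card (Γ ⧸ H) = p ^ (e+1) := by
  have : NeZero (Monoid.exponent Γ) := ⟨Monoid.exponent_ne_zero_of_finite⟩
  obtain ⟨φ, hφ⟩ := CommGroup.exists_apply_ne_one_of_hasEnoughRootsOfUnity Γ ℂ h2
  refine ⟨φ.ker, ?_⟩
  let eq := QuotientGroup.quotientKerEquivRange φ
  have hfin : Finite φ.range := Finite.of_equiv _ eq.toEquiv
  have hc : IsCyclic φ.range := isCyclic_subgroup_units _
  have hc2 : IsCyclic (Γ ⧸ φ.ker) := eq.isCyclic.2 hc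
  refine ⟨hc2, ?_⟩
  apply Nat.dvd_antisymm
  · rw [← IsCyclic.exponent_eq_card]
    apply Monoid.exponent_dvd_of_forall_pow_eq_one
    intro g
    obtain ⟨g, rfl⟩ := QuotientGroup.mk_surjective g
    rw [← QuotientGroup.mk_pow, h1]; rfl
  · have h3 : orderOf (φ τ) = p ^ (e+1) := by
      have : Fact p.Prime := ⟨hp⟩
      apply orderOf_eq_prime_pow
      · rwa [← map_pow]
      · rw [← map_pow, h1, map_one]
    rw [← h3, Nat.card_congr eq.toEquiv]
    exact Subgroup.orderOf_dvd_natCard _ ⟨τ, rfl⟩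

theorem as3 {K Z : Type} [Field K] [Field Z] [Algebra K Z] [FiniteDimensional K Z] [IsGalois K Z] (p e : ℕ) (hp : p.Prime)
    (hcm : ∀ σ τ : Z ≃ₐ[K] Z, σ * τ = τ * σ)
    (h1 : ∀ σ : Z ≃ₐ[K] Z, σ ^ (p ^ (e+1)) = 1) (τ : Z ≃ₐ[K] Z) (h2 : τ ^ (p ^ e) ≠ 1) :
    ∃ Y : IntermediateField K Z, IsGalois K Y ∧ IsCyclic (Y ≃ₐ[K] Y) ∧ Nat.card (Y ≃ₐ[K] Y) = p ^ (e+1) := by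
  let _ : CommGroup (Z ≃ₐ[K] Z) := { (inferInstance : Group (Z ≃ₐ[K] Z)) with mul_comm := hcm }
  obtain ⟨H, hH1, hH2⟩ := grp_cyc p e hp h1 τ h2
  let eq := IsGalois.normalAutEquivQuotient H
  refine ⟨IntermediateField.fixedField H, inferInstance, eq.isCyclic.1 hH1, ?_⟩
  rw [← Nat.card_congr eq.toEquiv, hH2]

theorem as4 {K Ω : Type} [Field K] [Field Ω] [Algebra K Ω] (p : ℕ) [Fact p.Prime] [CharP K p]
    (x : K) (y : ℕ → Ω) (hy0 : y 0 = 1)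
    (hy : ∀ i, y (i+1) ^ p = y (i+1) + algebraMap K Ω x * y i) (hx : ∀ w : K, w ^ p ≠ w + x) (e : ℕ) :
    ∃ Z : IntermediateField K Ω, FiniteDimensional K Z ∧
      IsGalois K Z ∧ IsCyclic (Z ≃ₐ[K] Z) ∧ Nat.card (Z ≃ₐ[K] Z) = p ^ (e+1) := by
  have hsep := as_sep p x y hy0 hy
  let A := algebraicClosure K Ω
  let φ : A →ₐ[K] AlgebraicClosure K := IsAlgClosed.lift
  let y' : ℕ → A := fun i => ⟨y i, mem_algebraicClosure_iff.2 (hsep i).isIntegral.isAlgebraic⟩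
  have hy0' : φ (y' 0) = 1 := by
    have : y' 0 = 1 := Subtype.ext hy0
    rw [this, map_one]
  have hy' : ∀ i, φ (y' (i+1)) ^ p = φ (y' (i+1)) + algebraMap K _ x * φ (y' i) := by
    intro i
    have : y' (i+1) ^ p = y' (i+1) + algebraMap K A x * y' i := Subtype.ext (hy i)
    rw [← map_pow, this, map_add, map_mul, AlgHom.commutes]
  obtain ⟨Z, hZ, hfd, hG, hcm, h1, τ, h2⟩ := as2 p x (fun i => φ (y' i)) hy0' hy' hx e
  obtain ⟨Y, hY1, hY2, hY3⟩ := as3 p e Fact.out hcm h1 τ h2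
  have hr : Z ≤ φ.fieldRange := by
    refine hZ.trans ?_
    rw [IntermediateField.adjoin_le_iff]
    rintro _ ⟨i, rfl⟩
    exact ⟨_, rfl⟩
  let ψ : Y →ₐ[K] Ω := A.val.comp ((AlgEquiv.ofInjectiveField φ).symm.toAlgHom.comp
    ((Subalgebra.inclusion (S := Z.toSubalgebra) (T := φ.range) hr).comp Y.val))
  let eq : Y ≃ₐ[K] ψ.fieldRange := AlgEquiv.ofInjectiveField ψ
  have hfd2 : FiniteDimensional K Y := inferInstance
  refine ⟨ψ.fieldRange, Module.Finite.equiv eq.toLinearEquiv, IsGalois.of_algEquiv eq, ?_, ?_⟩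
  · exact eq.autCongr.isCyclic.1 hY2
  · rw [← Nat.card_congr eq.autCongr.toEquiv, hY3]

theorem km1 {K Ω : Type} [Field K] [Field Ω] [Algebra K Ω] (q : ℕ) (hq : 0 < q) (ζ : K) (hζ : IsPrimitiveRoot ζ q)
    (a : K) (y : Ω) (hy : y ^ q = algebraMap K Ω a) (hirr : Irreducible (X ^ q - C a)) :
    ∃ Z : IntermediateField K Ω, FiniteDimensional K Z ∧
      IsGalois K Z ∧ IsCyclic (Z ≃ₐ[K] Z) ∧ Nat.card (Z ≃ₐ[K] Z) = q := by
  have hm : minpoly K y = X ^ q - C a := by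
    symm
    apply minpoly.eq_of_irreducible_of_monic hirr
    · simp [hy]
    · exact monic_X_pow_sub_C _ hq.ne'
  have hint : IsIntegral K y := ⟨X ^ q - C a, monic_X_pow_sub_C _ hq.ne', by simp [hy]⟩
  let Z := IntermediateField.adjoin K {y}
  have hfd : FiniteDimensional K Z := IntermediateField.adjoin.finiteDimensional hint
  have hr : Module.finrank K Z = q := by
    rw [IntermediateField.adjoin.finrank hint, hm, natDegree_X_pow_sub_C]
  have hne : (primitiveRoots (Module.finrank K Z) K).Nonempty := by
    rw [hr]; exact ⟨ζ, (mem_primitiveRoots hq).2 hζ⟩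
  have h3 : ∃ (α : Z), α ^ (Module.finrank K Z) ∈ Set.range (algebraMap K Z) ∧ IntermediateField.adjoin K {α} = ⊤ := by
    refine ⟨IntermediateField.AdjoinSimple.gen K y, ⟨a, ?_⟩, ?_⟩
    · rw [hr]
      apply Subtype.ext
      exact hy.symm
    · exact IntermediateField.adjoin_eq_top_of_algebra K _ (IntermediateField.adjoin.powerBasis hint).adjoin_gen_eq_top
  have h4 := ((isCyclic_tfae K Z hne).out 0 2).2 h3
  refine ⟨Z, hfd, h4.1, h4.2, ?_⟩
  have := h4.1
  rw [IsGalois.card_aut_eq_finrank, hr]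

end B2

section B3
open Polynomial

open scoped RatFunc in
theorem cyc_loc {G Q : Type} [Group G] [Finite G] [Field Q] (c : G)
    (h : ∃ Z : IntermediateField (RatFunc Q) (LaurentSeries Q), FiniteDimensional (RatFunc Q) Z ∧
      IsGalois (RatFunc Q) Z ∧ IsCyclic (Z ≃ₐ[RatFunc Q] Z) ∧ Nat.card (Z ≃ₐ[RatFunc Q] Z) = orderOf c) :
    ∃ S : Subring (G → WW Q), IsLoc (Subgroup.zpowers c) S := by
  obtain ⟨Z, h1, h2, h3, h4⟩ := h
  let e : (Z ≃ₐ[RatFunc Q] Z) ≃* Subgroup.zpowers c := mulEquivOfCyclicCardEq (by rw [h4, Nat.card_zpowers])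
  obtain ⟨S, hS⟩ := loc_exists' Z ((Subgroup.zpowers c).subtype.comp e.toMonoidHom)
    (fun a b h => e.injective (Subtype.ext h))
  have : ((Subgroup.zpowers c).subtype.comp e.toMonoidHom).range = Subgroup.zpowers c := by
    rw [MonoidHom.range_comp]
    have : e.toMonoidHom.range = ⊤ := MonoidHom.range_eq_top.2 e.surjective
    rw [this, ← MonoidHom.range_eq_map, Subgroup.range_subtype]
  rw [this] at hS
  exact ⟨S, hS⟩

theorem km_irr (Q : Type) [Field Q] (q : ℕ) (hq : 0 < q) :
    Irreducible (X ^ q - C (algebraMap Q[X] (RatFunc Q) (1 + X)) : (RatFunc Q)[X]) := by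
  have h1 : Irreducible (X ^ q - C (1 + X) : Q[X][X]) := by
    have hm : (X ^ q - C (1 + X) : Q[X][X]).Monic := monic_X_pow_sub_C _ hq.ne'
    have hX : Prime (X + C 1 : Q[X]) := (monic_X_add_C _).prime_of_degree_eq_one (degree_X_add_C _)
    have hX' : (X + C 1 : Q[X]) = 1 + X := by rw [map_one, add_comm]
    rw [hX'] at hX
    apply Polynomial.irreducible_of_eisenstein_criterion (P := Ideal.span {(1 + X : Q[X])})
    · rw [Ideal.span_singleton_prime hX.ne_zero]; exact hX
    · rw [hm.leadingCoeff, Ideal.mem_span_singleton]; exact fun h => hX.not_isUnit (isUnit_of_dvd_one h)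
    · intro n hn
      rw [degree_X_pow_sub_C hq, Nat.cast_lt] at hn
      rw [coeff_sub, coeff_X_pow, if_neg hn.ne, coeff_C, zero_sub, Ideal.mem_span_singleton]
      split_ifs
      · exact (dvd_refl _).neg_right
      · simp
    · rw [degree_X_pow_sub_C hq]; exact_mod_cast hq
    · rw [coeff_sub, coeff_X_pow, if_neg hq.ne, coeff_C, if_pos rfl, zero_sub, Ideal.span_singleton_pow, Ideal.mem_span_singleton, dvd_neg]
      intro h
      have := hX.not_isUnit
      obtain ⟨b, hb⟩ := h
      apply this
      have h2 : (1 + X : Q[X]) * 1 = (1+X) * ((1+X) * b) := by rw [mul_one]; linear_combination hb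
      exact IsUnit.of_mul_eq_one b (mul_left_cancel₀ hX.ne_zero h2).symm
    · exact hm.isPrimitive
  have hm : (X ^ q - C (1 + X) : Q[X][X]).Monic := monic_X_pow_sub_C _ hq.ne'
  have := (hm.irreducible_iff_irreducible_map_fraction_map (K := RatFunc Q)).1 h1
  simpa using this

theorem as_no (Q : Type) [Field Q] (p : ℕ) (hp : 1 < p) (w : RatFunc Q) :
    w ^ p ≠ w + algebraMap Q[X] (RatFunc Q) X := by
  intro h
  have hint : IsIntegral Q[X] w := by
    refine ⟨X ^ p - (X + C X), ?_, ?_⟩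
    · apply monic_X_pow_sub
      rw [degree_X_add_C]; exact_mod_cast hp
    · simp [h]
  obtain ⟨v, rfl⟩ := (IsIntegrallyClosed.isIntegral_iff).1 hint
  rw [← map_pow, ← map_add] at h
  have h2 := RatFunc.algebraMap_injective Q h
  have h3 := congrArg natDegree h2
  rw [natDegree_pow] at h3
  rcases Nat.lt_or_ge 1 v.natDegree with h4 | h4
  · rw [natDegree_add_eq_left_of_natDegree_lt (by rw [natDegree_X]; exact h4)] at h3
    nlinarith
  · have h5 : (v + X).natDegree ≤ 1 := (natDegree_add_le _ _).trans (by simp [h4])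
    have h6 : v.natDegree = 0 := by
      by_contra h0
      have : 1 ≤ v.natDegree := Nat.pos_of_ne_zero h0
      nlinarith
    rw [natDegree_add_eq_right_of_natDegree_lt (by rw [natDegree_X]; lia), h6, natDegree_X] at h3
    simp at h3

open scoped RatFunc in
theorem loc_kummer {G Q : Type} [Group G] [Finite G] [Field Q] (c : G) (ζ : Q) (hζ : IsPrimitiveRoot ζ (orderOf c))
    (hq : (orderOf c : Q) ≠ 0) : ∃ S : Subring (G → WW Q), IsLoc (Subgroup.zpowers c) S := by
  apply cyc_loc
  have hpos := orderOf_pos c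
  obtain ⟨y, hy⟩ := ps_hensel (X ^ (orderOf c) - C ((1 + X : Q[X]) : PowerSeries Q)) 1 (by simp) (by
    simpa [derivative_X_pow] using hq)
  have hy' : y ^ (orderOf c) = ((1 + X : Q[X]) : PowerSeries Q) := by simpa [sub_eq_zero] using hy
  refine km1 (K := RatFunc Q) (Ω := LaurentSeries Q) (orderOf c) hpos (algebraMap Q (RatFunc Q) ζ)
    (hζ.map_of_injective (algebraMap Q (RatFunc Q)).injective) (algebraMap Q[X] (RatFunc Q) (1 + X))
    (HahnSeries.ofPowerSeries ℤ Q y) ?_ (km_irr Q _ hpos)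
  rw [rl_poly, ← map_pow, hy']

open scoped RatFunc in
theorem loc_as {G Q : Type} [Group G] [Finite G] [Field Q] (p : ℕ) (hp : p.Prime) [CharP Q p] (c : G) (e : ℕ)
    (hc : orderOf c = p ^ (e+1)) : ∃ S : Subring (G → WW Q), IsLoc (Subgroup.zpowers c) S := by
  apply cyc_loc
  have : Fact p.Prime := ⟨hp⟩
  have step : ∀ w : PowerSeries Q, ∃ y : PowerSeries Q, y ^ p = y + PowerSeries.X * w := by
    intro w
    obtain ⟨y, hy⟩ := ps_hensel (X ^ p - X - C (PowerSeries.X * w)) 0 (by simp [hp.ne_zero]) (by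
      simp [derivative_X_pow])
    refine ⟨y, ?_⟩
    have : y ^ p - y - PowerSeries.X * w = 0 := by simpa using hy
    linear_combination this
  choose f hf using step
  let y : ℕ → PowerSeries Q := fun i => Nat.rec 1 (fun _ z => f z) i
  have : CharP (RatFunc Q) p := charP_of_injective_algebraMap (algebraMap Q (RatFunc Q)).injective p
  rw [hc]
  refine as4 (K := RatFunc Q) (Ω := LaurentSeries Q) p (algebraMap Q[X] (RatFunc Q) X)
    (fun i => HahnSeries.ofPowerSeries ℤ Q (y i)) (map_one _) ?_ (as_no Q p hp.one_lt) e
  intro i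
  rw [rl_poly, ← map_pow, ← map_mul, ← map_add, Polynomial.coe_X]
  exact congrArg _ (hf (y i))

end B3

section B4
open MvPolynomial

theorem gen_act {G L : Type} [Group G] [Field L] (α : G →* (L ≃+* L)) :
    ∃ (_ : MulSemiringAction G (FractionRing (MvPolynomial G L))),
      FaithfulSMul G (FractionRing (MvPolynomial G L)) ∧
      ∀ g l, g • (algebraMap (MvPolynomial G L) (FractionRing (MvPolynomial G L)) (C l)) = 
        algebraMap (MvPolynomial G L) (FractionRing (MvPolynomial G L)) (C (α g l)) := by
  classical
  set P := MvPolynomial G L with hP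
  set M := FractionRing P
  let ρ : G → P →+* P := fun g => eval₂Hom (C.comp (α g : L →+* L)) (fun h => X (g * h))
  have ρC : ∀ g l, ρ g (C l) = C (α g l) := fun g l => eval₂Hom_C _ _ _
  have ρX : ∀ g h, ρ g (X h) = X (g * h) := fun g l => eval₂Hom_X' _ _ _
  have ρ1 : ρ 1 = RingHom.id P := by
    apply MvPolynomial.ringHom_ext
    · intro l; rw [ρC, map_one]; rfl
    · intro h; rw [ρX, one_mul]; rfl
  have ρm : ∀ g h, ρ (g * h) = (ρ g).comp (ρ h) := by
    intro g h
    apply MvPolynomial.ringHom_ext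
    · intro l; rw [RingHom.comp_apply, ρC, ρC, ρC, map_mul]; rfl
    · intro l; rw [RingHom.comp_apply, ρX, ρX, ρX, mul_assoc]
  have ρi : ∀ g, Function.Injective (ρ g) := by
    intro g
    have : Function.LeftInverse (ρ g⁻¹) (ρ g) := by
      intro x
      rw [← RingHom.comp_apply, ← ρm, inv_mul_cancel, ρ1]; rfl
    exact this.injective
  let r : G → M →+* M := fun g => IsFractionRing.map (ρi g)
  have hr : ∀ g x, r g (algebraMap P M x) = algebraMap P M (ρ g x) := by
    intro g x
    exact IsLocalization.map_eq _ x
  have h1 : ∀ x : M, r 1 x = x := by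
    intro x
    have : r 1 = RingHom.id M := by
      apply IsLocalization.ringHom_ext (nonZeroDivisors P)
      refine RingHom.ext fun x => ?_
      rw [RingHom.comp_apply, hr, ρ1]; rfl
    rw [this]; rfl
  have h2 : ∀ g h (x : M), r (g * h) x = r g (r h x) := by
    intro g h x
    have : r (g * h) = (r g).comp (r h) := by
      apply IsLocalization.ringHom_ext (nonZeroDivisors P)
      refine RingHom.ext fun x => ?_
      rw [RingHom.comp_apply, RingHom.comp_apply, RingHom.comp_apply, hr, hr, hr, ρm]; rfl
    rw [this]; rfl
  let act : MulSemiringAction G M := { smul := fun g x => r g x, one_smul := h1, mul_smul := h2, smul_zero := fun g => map_zero (r g), smul_add := fun g => map_add (r g), smul_one := fun g => map_one (r g), smul_mul := fun g => map_mul (r g) }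
  refine ⟨act, ?_, ?_⟩
  · refine ⟨fun {g h} H => ?_⟩
    have H1 : r g (algebraMap P M (X 1)) = r h (algebraMap P M (X 1)) := H (algebraMap P M (X 1))
    rw [hr, hr, ρX, ρX, mul_one, mul_one] at H1
    exact X_injective (IsFractionRing.injective P M H1)
  · intro g l
    change r g _ = _
    rw [hr, ρC]

theorem gen_W {G L kb : Type} [Field L] [Field kb] [Algebra L kb] :
    ∃ (w : FractionRing (MvPolynomial G L) →+* FractionRing (MvPolynomial G kb)) (u : kb →+* FractionRing (MvPolynomial G kb)),
     (∀ l, w (algebraMap (MvPolynomial G L) (FractionRing (MvPolynomial G L)) (C l)) = u (algebraMap L kb l)) ∧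
     ∀ (κ : Type) (β : κ → kb) (_ : LinearIndependent L β) (s : Finset κ) (m : κ → FractionRing (MvPolynomial G L)),
       ∑ j ∈ s, w (m j) * u (β j) = 0 → ∀ j ∈ s, m j = 0 := by
  classical
  set P := MvPolynomial G L with hP
  set M := FractionRing P
  set P' := MvPolynomial G kb with hP'
  set W := FractionRing P'
  have hi : Function.Injective (MvPolynomial.map (σ := G) (algebraMap L kb)) := MvPolynomial.map_injective _ (algebraMap L kb).injective
  let w : M →+* W := IsFractionRing.map hi
  have hw : ∀ x, w (algebraMap P M x) = algebraMap P' W (MvPolynomial.map (algebraMap L kb) x) := 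
    fun x => IsLocalization.map_eq _ x
  refine ⟨w, (algebraMap P' W).comp C, ?_, ?_⟩
  · intro l; rw [hw, map_C]; rfl
  · intro κ β hβ s m hm j hj
    obtain ⟨d, hd⟩ := IsLocalization.exist_integer_multiples_of_finset (nonZeroDivisors P) (s.image m)
    have : ∀ j, ∃ a : P, j ∈ s → algebraMap P M a = algebraMap P M d * m j := by
      intro j
      by_cases hj : j ∈ s
      · obtain ⟨a, ha⟩ := hd (m j) (Finset.mem_image_of_mem _ hj)
        refine ⟨a, fun _ => ?_⟩
        rw [ha, Algebra.smul_def]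
      · exact ⟨0, fun h => absurd h hj⟩
    choose a ha using this
    have h1 : ∑ j ∈ s, MvPolynomial.map (algebraMap L kb) (a j) * C (β j) = 0 := by
      apply IsFractionRing.injective P' W
      rw [map_sum, map_zero]
      have := congrArg (fun z => w (algebraMap P M d) * z) hm
      simp only [mul_zero] at this
      rw [← this, Finset.mul_sum]
      refine Finset.sum_congr rfl fun j hj => ?_
      rw [map_mul, ← hw, ha j hj, map_mul, mul_assoc]; rfl
    have h2 : ∀ j ∈ s, a j = 0 := by
      intro j hj
      ext e
      rw [coeff_zero]
      have h3 := congrArg (coeff e) h1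
      rw [coeff_sum, coeff_zero] at h3
      rw [linearIndependent_iff'] at hβ
      refine hβ s (fun j => coeff e (a j)) ?_ j hj
      rw [← h3]
      refine Finset.sum_congr rfl fun j hj => ?_
      rw [mul_comm, coeff_C_mul, coeff_map, Algebra.smul_def, mul_comm]
    have h4 := ha j hj
    rw [h2 j hj, map_zero] at h4
    have hd0 : algebraMap P M d ≠ 0 := by
      rw [Ne, IsFractionRing.to_map_eq_zero_iff]; exact nonZeroDivisors.coe_ne_zero d
    exact (mul_eq_zero.1 h4.symm).resolve_left hd0

theorem descent {k L M G ι : Type} [Field k] [Field L] [Algebra k L] [FiniteDimensional k L] [IsGalois k L] [Group G]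
    [Field M] [MulSemiringAction G M] [Fintype ι] (α : G →* (L ≃ₐ[k] L)) (hα : Function.Surjective α) (lam : L →+* M)
    (hlam : ∀ g l, g • lam l = lam (α g l)) (B : Module.Basis ι k L) (f : ι → M) (hf : ∀ i (g : G), g • f i = f i)
    (h0 : ∑ i, f i * lam (B i) = 0) : ∀ i, f i = 0 := by
  classical
  have h1 : ∀ σ : L ≃ₐ[k] L, ∑ i, f i * lam (σ (B i)) = 0 := by
    intro σ
    obtain ⟨g, rfl⟩ := hα σ
    have := congrArg (fun z => g • z) h0
    simp only [Finset.smul_sum, smul_mul', hf, hlam, smul_zero] at this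
    exact this
  have h2 : ∀ y, ∑ i, f i * lam (algebraMap k L (Algebra.trace k L (B i * y))) = 0 := by
    intro y
    have : ∀ i, f i * lam (algebraMap k L (Algebra.trace k L (B i * y))) = ∑ σ : L ≃ₐ[k] L, f i * lam (σ (B i)) * lam (σ y) := by
      intro i
      rw [trace_eq_sum_automorphisms, map_sum, Finset.mul_sum]
      refine Finset.sum_congr rfl fun σ _ => ?_
      rw [map_mul, map_mul]; ring
    rw [Finset.sum_congr rfl fun i _ => this i, Finset.sum_comm]
    refine Finset.sum_eq_zero fun σ _ => ?_
    rw [← Finset.sum_mul, h1, zero_mul]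
  intro i
  let D := (Algebra.traceForm k L).dualBasis (traceForm_nondegenerate k L) B
  have h3 := h2 (D i)
  rw [Finset.sum_eq_single i] at h3
  · have h4 : Algebra.trace k L (B i * D i) = 1 := by
      have := LinearMap.BilinForm.apply_dualBasis_right (traceForm_nondegenerate k L) (Algebra.traceForm_isSymm k) B i i
      rw [if_pos rfl] at this
      exact this
    rw [h4, map_one, map_one, mul_one] at h3
    exact h3
  · intro j _ hj
    have h4 : Algebra.trace k L (B j * D i) = 0 := by
      have := LinearMap.BilinForm.apply_dualBasis_right (traceForm_nondegenerate k L) (Algebra.traceForm_isSymm k) B j i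
      rw [if_neg hj] at this
      exact this
    rw [h4, map_zero, map_zero, mul_zero]
  · intro h; exact absurd (Finset.mem_univ i) h

open TensorProduct in
theorem reg_dom {k kb F W ι K : Type} [Field k] [Field kb] [Field F] [Field W] [Algebra k kb] [Algebra k F]
    [Field K] [Algebra k K] (cK : K →+* LaurentSeries F) (hcK : ∀ x, cK (algebraMap k K x) = HahnSeries.C (algebraMap k F x))
    (u : kb →+* W) (v : F →+* W) (huv : ∀ x, u (algebraMap k kb x) = v (algebraMap k F x))
    (B : Module.Basis ι k kb) (hlin : ∀ (s : Finset ι) (f : ι → F), (∀ i ∉ s, f i = 0) → ∑ i ∈ s, v (f i) * u (B i) = 0 → ∀ i, f i = 0) :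
    IsDomain (kb ⊗[k] K) := by
  classical
  let W1 := LaurentSeries W
  let U : kb →+* W1 := HahnSeries.C.comp u
  let V : K →+* W1 := (lmap v).comp cK
  let _ : Algebra k W1 := (U.comp (algebraMap k kb)).toAlgebra
  let U' : kb →ₐ[k] W1 := { U with commutes' := fun x => rfl }
  have hc : ∀ x, V (algebraMap k K x) = HahnSeries.C (u (algebraMap k kb x)) := by
    intro x
    rw [huv, ← lmap_C, ← hcK]; rfl
  let V' : K →ₐ[k] W1 := { V with commutes' := fun x => hc x }
  let Φ := Algebra.TensorProduct.productMap U' V'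
  have hΦ : Function.Injective Φ := by
    rw [injective_iff_map_eq_zero]
    intro x hx
    obtain ⟨b, rfl⟩ := TensorProduct.eq_repr_basis_left B x
    have h1 : ∀ i, b i = 0 := by
      intro i
      apply cK.injective
      rw [map_zero]
      ext m
      refine hlin b.support (fun i => (cK (b i)).coeff m) ?_ ?_ i
      · intro i hi
        rw [Finsupp.notMem_support_iff.1 hi, map_zero]; rfl
      · have h2 := congrArg (fun z : W1 => HahnSeries.coeff z m) hx
        simp only [Finsupp.sum, map_sum] at h2
        rw [HahnSeries.coeff_sum, HahnSeries.coeff_zero] at h2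
        rw [← h2]
        refine Finset.sum_congr rfl fun i _ => ?_
        rw [Algebra.TensorProduct.productMap_apply_tmul]
        change _ = (HahnSeries.C (u (B i)) * lmap v (cK (b i))).coeff m
        rw [HahnSeries.C_apply, HahnSeries.coeff_single_zero_mul, lmap_coeff, mul_comm]
    have : b = 0 := Finsupp.ext h1
    rw [this, Finsupp.sum_zero_index]
  exact hΦ.isDomain Φ.toRingHom

end B4

section B5
open Polynomial

open IntermediateField in
theorem prim_shift {F Q : Type} [Field F] [Field Q] [Algebra F Q] [FiniteDimensional F Q] [Algebra.IsSeparable F Q]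
    [Infinite F] (ι : Type) [Fintype ι] : ∃ c : ι → Q, (∀ i j, i ≠ j → minpoly F (c i) ≠ minpoly F (c j)) ∧
      ∀ i, (minpoly F (c i)).natDegree = Module.finrank F Q := by
  obtain ⟨c0, hc0⟩ := Field.exists_primitive_element F Q
  let μ : F → F[X] := fun a => minpoly F (c0 + algebraMap F Q a)
  have hfin : ∀ P : Set.range μ, (μ ⁻¹' {P.1}).Finite := by
    rintro ⟨_, a, rfl⟩
    have h0 : μ a ≠ 0 := minpoly.ne_zero (IsIntegral.of_finite F _)
    apply Set.Finite.of_finite_image (f := fun b => c0 + algebraMap F Q b)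
    · apply Set.Finite.subset ((μ a).rootSet_finite Q)
      rintro _ ⟨b, hb, rfl⟩
      rw [mem_rootSet]
      refine ⟨h0, ?_⟩
      have hb' : μ b = μ a := hb
      rw [← hb']
      exact minpoly.aeval F _
    · intro x _ y _ h
      exact (algebraMap F Q).injective (add_left_cancel h)
  have hinf : (Set.range μ).Infinite := by
    intro hf
    have : (Set.univ : Set F).Finite := by
      have := hf.preimage' (f := μ) (fun b hb => hfin ⟨b, hb⟩)
      simpa using this
    exact Set.infinite_univ this
  have : Infinite (Set.range μ) := hinf.to_subtype
  let e : ι ↪ Set.range μ := ((Fintype.equivFin ι).toEmbedding.trans Fin.valEmbedding).trans (Infinite.natEmbedding _)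
  have h2 : ∀ i, ∃ a, μ a = (e i).1 := fun i => (e i).2
  choose a ha using h2
  refine ⟨fun i => c0 + algebraMap F Q (a i), ?_, ?_⟩
  · intro i j hij h
    apply hij
    apply e.injective
    apply Subtype.ext
    rw [← ha, ← ha]; exact h
  · intro i
    rw [← IntermediateField.adjoin.finrank (IsIntegral.of_finite F _)]
    have : F⟮c0 + algebraMap F Q (a i)⟯ = ⊤ := by
      rw [eq_top_iff, ← hc0, IntermediateField.adjoin_simple_le_iff]
      have h1 := IntermediateField.mem_adjoin_simple_self F (c0 + algebraMap F Q (a i))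
      have h2 := (F⟮c0 + algebraMap F Q (a i)⟯).algebraMap_mem (a i)
      simpa using sub_mem h1 h2
    rw [this, IntermediateField.finrank_top']

theorem span_loc {G Q : Type} [Group G] [Finite G] [Field Q] (N : Subgroup G)
    (hr : ∀ c : G, (orderOf c : Q) ≠ 0 → ∃ ζ : Q, IsPrimitiveRoot ζ (orderOf c)) :
    ∃ (ι : Type) (_ : Fintype ι) (Cs : ι → Subgroup G) (S : ι → Subring (G → WW Q)),
      (∀ i, IsLoc (Cs i) (S i)) ∧ ⨆ i, Cs i = N := by
  classical
  have hk : ∀ c : G, (orderOf c : Q) ≠ 0 → ∃ S : Subring (G → WW Q), IsLoc (Subgroup.zpowers c) S := by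
    intro c hc
    obtain ⟨ζ, hζ⟩ := hr c hc
    exact loc_kummer c ζ hζ hc
  let ι := {c : G // c ∈ N ∧ ∃ S : Subring (G → WW Q), IsLoc (Subgroup.zpowers c) S}
  have hf : Finite ι := Subtype.finite
  refine ⟨ι, Fintype.ofFinite ι, fun i => Subgroup.zpowers i.1, fun i => i.2.2.choose, fun i => i.2.2.choose_spec, ?_⟩
  apply le_antisymm
  · apply iSup_le
    rintro ⟨c, hc, _⟩
    exact (Subgroup.zpowers_le).2 hc
  have key : ∀ c ∈ N, (∃ S : Subring (G → WW Q), IsLoc (Subgroup.zpowers c) S) → c ∈ ⨆ i : ι, Subgroup.zpowers i.1 := by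
    intro c hc h
    exact (le_iSup (fun i : ι => Subgroup.zpowers i.1) ⟨c, hc, h⟩) (Subgroup.mem_zpowers c)
  intro n hn
  obtain ⟨p, hp⟩ := CharP.exists Q
  rcases CharP.char_is_prime_or_zero Q p with hpp | rfl
  · obtain ⟨e, m, hm, hem⟩ := Nat.exists_eq_pow_mul_and_not_dvd (orderOf_pos n).ne' p hpp.ne_one
    have hmpos : 0 < m := Nat.pos_of_ne_zero (by rintro rfl; simp at hm)
    have ppos : 0 < p ^ e := pow_pos hpp.pos _
    have o1 : orderOf (n ^ p ^ e) = m := by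
      rw [orderOf_pow_of_dvd ppos.ne' ⟨m, hem⟩, hem, Nat.mul_div_cancel_left _ ppos]
    have o2 : orderOf (n ^ m) = p ^ e := by
      rw [orderOf_pow_of_dvd hmpos.ne' ⟨p ^ e, by rw [hem, mul_comm]⟩, hem, Nat.mul_div_cancel _ hmpos]
    have h1 : n ^ p ^ e ∈ ⨆ i : ι, Subgroup.zpowers i.1 := by
      apply key _ (pow_mem hn _) (hk _ _)
      rw [o1, Ne, CharP.cast_eq_zero_iff Q p]
      exact hm
    have h2 : n ^ m ∈ ⨆ i : ι, Subgroup.zpowers i.1 := by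
      apply key _ (pow_mem hn _)
      cases e with
      | zero => apply hk; rw [o2]; simp
      | succ e => exact loc_as p hpp _ e o2
    have hcop : IsCoprime ((p ^ e : ℕ) : ℤ) (m : ℤ) := by
      rw [Nat.isCoprime_iff_coprime]
      exact Nat.Coprime.pow_left _ ((Nat.Prime.coprime_iff_not_dvd hpp).2 hm)
    obtain ⟨a, b, hab⟩ := hcop
    have : n = (n ^ p ^ e) ^ a * (n ^ m) ^ b := by
      rw [← zpow_natCast n m, ← zpow_natCast n (p ^ e), ← zpow_mul, ← zpow_mul, ← zpow_add, mul_comm _ a, mul_comm _ b, hab, zpow_one]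
    rw [this]
    exact mul_mem (zpow_mem h1 a) (zpow_mem h2 b)
  · have : CharZero Q := CharP.charP_to_charZero Q
    exact key n hn (hk n (by exact_mod_cast (orderOf_pos n).ne'))

theorem cyc_ext (M : Type) [Field M] (n : ℕ) (hn : n ≠ 0) : ∃ (Q : Type) (_ : Field Q) (_ : Algebra M Q),
    FiniteDimensional M Q ∧ Algebra.IsSeparable M Q ∧ ∀ d, d ∣ n → (d : Q) ≠ 0 → ∃ ζ : Q, IsPrimitiveRoot ζ d := by
  have h : ∃ m : ℕ, m ≠ 0 ∧ (m : M) ≠ 0 ∧ ∀ d, d ∣ n → (d : M) ≠ 0 → d ∣ m := by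
    obtain ⟨p, hp⟩ := CharP.exists M
    rcases CharP.char_is_prime_or_zero M p with hpp | rfl
    · obtain ⟨e, m, hm, hem⟩ := Nat.exists_eq_pow_mul_and_not_dvd hn p hpp.ne_one
      refine ⟨m, by rintro rfl; simp at hm, by rwa [Ne, CharP.cast_eq_zero_iff M p], fun d hd hdp => ?_⟩
      rw [Ne, CharP.cast_eq_zero_iff M p] at hdp
      rw [hem] at hd
      exact Nat.Coprime.dvd_of_dvd_mul_left (Nat.Coprime.pow_right _ ((Nat.Prime.coprime_iff_not_dvd hpp).2 hdp).symm) hd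
    · have : CharZero M := CharP.charP_to_charZero M
      exact ⟨n, hn, by exact_mod_cast hn, fun d hd _ => hd⟩
  obtain ⟨m, hm0, hmM, hd⟩ := h
  have : NeZero m := ⟨hm0⟩
  have : NeZero (m : M) := ⟨hmM⟩
  refine ⟨CyclotomicField m M, inferInstance, inferInstance, IsCyclotomicExtension.finiteDimensional {m} M _, ?_, ?_⟩
  · have := IsCyclotomicExtension.isGalois {m} M (CyclotomicField m M)
    infer_instance
  · intro d hdn hdQ
    have hdM : (d : M) ≠ 0 := by
      intro h0; apply hdQ
      have := congrArg (algebraMap M (CyclotomicField m M)) h0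
      simpa using this
    obtain ⟨e, he⟩ := hd d hdn hdM
    exact ⟨_, (IsCyclotomicExtension.zeta_spec m M (CyclotomicField m M)).pow (Nat.pos_of_ne_zero hm0) (by rw [he, mul_comm])⟩

end B5

section B6

theorem fix_field {k L G M : Type} [Field k] [Field L] [Algebra k L] [Group G] [Finite G] [Field M] [MulSemiringAction G M]
    [FaithfulSMul G M] [Infinite M] (α : G →* (L ≃ₐ[k] L)) (lam : L →+* M) (hlam : ∀ g l, g • lam l = lam (α g l)) :
    ∃ (F : Type) (_ : Field F) (_ : Algebra F M) (_ : Algebra k F),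
      (∀ m : M, (∀ g : G, g • m = m) → ∃ f : F, algebraMap F M f = m) ∧ 
      (∀ (g : G) (f : F), g • algebraMap F M f = algebraMap F M f) ∧ FiniteDimensional F M ∧ Algebra.IsSeparable F M ∧
      Infinite F ∧ (∀ x, lam (algebraMap k L x) = algebraMap F M (algebraMap k F x)) := by
  let F := FixedPoints.subfield G M
  have hk : ∀ x : k, lam (algebraMap k L x) ∈ F := by
    intro x g
    rw [hlam, AlgEquiv.commutes]
  let a : Algebra k F := ((lam.comp (algebraMap k L)).codRestrict F.toSubring hk).toAlgebra
  have hfd : FiniteDimensional F M := inferInstance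
  refine ⟨F, inferInstance, inferInstance, a, fun m hm => ⟨⟨m, hm⟩, rfl⟩, fun g f => f.2 g, hfd, inferInstance, ?_, fun x => rfl⟩
  by_contra h
  have : Finite F := not_infinite_iff_finite.1 h
  have : Finite M := Module.finite_of_finite F
  exact not_finite M

theorem gen_reg {k L G : Type} [Field k] [Field L] [Algebra k L] [FiniteDimensional k L] [IsGalois k L] [Group G] [Finite G]
    (kb : Type) [Field kb] [Algebra k kb] [Algebra L kb] [IsScalarTower k L kb]
    (α : G →* (L ≃ₐ[k] L)) (hα : Function.Surjective α) :
    ∃ (M F : Type) (_ : Field M) (_ : Field F) (_ : MulSemiringAction G M) (_ : Algebra F M) (_ : Algebra k F) (lam : L →+* M),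
      FaithfulSMul G M ∧ (∀ g l, g • lam l = lam (α g l)) ∧
      (∀ m : M, (∀ g : G, g • m = m) → ∃ f : F, algebraMap F M f = m) ∧ 
      (∀ (g : G) (f : F), g • algebraMap F M f = algebraMap F M f) ∧ FiniteDimensional F M ∧ Algebra.IsSeparable F M ∧
      Infinite F ∧ (∀ x, lam (algebraMap k L x) = algebraMap F M (algebraMap k F x)) ∧
      ∃ (W : Type) (_ : Field W) (u : kb →+* W) (v : F →+* W) (ι : Type) (B : Module.Basis ι k kb),
        (∀ x, u (algebraMap k kb x) = v (algebraMap k F x)) ∧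
        (∀ (s : Finset ι) (f : ι → F), (∀ i ∉ s, f i = 0) → ∑ i ∈ s, v (f i) * u (B i) = 0 → ∀ i, f i = 0) := by
  classical
  let α' : G →* (L ≃+* L) := 
    { toFun := fun g => (α g).toRingEquiv
      map_one' := by rw [map_one]; rfl
      map_mul' := fun a b => by rw [map_mul]; rfl }
  obtain ⟨act, hfa, hact⟩ := gen_act α'
  obtain ⟨w, u, hwu, hli⟩ := gen_W (G := G) (L := L) (kb := kb)
  have hinf : Infinite (FractionRing (MvPolynomial G L)) := 
    Infinite.of_injective _ (IsFractionRing.injective (MvPolynomial G L) (FractionRing (MvPolynomial G L)))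
  let lam : L →+* FractionRing (MvPolynomial G L) := (algebraMap (MvPolynomial G L) (FractionRing (MvPolynomial G L))).comp MvPolynomial.C
  have hlam : ∀ g l, g • lam l = lam (α g l) := fun g l => hact g l
  obtain ⟨F, _, _, _, h1, h2, h3, h4, h5, h6⟩ := fix_field α lam hlam
  refine ⟨_, F, inferInstance, inferInstance, act, inferInstance, inferInstance, lam, hfa, hlam, h1, h2, h3, h4, h5, h6, ?_⟩
  let bL := Module.finBasis k L
  let bK := Module.Free.chooseBasis L kb
  refine ⟨_, inferInstance, u, w.comp (algebraMap F _), _, bL.smulTower bK, ?_, ?_⟩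
  · intro x
    rw [RingHom.comp_apply, ← h6, IsScalarTower.algebraMap_apply k L kb, ← hwu]; rfl
  · rintro s f hs h0
    have hz : ∀ j ∈ s.image Prod.snd, ∑ i, algebraMap F (FractionRing (MvPolynomial G L)) (f (i, j)) * lam (bL i) = 0 := by
      apply hli _ bK bK.linearIndependent
      rw [← h0]
      have hss : s ⊆ Finset.univ ×ˢ s.image Prod.snd := by
        intro x hx
        simp only [Finset.mem_product, Finset.mem_univ, true_and]
        exact Finset.mem_image_of_mem _ hx
      rw [Finset.sum_subset hss, Finset.sum_product_right]
      · apply Finset.sum_congr rfl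
        intro j hj
        rw [map_sum, Finset.sum_mul]
        apply Finset.sum_congr rfl
        intro i hi
        rw [map_mul, Module.Basis.smulTower_apply, Algebra.smul_def, map_mul u, ← hwu, mul_assoc]; rfl
      · intro x _ hx
        rw [hs x hx, map_zero, zero_mul]
    rintro ⟨i, j⟩
    by_cases hj : j ∈ s.image Prod.snd
    · have := descent α hα lam hlam bL (fun i => algebraMap F (FractionRing (MvPolynomial G L)) (f (i, j))) 
        (fun i g => h2 g _) (hz j hj) i
      exact (map_eq_zero _).1 this
    · apply hs
      intro h
      exact hj (Finset.mem_image_of_mem _ h)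

open Polynomial in
theorem geom_out (k L G : Type) [Field k] [Field L] [Algebra k L] [FiniteDimensional k L] [IsGalois k L] [Group G] [Finite G]
    (α : G →* (L ≃ₐ[k] L)) (hα : Function.Surjective α) :
    ∃ (K E : Type) (_ : Field K) (_ : Algebra k K) (_ : Field E) (_ : MulSemiringAction G E) (i0 : K[X] →+* E) (j : L →+* E),
      IsDomain (TensorProduct k (AlgebraicClosure k) K) ∧
      Function.Injective i0 ∧ FaithfulSMul G E ∧ (∀ (g : G) B, g • i0 B = i0 B) ∧
      (∀ z : E, (∀ g : G, g • z = z) → ∃ A B, B ≠ 0 ∧ i0 B * z = i0 A) ∧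
      (∀ (g : G) l, g • j l = j (α g l)) ∧
      (∀ x : k, j (algebraMap k L x) = i0 (C (algebraMap k K x))) ∧
      (∀ z : E, (∃ p : K[X], p ≠ 0 ∧ p.eval₂ (i0.comp C) z = 0) → ∀ n ∈ α.ker, n • z = z) := by
  let kb := AlgebraicClosure k
  let a1 : Algebra L kb := (IsAlgClosed.lift (R := k) (S := L) (M := kb)).toRingHom.toAlgebra
  have : IsScalarTower k L kb := IsScalarTower.of_algebraMap_eq (fun x => ((IsAlgClosed.lift (R := k) (S := L) (M := kb)).commutes x).symm)
  obtain ⟨M, F, _, _, _, _, _, lam, hfa, hlam, hF, hfix, hfd, hsep, hinf, hkl, W, _, u, v, ι', B, huv, hlin⟩ := gen_reg kb α hα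
  obtain ⟨Q, _, _, hQ1, hQ2, hQ3⟩ := cyc_ext M (Nat.card G) Nat.card_pos.ne'
  let aFQ : Algebra F Q := ((algebraMap M Q).comp (algebraMap F M)).toAlgebra
  have : IsScalarTower F M Q := IsScalarTower.of_algebraMap_eq (fun x => rfl)
  have : FiniteDimensional F Q := FiniteDimensional.trans F M Q
  have : Algebra.IsSeparable F Q := Algebra.IsSeparable.trans F M Q
  obtain ⟨ι, _, Cs, S, hS, hN⟩ := span_loc (Q := Q) α.ker (fun c => hQ3 _ (orderOf_dvd_natCard c))
  obtain ⟨c, hc, hg⟩ := prim_shift (F := F) (Q := Q) ι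
  obtain ⟨E, fE, aE, i0, j, p1, p2, p3, p4, p5, p6, p7⟩ := patch hF hfix c hc hg Cs S hS α.ker hN L lam (by
    intro n hn l
    rw [hlam, MonoidHom.mem_ker.1 hn]; rfl)
  let aK : Algebra k (LaurentSeries F) := ((HahnSeries.C : F →+* LaurentSeries F).comp (algebraMap k F)).toAlgebra
  refine ⟨LaurentSeries F, E, inferInstance, aK, fE, aE, i0, j, ?_, p1, p2, p3, p4, fun g l => p5 _ _ _ (hlam g l), ?_, p7⟩
  · exact @reg_dom k kb F W ι' (LaurentSeries F) _ _ _ _ _ _ _ aK (RingHom.id _) (fun x => rfl) u v huv B hlin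
  · intro x
    exact p6 _ _ (hkl x)

end B6

section C1
open Polynomial IntermediateField

theorem low_indep {k F Ω ι : Type} [Field k] [Field F] [Field Ω] [Algebra F Ω] [Fintype ι]
    (ev : k[X] →+* F) (hfrac : ∀ z : F, ∃ a b, b ≠ 0 ∧ ev b * z = ev a) (hev : Function.Injective ev)
    (y0 : Ω) (N : ℕ) (b : ι → Ω)
    (low : ∀ a : ι × Fin N → k[X], ∑ i, algebraMap F Ω (ev (a i)) * (b i.1 * y0 ^ (i.2 : ℕ)) = 0 → ∀ i, a i = 0) :
    LinearIndependent F (fun i : ι × Fin N => b i.1 * y0 ^ (i.2 : ℕ)) := by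
  classical
  rw [Fintype.linearIndependent_iff]
  intro g hg
  choose a d hd had using fun i => hfrac (g i)
  have h := low (fun i => a i * ∏ j ∈ Finset.univ.erase i, d j) (by
    have h2 : (algebraMap F Ω (ev (∏ j, d j))) * ∑ i, g i • (b i.1 * y0 ^ (i.2 : ℕ)) = 0 := by rw [hg, mul_zero]
    rw [← h2, Finset.mul_sum]
    apply Finset.sum_congr rfl
    intro i _
    rw [map_mul, ← had, ← Finset.mul_prod_erase _ _ (Finset.mem_univ i), map_mul ev, map_mul (algebraMap F Ω), map_mul (algebraMap F Ω), map_mul (algebraMap F Ω), Algebra.smul_def]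
    ring)
  intro i
  have h3 := h i
  simp only [mul_eq_zero] at h3
  have h4 : a i = 0 := by
    rcases h3 with h3 | h3
    · exact h3
    · rw [Finset.prod_eq_zero_iff] at h3
      obtain ⟨j, _, hj⟩ := h3
      exact absurd hj (hd j)
  have h5 := had i
  rw [h4, map_zero] at h5
  rcases mul_eq_zero.1 h5 with h6 | h6
  · exact absurd (hev (by rw [h6, map_zero])) (hd i)
  · exact h6

theorem final_field {k F Ω L G : Type} [Field k] [Field F] [Field Ω] [Algebra F Ω] [Algebra k Ω] [Field L] [Algebra k L]
    [Algebra k F] [IsScalarTower k F Ω]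
    [FiniteDimensional k L] [IsGalois k L] [Group G] [Finite G]
    (ev : k[X] →+* F) (hfrac : ∀ z : F, ∃ a b, b ≠ 0 ∧ ev b * z = ev a) (hev : Function.Injective ev)
    (α : G →* (L ≃ₐ[k] L)) (hα : Function.Surjective α)
    (Yv : G → Ω) (hY : Function.Injective Yv) (J : L →ₐ[k] Ω)
    (f0 : k[X][X]) (hf : f0.Monic) (hfd : f0.natDegree = Nat.card G)
    (hf0 : ∀ g, f0.eval₂ ((algebraMap F Ω).comp ev) (Yv g) = 0)
    (hr1 : ∀ g, ∃ d P, d ≠ 0 ∧ ∀ h, algebraMap F Ω (ev d) * Yv (h * g) = eval₂ ((algebraMap F Ω).comp ev) (Yv h) P)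
    (ι : Type) [Fintype ι] (B : Module.Basis ι k L)
    (hr2 : ∀ i, ∃ d P, d ≠ 0 ∧ ∀ h, algebraMap F Ω (ev d) * J (α h (B i)) = eval₂ ((algebraMap F Ω).comp ev) (Yv h) P)
    (low : ∀ (ι' : Type) [Fintype ι'] (b : ι' → Ω), LinearIndependent k b → (∀ i, IsAlgebraic k (b i)) →
      ∀ a : ι' × Fin (Nat.card α.ker) → k[X], ∑ i, algebraMap F Ω (ev (a i)) * (b i.1 * (Yv 1) ^ (i.2 : ℕ)) = 0 → ∀ i, a i = 0) :
    ∃ (E : IntermediateField F Ω) (hJ : ∀ l, J l ∈ E), FiniteDimensional F E ∧ IsGalois F E ∧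
      (∀ x ∈ E, IsAlgebraic k x → ∃ l, J l = x) ∧ 
      ∃ e : G ≃* (E ≃ₐ[F] E), ∀ g l, ((e g ⟨J l, hJ l⟩ : E) : Ω) = J (α g l) := by
  classical
  have : Fintype G := Fintype.ofFinite G
  set n := Nat.card G with hn
  have hcard : n = Fintype.card ι * Nat.card α.ker := by
    rw [hn, Subgroup.card_eq_card_quotient_mul_card_subgroup α.ker, Nat.card_congr (QuotientGroup.quotientKerEquivOfSurjective α hα).toEquiv, IsGalois.card_aut_eq_finrank, Module.finrank_eq_card_basis B]
  set y0 := Yv 1 with hy0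
  have hfm : ∀ z : Ω, eval₂ ((algebraMap F Ω).comp ev) z f0 = aeval z (f0.map ev) := by
    intro z; rw [aeval_def, eval₂_map]
  have hmon : (f0.map ev).Monic := hf.map ev
  have hint : IsIntegral F y0 := ⟨f0.map ev, hmon, by rw [← aeval_def, ← hfm]; exact hf0 1⟩
  set E := F⟮y0⟯ with hE
  have : FiniteDimensional F E := adjoin.finiteDimensional hint
  have hyE : y0 ∈ E := mem_adjoin_simple_self F y0
  have hfE : ∀ (d : k[X]) (P : k[X][X]) (z : Ω), d ≠ 0 → algebraMap F Ω (ev d) * z = eval₂ ((algebraMap F Ω).comp ev) y0 P → z ∈ E := by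
    intro d P z hd h
    have hd0 : algebraMap F Ω (ev d) ≠ 0 := by
      rw [Ne, map_eq_zero]; intro h0; exact hd (hev (by rw [h0, map_zero]))
    have : z = (algebraMap F Ω (ev d))⁻¹ * aeval y0 (P.map ev) := by
      rw [aeval_def, eval₂_map, ← h, inv_mul_cancel_left₀ hd0]
    rw [this]
    refine mul_mem (inv_mem (E.algebraMap_mem _)) ?_
    exact (Algebra.adjoin_le (by simpa using hyE) : Algebra.adjoin F {y0} ≤ E.toSubalgebra) (aeval_mem_adjoin_singleton F y0)
  have hYE : ∀ g, Yv g ∈ E := by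
    intro g
    obtain ⟨d, P, hd, h⟩ := hr1 g
    have := h 1
    rw [one_mul] at this
    exact hfE d P _ hd this
  have hkE : ∀ x : k, algebraMap k Ω x ∈ E := by
    intro x
    rw [IsScalarTower.algebraMap_apply k F Ω]
    exact E.algebraMap_mem _
  have hJ : ∀ l, J l ∈ E := by
    intro l
    rw [← B.sum_repr l, map_sum]
    refine sum_mem (fun i _ => ?_)
    rw [map_smul, Algebra.smul_def]
    refine mul_mem (hkE _) ?_
    obtain ⟨d, P, hd, h⟩ := hr2 i
    have := h 1
    rw [map_one] at this
    exact hfE d P _ hd this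
  have hle : Module.finrank F E ≤ n := by
    rw [adjoin.finrank hint]
    refine (natDegree_le_of_dvd (minpoly.dvd F y0 (p := f0.map ev) (by rw [← hfm]; exact hf0 1)) hmon.ne_zero).trans ?_
    rw [hf.natDegree_map, hfd]
  have hge : ∀ (ι' : Type) [Fintype ι'] (b : ι' → Ω), LinearIndependent k b → (∀ i, IsAlgebraic k (b i)) → (∀ i, b i ∈ E) →
      Fintype.card ι' * Nat.card α.ker ≤ n := by
    intro ι' _ b hb hba hbE
    have h1 := low_indep ev hfrac hev y0 _ b (low ι' b hb hba)
    have h2 : LinearIndependent F (fun i : ι' × Fin (Nat.card α.ker) => (⟨b i.1 * y0 ^ (i.2 : ℕ), mul_mem (hbE _) (pow_mem hyE _)⟩ : E)) :=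
      LinearIndependent.of_comp E.val.toLinearMap h1
    have h3 := h2.fintype_card_le_finrank
    rw [Fintype.card_prod, Fintype.card_fin] at h3
    exact h3.trans hle
  have hJl : LinearIndependent k (fun i => J (B i)) := B.linearIndependent.map' J.toLinearMap (LinearMap.ker_eq_bot.2 J.toRingHom.injective)
  have hJa : ∀ l, IsAlgebraic k (J l) := fun l => (Algebra.IsAlgebraic.isAlgebraic l).algHom J
  have hkerpos : 0 < Nat.card α.ker := Nat.card_pos
  have halg : ∀ x ∈ E, IsAlgebraic k x → ∃ l, J l = x := by
    intro x hx hxa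
    by_contra hcon
    have hli : LinearIndependent k (fun o : Option ι => o.elim x (fun i => J (B i))) := by
      rw [linearIndependent_option]
      refine ⟨hJl, ?_⟩
      intro hmem
      apply hcon
      have : Submodule.span k (Set.range ((fun o : Option ι => o.elim x (fun i => J (B i))) ∘ some)) ≤ LinearMap.range J.toLinearMap := by
        rw [Submodule.span_le]
        rintro _ ⟨i, rfl⟩
        exact ⟨B i, rfl⟩
      obtain ⟨l, hl⟩ := this hmem
      exact ⟨l, hl⟩
    have := hge (Option ι) _ hli (by rintro (_ | i); exacts [hxa, hJa _]) (by rintro (_ | i); exacts [hx, hJ _])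
    rw [hcard, Fintype.card_option] at this
    have := Nat.le_of_mul_le_mul_right this hkerpos
    omega
  have hfin : Module.finrank F E = n := by
    apply le_antisymm hle
    have h1 := low_indep ev hfrac hev y0 _ _ (low ι _ hJl (fun i => hJa _))
    have h2 : LinearIndependent F (fun i : ι × Fin (Nat.card α.ker) => (⟨J (B i.1) * y0 ^ (i.2 : ℕ), mul_mem (hJ _) (pow_mem hyE _)⟩ : E)) :=
      LinearIndependent.of_comp E.val.toLinearMap h1
    have h3 := h2.fintype_card_le_finrank
    rw [Fintype.card_prod, Fintype.card_fin] at h3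
    rw [hcard]; exact h3
  have hmin : minpoly F y0 = f0.map ev := by
    symm; apply Polynomial.eq_of_monic_of_dvd_of_natDegree_le (minpoly.monic hint) hmon (minpoly.dvd F y0 (by rw [← hfm]; exact hf0 1))
    rw [hf.natDegree_map, hfd, ← hfin, adjoin.finrank hint]
  -- automorphisms
  have hex : ∀ g, ∃ σ : E →ₐ[F] E, σ ⟨y0, hyE⟩ = ⟨Yv g, hYE g⟩ := by
    intro g
    let pb := adjoin.powerBasis hint
    have hgen : pb.gen = ⟨y0, hyE⟩ := adjoin.powerBasis_gen hint
    have hroot : aeval (⟨Yv g, hYE g⟩ : E) (minpoly F pb.gen) = 0 := by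
      rw [hgen]
      have h1 : minpoly F (⟨y0, hyE⟩ : E) = minpoly F y0 := minpoly_eq _
      rw [h1, hmin]
      apply Subtype.ext
      have : ((aeval (⟨Yv g, hYE g⟩ : E) (f0.map ev) : E) : Ω) = aeval (Yv g) (f0.map ev) := (aeval_algHom_apply E.val _ _).symm
      rw [this, ← hfm, hf0]; rfl
    exact ⟨pb.lift _ hroot, by rw [← hgen]; exact pb.lift_gen _ hroot⟩
  choose σ hσ using hex
  have hev2 : ∀ g (P : k[X][X]), ∀ z : E, (z : Ω) = eval₂ ((algebraMap F Ω).comp ev) y0 P → 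
      ((σ g z : E) : Ω) = eval₂ ((algebraMap F Ω).comp ev) (Yv g) P := by
    intro g P z hz
    have h1 : z = aeval (⟨y0, hyE⟩ : E) (P.map ev) := by
      apply Subtype.ext
      rw [hz]
      have : ((aeval (⟨y0, hyE⟩ : E) (P.map ev) : E) : Ω) = aeval y0 (P.map ev) := (aeval_algHom_apply E.val _ _).symm
      rw [this, aeval_def, eval₂_map]
    rw [h1, ← aeval_algHom_apply, hσ]
    have : ((aeval (⟨Yv g, hYE g⟩ : E) (P.map ev) : E) : Ω) = aeval (Yv g) (P.map ev) := (aeval_algHom_apply E.val _ _).symm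
    rw [this, aeval_def, eval₂_map]
  have hrel : ∀ g (d : k[X]) (P : k[X][X]) (z z' : Ω) (hz : z ∈ E), d ≠ 0 → algebraMap F Ω (ev d) * z = eval₂ ((algebraMap F Ω).comp ev) y0 P →
      algebraMap F Ω (ev d) * z' = eval₂ ((algebraMap F Ω).comp ev) (Yv g) P → ((σ g ⟨z, hz⟩ : E) : Ω) = z' := by
    intro g d P z z' hz hd h1 h2
    have hd0 : algebraMap F Ω (ev d) ≠ 0 := by
      rw [Ne, map_eq_zero]; intro h0; exact hd (hev (by rw [h0, map_zero]))
    have h3 := hev2 g P (algebraMap F E (ev d) * (⟨z, hz⟩ : E)) h1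
    rw [map_mul, AlgHom.commutes, ← h2] at h3
    exact mul_left_cancel₀ hd0 h3
  have hσY : ∀ g h, σ g ⟨Yv h, hYE h⟩ = ⟨Yv (g * h), hYE _⟩ := by
    intro g h
    obtain ⟨d, P, hd, hP⟩ := hr1 h
    apply Subtype.ext
    have h1 := hP 1
    rw [one_mul] at h1
    exact hrel g d P _ _ (hYE h) hd h1 (hP g)
  have hσJ : ∀ g i, ((σ g ⟨J (B i), hJ _⟩ : E) : Ω) = J (α g (B i)) := by
    intro g i
    obtain ⟨d, P, hd, hP⟩ := hr2 i
    have h1 := hP 1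
    rw [map_one] at h1
    exact hrel g d P _ _ (hJ _) hd h1 (hP g)
  have hext : ∀ s t : E →ₐ[F] E, s ⟨y0, hyE⟩ = t ⟨y0, hyE⟩ → s = t := by
    intro s t hst
    apply (adjoin.powerBasis hint).algHom_ext
    have hgen : (adjoin.powerBasis hint).gen = ⟨y0, hyE⟩ := adjoin.powerBasis_gen hint
    rw [hgen]; exact hst
  let Sg : G →* (E →ₐ[F] E) :=
    { toFun := σ
      map_one' := hext _ _ (by rw [hσ]; rfl)
      map_mul' := fun g h => hext _ _ (by rw [hσ, AlgHom.mul_apply, hσ, hσY]) }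
  let e0 : G →* (E ≃ₐ[F] E) := (AlgEquiv.algHomUnitsEquiv F E).toMonoidHom.comp Sg.toHomUnits
  have he0 : ∀ g z, e0 g z = σ g z := fun g z => rfl
  have hinj : Function.Injective e0 := by
    intro g h hgh
    apply hY
    have : e0 g ⟨y0, hyE⟩ = e0 h ⟨y0, hyE⟩ := by rw [hgh]
    rw [he0, he0, hσ, hσ] at this
    exact congrArg Subtype.val this
  have hcardA : Nat.card (E ≃ₐ[F] E) = n := by
    apply le_antisymm
    · have := AlgEquiv.card_le (F := F) (K := E)
      rw [← hfin, Nat.card_eq_fintype_card]; exact this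
    · exact Nat.card_le_card_of_injective e0 hinj
  have hbij : Function.Bijective e0 := (Nat.bijective_iff_injective_and_card _).2 ⟨hinj, hcardA.symm⟩
  refine ⟨E, hJ, inferInstance, IsGalois.of_card_aut_eq_finrank F E (by rw [hcardA, hfin]), halg, MulEquiv.ofBijective e0 hbij, ?_⟩
  intro g l
  have key : ∀ l, ((σ g ⟨J l, hJ l⟩ : E) : Ω) = J (α g l) := by
    intro l
    have hz : ∀ l, (⟨J l, hJ l⟩ : E) = ∑ i, (algebraMap F E (algebraMap k F (B.repr l i))) * ⟨J (B i), hJ _⟩ := by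
      intro l
      apply Subtype.ext
      change J l = ((∑ i, (algebraMap F E (algebraMap k F (B.repr l i))) * ⟨J (B i), hJ _⟩ : E) : Ω)
      rw [AddSubmonoidClass.coe_finset_sum]
      conv_lhs => rw [← B.sum_repr l, map_sum]
      apply Finset.sum_congr rfl
      intro i _
      rw [map_smul, Algebra.smul_def, IsScalarTower.algebraMap_apply k F Ω]; rfl
    rw [hz l, map_sum, AddSubmonoidClass.coe_finset_sum]
    conv_rhs => rw [← B.sum_repr l, map_sum, map_sum]
    apply Finset.sum_congr rfl
    intro i _
    rw [map_mul, AlgHom.commutes, map_smul, map_smul, Algebra.smul_def, IsScalarTower.algebraMap_apply k F Ω, ← hσJ]; rfl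
  exact key l

end C1

section C2
open Polynomial IntermediateField

theorem int_inv {K E : Type} [Field K] [Field E] (i0 : K[X] →+* E) (hi : Function.Injective i0) (z : E)
    (hz : ∃ A B, B ≠ 0 ∧ i0 B * z = i0 A) (hint : i0.IsIntegralElem z) : ∃ A, i0 A = z := by
  obtain ⟨A, B, hB, hAB⟩ := hz
  let a : Algebra K[X] E := i0.toAlgebra
  have : FaithfulSMul K[X] E := (faithfulSMul_iff_algebraMap_injective _ _).2 hi
  let φ : FractionRing K[X] →ₐ[K[X]] E := IsFractionRing.liftAlgHom (g := Algebra.ofId K[X] E) hi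
  have hφ : φ (algebraMap _ _ A / algebraMap _ _ B) = z := by
    rw [map_div₀, AlgHom.commutes, AlgHom.commutes]
    have : algebraMap K[X] E B ≠ 0 := by
      change i0 B ≠ 0; rw [Ne, map_eq_zero_iff _ hi]; exact hB
    rw [div_eq_iff this, mul_comm]; exact hAB.symm
  have h1 : IsIntegral K[X] (algebraMap K[X] (FractionRing K[X]) A / algebraMap _ _ B) := by
    rw [← isIntegral_algHom_iff φ φ.toRingHom.injective, hφ]; exact hint
  obtain ⟨C, hC⟩ := IsIntegrallyClosed.isIntegral_iff.1 h1
  refine ⟨C, ?_⟩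
  rw [← hφ, ← hC, AlgHom.commutes]; rfl

theorem alg_data {K E G : Type} [Field K] [Field E] [Group G] [Fintype G] [DecidableEq G] [MulSemiringAction G E] [FaithfulSMul G E]
    (i0 : K[X] →+* E) (hi : Function.Injective i0) (hfix : ∀ (g : G) B, g • i0 B = i0 B)
    (hfr : ∀ z : E, (∀ g : G, g • z = z) → ∃ A B, B ≠ 0 ∧ i0 B * z = i0 A) :
    ∃ (y : E) (f : K[X][X]) (δ : K[X]), f.Monic ∧ f.natDegree = Nat.card G ∧ f.map i0 = ∏ g : G, (X - C (g • y)) ∧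
      δ ≠ 0 ∧ i0 δ = ∏ p ∈ (Finset.univ : Finset G).offDiag, (p.1 • y - p.2 • y) ∧
      ∀ z, ∃ d P, d ≠ 0 ∧ i0 d * z = eval₂ i0 y P := by
  let F := FixedPoints.subfield G E
  have hfr' : ∀ z : F, ∃ A B, B ≠ 0 ∧ i0 B * (z : E) = i0 A := fun z => hfr z.1 z.2
  let a : Algebra K[X] E := i0.toAlgebra
  have hne : ∀ B, B ≠ 0 → i0 B ≠ 0 := fun B hB h => hB ((map_eq_zero_iff _ hi).1 h)
  obtain ⟨y1, hy1⟩ := Field.exists_primitive_element F E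
  -- every z algebraic
  have halg : IsAlgebraic K[X] y1 := by
    have h1 : IsIntegral F y1 := IsIntegral.of_finite F y1
    obtain ⟨p, hp, hp0⟩ := h1
    choose A B hB hAB using hfr'
    -- clear denominators
    let D : K[X] := ∏ i ∈ Finset.range (p.natDegree + 1), B (p.coeff i)
    have hD : D ≠ 0 := Finset.prod_ne_zero_iff.2 (fun i _ => hB _)
    have h2 : ∀ i ∈ Finset.range (p.natDegree + 1), ∃ q, i0 q = i0 D * (p.coeff i : E) := by
      intro i hi
      refine ⟨A (p.coeff i) * ∏ j ∈ (Finset.range (p.natDegree + 1)).erase i, B (p.coeff j), ?_⟩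
      rw [map_mul, ← hAB]
      change _ = i0 (∏ i ∈ Finset.range (p.natDegree + 1), B (p.coeff i)) * _
      rw [← Finset.mul_prod_erase _ _ hi, map_mul]; ring
    choose! q hq using h2
    refine ⟨∑ i ∈ Finset.range (p.natDegree + 1), C (q i) * X ^ i, ?_, ?_⟩
    · intro h0
      have h3 := congrArg (fun r => coeff r p.natDegree) h0
      simp only [finset_sum_coeff, coeff_C_mul, coeff_X_pow, coeff_zero] at h3
      rw [Finset.sum_eq_single p.natDegree] at h3
      · simp only [if_true, mul_one] at h3
        have h4 := hq p.natDegree (by simp)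
        rw [h3, map_zero, coeff_natDegree, hp.leadingCoeff] at h4
        apply hne D hD
        simpa using h4.symm
      · intro b _ hb; rw [if_neg hb.symm, mul_zero]
      · intro h; exact absurd (by simp) h
    · rw [map_sum]
      have : i0 D * aeval y1 p = 0 := by rw [aeval_def, hp0, mul_zero]
      rw [← this, aeval_eq_sum_range, Finset.mul_sum]
      apply Finset.sum_congr rfl
      intro i hi
      rw [map_mul, aeval_C, map_pow, aeval_X]
      change i0 (q i) * _ = _
      rw [hq i hi, Algebra.smul_def, mul_assoc]; rfl
  obtain ⟨r, hr0, hr⟩ := halg.exists_integral_multiple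
  set y : E := i0 r * y1 with hy
  have hyint : i0.IsIntegralElem y := by
    rw [Algebra.smul_def] at hr; exact hr
  have hprim : F⟮y⟯ = ⊤ := by
    rw [eq_top_iff, ← hy1, adjoin_simple_le_iff]
    have hrF : i0 r ∈ F⟮y⟯ := F⟮y⟯.algebraMap_mem ⟨i0 r, fun g => hfix g r⟩
    have := mul_mem (inv_mem hrF) (mem_adjoin_simple_self F y)
    rwa [hy, inv_mul_cancel_left₀ (hne r hr0)] at this
  have hadj : ∀ z : E, z ∈ Algebra.adjoin F {y} := by
    intro z
    have h1 : (F⟮y⟯).toSubalgebra = Algebra.adjoin F {y} := adjoin_simple_toSubalgebra_of_isAlgebraic (IsIntegral.of_finite F y).isAlgebraic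
    rw [← h1, hprim]; trivial
  have hinj : ∀ g h : G, g • y = h • y → g = h := by
    intro g h hgh
    apply FaithfulSMul.eq_of_smul_eq_smul (α := E)
    intro z
    induction hadj z using Algebra.adjoin_induction with
    | mem x hx => rw [Set.mem_singleton_iff.1 hx]; exact hgh
    | algebraMap x => exact (x.2 g).trans (x.2 h).symm
    | add a b _ _ ha hb => rw [smul_add, smul_add, ha, hb]
    | mul a b _ _ ha hb => rw [smul_mul', smul_mul', ha, hb]
  have hgint : ∀ g : G, i0.IsIntegralElem (g • y) := by
    intro g
    obtain ⟨p, hp, hp0⟩ := hyint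
    refine ⟨p, hp, ?_⟩
    have h1 := congrArg (fun z => (MulSemiringAction.toRingHom G E g) z) hp0
    simp only [map_zero] at h1
    rw [hom_eval₂] at h1
    have h2 : (MulSemiringAction.toRingHom G E g).comp i0 = i0 := RingHom.ext (fun B => hfix g B)
    rw [h2] at h1
    exact h1
  -- f
  set fE : E[X] := ∏ g : G, (X - C (g • y)) with hfE
  have hfEmon : fE.Monic := monic_prod_of_monic _ _ (fun g _ => monic_X_sub_C _)
  have hfEinv : ∀ (h : G) i, h • fE.coeff i = fE.coeff i := by
    intro h i
    have : fE.map (MulSemiringAction.toRingHom G E h) = fE := by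
      rw [hfE, Polynomial.map_prod]
      simp only [Polynomial.map_sub, map_X, map_C]
      refine Fintype.prod_equiv (Equiv.mulLeft h) _ _ (fun g => ?_)
      simp [mul_smul]
    conv_rhs => rw [← this, coeff_map]
    rfl
  have hfEint : ∀ i, i0.IsIntegralElem (fE.coeff i) := by
    intro i
    have h1 : fE ∈ Polynomial.lifts (integralClosure K[X] E).val.toRingHom := by
      rw [hfE]
      apply Subsemiring.prod_mem
      intro g _
      refine ⟨X - C (⟨g • y, hgint g⟩ : integralClosure K[X] E), ?_⟩
      simp
    rw [lifts_iff_coeff_lifts] at h1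
    obtain ⟨c, hc⟩ := h1 i
    rw [← hc]
    exact c.2
  have hfl : fE ∈ lifts i0 := by
    rw [lifts_iff_coeff_lifts]
    intro i
    exact int_inv i0 hi _ (hfr _ (fun g => hfEinv g i)) (hfEint i)
  obtain ⟨f, hf, hfd, hfm⟩ := lifts_and_natDegree_eq_and_monic hfl hfEmon
  -- delta
  set dE : E := ∏ p ∈ (Finset.univ : Finset G).offDiag, (p.1 • y - p.2 • y) with hdE
  have hdE0 : dE ≠ 0 := by
    rw [hdE, Finset.prod_ne_zero_iff]
    rintro ⟨g, h⟩ hp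
    rw [Finset.mem_offDiag] at hp
    rw [sub_ne_zero]
    exact fun h => hp.2.2 (hinj _ _ h)
  have hdinv : ∀ h : G, h • dE = dE := by
    intro h
    rw [hdE, Finset.smul_prod']
    refine Finset.prod_equiv (Equiv.prodCongr (Equiv.mulLeft h) (Equiv.mulLeft h)) ?_ ?_
    · rintro ⟨a, b⟩; simp
    · rintro ⟨a, b⟩ _; simp [smul_sub, mul_smul]
  have hdint : i0.IsIntegralElem dE := by
    have : dE ∈ integralClosure K[X] E := by
      rw [hdE]
      exact prod_mem (fun p _ => sub_mem (hgint p.1) (hgint p.2))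
    exact this
  obtain ⟨δ, hδ⟩ := int_inv i0 hi dE (hfr _ hdinv) hdint
  refine ⟨y, f, δ, hfm, ?_, hf, ?_, hδ, ?_⟩
  · rw [hfd, hfE, natDegree_prod_of_monic _ _ (fun g _ => monic_X_sub_C _)]
    simp
  · rintro rfl
    rw [map_zero] at hδ
    exact hdE0 hδ.symm
  · intro z
    induction hadj z using Algebra.adjoin_induction with
    | mem x hx => exact ⟨1, X, one_ne_zero, by rw [Set.mem_singleton_iff.1 hx]; simp⟩
    | algebraMap x => 
      obtain ⟨A, B, hB, h⟩ := hfr' x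
      exact ⟨B, C A, hB, by rw [eval₂_C]; exact h⟩
    | add a b _ _ ha hb =>
      obtain ⟨d, P, hd, h⟩ := ha
      obtain ⟨d', P', hd', h'⟩ := hb
      refine ⟨d * d', C d' * P + C d * P', mul_ne_zero hd hd', ?_⟩
      rw [eval₂_add, eval₂_mul, eval₂_mul, ← h, ← h', eval₂_C, eval₂_C, map_mul]; ring
    | mul a b _ _ ha hb =>
      obtain ⟨d, P, hd, h⟩ := ha
      obtain ⟨d', P', hd', h'⟩ := hb
      refine ⟨d * d', P * P', mul_ne_zero hd hd', ?_⟩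
      rw [eval₂_mul, ← h, ← h', map_mul]; ring

end C2

section C3
open Polynomial

theorem insep_of_fixed {E Ω : Type} [Field E] [Field Ω] [Algebra E Ω] [IsAlgClosed Ω] [Algebra.IsAlgebraic E Ω] (u : Ω)
    (hu : ∀ τ : Ω ≃ₐ[E] Ω, τ u = u) : ∃ n : ℕ, ∃ e : E, algebraMap E Ω e = u ^ (ringExpChar E) ^ n := by
  classical
  have : Normal E Ω := normal_iff.2 (fun x => ⟨Algebra.IsIntegral.isIntegral x, IsAlgClosed.splits _⟩)
  have h : u ∈ perfectClosure E Ω := by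
    rw [mem_perfectClosure_iff_natSepDegree_eq_one, natSepDegree_eq_of_isAlgClosed Ω]
    have hint : IsIntegral E u := Algebra.IsIntegral.isIntegral u
    have : ((minpoly E u).aroots Ω).toFinset = {u} := by
      ext v
      rw [Multiset.mem_toFinset, mem_aroots, Finset.mem_singleton]
      constructor
      · rintro ⟨_, hv⟩
        obtain ⟨τ, hτ⟩ := minpoly.exists_algEquiv_of_root' hint.isAlgebraic hv
        rw [← hτ, hu]
      · rintro rfl
        exact ⟨minpoly.ne_zero hint, minpoly.aeval _ _⟩
    rw [this, Finset.card_singleton]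
  obtain ⟨n, e, he⟩ := mem_perfectClosure_iff.1 h
  exact ⟨n, e, he⟩

theorem alg_coef_zero {K Ω : Type} [Field K] [Field Ω] [Algebra K Ω] (x : Ω) (hx : Transcendental K x)
    (p : Polynomial Ω) (hp : ∀ i, IsAlgebraic K (p.coeff i)) (h0 : p.eval x = 0) : p = 0 := by
  have h1 : p ∈ lifts (algebraMap (algebraicClosure K Ω) Ω) := by
    rw [lifts_iff_coeff_lifts]
    intro i
    exact ⟨⟨p.coeff i, mem_algebraicClosure_iff.2 (hp i)⟩, rfl⟩
  obtain ⟨q, rfl⟩ := h1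
  have h2 := hx.algebraicClosure
  have h3 : aeval x q = 0 := by
    rw [aeval_def, ← eval_map]; exact h0
  have h4 : q = 0 := by
    by_contra hq
    exact h2 ⟨q, hq, h3⟩
  rw [h4]; exact Polynomial.map_zero _

theorem const_fixed {K E Ω S G : Type} [Field K] [Field E] [Field S] [Group G] [MulSemiringAction G E] 
    [Field Ω] [Algebra E Ω] [IsAlgClosed Ω] [Algebra.IsAlgebraic E Ω] [Algebra K S] [Algebra.IsAlgebraic K S]
    (i0 : K[X] →+* E) (hi : Function.Injective i0) (hfix : ∀ (g : G) B, g • i0 B = i0 B)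
    (N : Subgroup G) (hALG : ∀ z : E, (∃ p : K[X], p ≠ 0 ∧ p.eval₂ (i0.comp C) z = 0) → ∀ n ∈ N, n • z = z)
    (ψ : S →+* Ω) (hψ : ∀ a, ψ (algebraMap K S a) = algebraMap E Ω (i0 (C a)))
    (c : S[X]) (e : E) (hec : algebraMap E Ω e = c.eval₂ ψ (algebraMap E Ω (i0 X))) : ∀ n ∈ N, n • e = e := by
  classical
  intro n hn
  let aK : Algebra K Ω := ((algebraMap E Ω).comp (i0.comp C)).toAlgebra
  set x : Ω := algebraMap E Ω (i0 X) with hxdef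
  have hx : Transcendental K x := by
    rintro ⟨p, hp, h0⟩
    apply hp
    apply hi
    apply (algebraMap E Ω).injective
    rw [map_zero, map_zero, ← h0, aeval_def]
    change _ = eval₂ ((algebraMap E Ω).comp (i0.comp C)) x p
    rw [hxdef, ← hom_eval₂, ← hom_eval₂, eval₂_C_X]
  have hSalg : ∀ s : S, IsAlgebraic K (ψ s) := by
    intro s
    let ψ' : S →ₐ[K] Ω := { ψ with commutes' := hψ }
    exact (Algebra.IsAlgebraic.isAlgebraic s).algHom ψ'
  have hτ : ∀ (i : ℕ) (τ : Ω ≃ₐ[E] Ω), τ (ψ (c.coeff i)) = ψ (c.coeff i) := by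
    intro i τ
    have h1 : c.map ((τ : Ω →+* Ω).comp ψ) - c.map ψ = 0 := by
      apply alg_coef_zero x hx
      · intro j
        rw [coeff_sub, coeff_map, coeff_map]
        apply IsAlgebraic.sub _ (hSalg _)
        let τ' : Ω →ₐ[K] Ω := { (τ : Ω →+* Ω) with commutes' := fun a => τ.commutes _ }
        exact (hSalg _).algHom τ'
      · rw [eval_sub, eval_map, eval_map, ← hec]
        have h2 : τ (algebraMap E Ω e) = algebraMap E Ω e := τ.commutes _
        have h3 : (τ : Ω →+* Ω) (eval₂ ψ x c) = eval₂ ((τ : Ω →+* Ω).comp ψ) ((τ : Ω →+* Ω) x) c := hom_eval₂ _ _ _ _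
        have h4 : (τ : Ω →+* Ω) x = x := τ.commutes _
        rw [h4] at h3
        rw [← h3, ← hec]
        change τ _ - _ = 0
        rw [h2, sub_self]
    have h5 := congrArg (fun r => coeff r i) h1
    simp only [coeff_sub, coeff_map, coeff_zero] at h5
    exact sub_eq_zero.1 h5
  choose m em hem using fun i => insep_of_fixed (ψ (c.coeff i)) (hτ i)
  set q := ringExpChar E with hq
  have hqc : ExpChar E q := ringExpChar.expChar E
  have hqo : ExpChar Ω q := expChar_of_injective_ringHom (algebraMap E Ω).injective q
  let Mx := ∑ i ∈ c.support, m i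
  have hM : ∀ i ∈ c.support, ∃ e' : E, algebraMap E Ω e' = ψ (c.coeff i) ^ q ^ Mx := by
    intro i hi
    have : m i ≤ Mx := Finset.single_le_sum (fun _ _ => Nat.zero_le _) hi
    obtain ⟨r, hr⟩ := Nat.exists_eq_add_of_le this
    refine ⟨em i ^ q ^ r, ?_⟩
    rw [map_pow, hem, ← pow_mul, ← pow_add, hr]
  choose! e' he' using hM
  have hfe : ∀ i ∈ c.support, n • e' i = e' i := by
    intro i hi
    apply hALG _ _ n hn
    obtain ⟨p, hp, hp0⟩ := (hSalg (c.coeff i ^ q ^ Mx))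
    refine ⟨p, hp, ?_⟩
    apply (algebraMap E Ω).injective
    rw [hom_eval₂, he' i hi, map_zero, ← map_pow]
    exact hp0
  have hsum : e ^ q ^ Mx = ∑ i ∈ c.support, e' i * (i0 (X ^ i)) ^ q ^ Mx := by
    apply (algebraMap E Ω).injective
    rw [map_pow, hec, eval₂_eq_sum, Polynomial.sum, map_sum, ← iterateFrobenius_def, map_sum]
    apply Finset.sum_congr rfl
    intro i hi
    rw [map_mul, map_mul, he' i hi, iterateFrobenius_def, iterateFrobenius_def, map_pow (algebraMap E Ω), map_pow i0, map_pow (algebraMap E Ω)]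
  have hnsum : n • (e ^ q ^ Mx) = e ^ q ^ Mx := by
    rw [hsum, Finset.smul_sum]
    apply Finset.sum_congr rfl
    intro i hi
    rw [smul_mul', hfe i hi, smul_pow', hfix]
  rw [smul_pow'] at hnsum
  exact iterateFrobenius_inj E q Mx hnsum

theorem geom_factor {K E G : Type} [Field K] [Field E] [Group G] [Fintype G] [MulSemiringAction G E] 
    (i0 : K[X] →+* E) (hi : Function.Injective i0) (hfix : ∀ (g : G) B, g • i0 B = i0 B)
    (N : Subgroup G) (hALG : ∀ z : E, (∃ p : K[X], p ≠ 0 ∧ p.eval₂ (i0.comp C) z = 0) → ∀ n ∈ N, n • z = z)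
    (y : E) (f : K[X][X]) (hf : f.map i0 = ∏ g : G, (X - C (g • y))) (hinj : ∀ g h : G, g • y = h • y → g = h)
    (S : Type) [Field S] [Algebra K S] [Algebra.IsAlgebraic K S] (h1 h2 : S[X][X]) (m1 : h1.Monic)
    (hh : h1 * h2 = f.map (mapRingHom (algebraMap K S))) (hpos : 0 < h1.natDegree) : Nat.card N ≤ h1.natDegree := by
  classical
  let Ω := AlgebraicClosure E
  let aK : Algebra K Ω := ((algebraMap E Ω).comp (i0.comp C)).toAlgebra
  let ψ : S →ₐ[K] Ω := IsAlgClosed.lift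
  have hψ : ∀ a, ψ.toRingHom (algebraMap K S a) = algebraMap E Ω (i0 (C a)) := fun a => ψ.commutes a
  let θ : S[X] →+* Ω := eval₂RingHom ψ.toRingHom (algebraMap E Ω (i0 X))
  have hθ : θ.comp (mapRingHom (algebraMap K S)) = (algebraMap E Ω).comp i0 := by
    apply Polynomial.ringHom_ext
    · intro a
      simp only [RingHom.comp_apply, coe_mapRingHom, map_C]
      rw [← hψ]
      exact eval₂_C _ _
    · simp only [RingHom.comp_apply, coe_mapRingHom, map_X]
      exact eval₂_X _ _
  have hprod : h1.map θ * h2.map θ = ∏ g : G, (X - C (algebraMap E Ω (g • y))) := by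
    rw [← Polynomial.map_mul, hh, Polynomial.map_map, hθ, ← Polynomial.map_map, hf, Polynomial.map_prod]
    simp
  have hH : (h1.map θ).Monic := m1.map θ
  have hd : (h1.map θ).natDegree = h1.natDegree := m1.natDegree_map θ
  let Sg : Finset G := Finset.univ.filter (fun g => (h1.map θ).IsRoot (algebraMap E Ω (g • y)))
  have hP0 : (∏ g : G, (X - C (algebraMap E Ω (g • y)))) ≠ 0 := (monic_prod_of_monic _ _ (fun g _ => monic_X_sub_C _)).ne_zero
  have hyinj : Function.Injective (fun g : G => algebraMap E Ω (g • y)) := fun g h hgh => hinj _ _ ((algebraMap E Ω).injective hgh)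
  have hroots : (∏ g : G, (X - C (algebraMap E Ω (g • y)))).roots = Finset.univ.val.map (fun g : G => algebraMap E Ω (g • y)) := by
    rw [roots_prod _ _ hP0]
    simp [Multiset.bind_singleton]
  have hle : (h1.map θ).roots ≤ Finset.univ.val.map (fun g : G => algebraMap E Ω (g • y)) := by
    rw [← hroots]
    exact roots.le_of_dvd hP0 (Dvd.intro _ hprod)
  have hnd : (h1.map θ).roots.Nodup := Multiset.nodup_of_le hle (Finset.univ.nodup.map hyinj)
  have hrS : (h1.map θ).roots = Sg.val.map (fun g : G => algebraMap E Ω (g • y)) := by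
    rw [Multiset.Nodup.ext hnd (Sg.nodup.map hyinj)]
    intro a
    rw [Multiset.mem_map]
    constructor
    · intro ha
      obtain ⟨g, _, rfl⟩ := Multiset.mem_map.1 (Multiset.mem_of_le hle ha)
      exact ⟨g, Finset.mem_filter.2 ⟨Finset.mem_univ _, isRoot_of_mem_roots ha⟩, rfl⟩
    · rintro ⟨g, hg, rfl⟩
      exact (mem_roots hH.ne_zero).2 (Finset.mem_filter.1 hg).2
  let HE : E[X] := ∏ g ∈ Sg, (X - C (g • y))
  have hHE : HE.map (algebraMap E Ω) = h1.map θ := by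
    rw [(IsAlgClosed.splits (h1.map θ)).eq_prod_roots_of_monic hH, hrS, Multiset.map_map, Polynomial.map_prod]
    simp only [Polynomial.map_sub, map_X, map_C]; rfl
  have hcard : Sg.card = h1.natDegree := by
    rw [← hd, (IsAlgClosed.splits (h1.map θ)).natDegree_eq_card_roots, hrS, Multiset.card_map]; rfl
  have hcoef : ∀ n ∈ N, HE.map (MulSemiringAction.toRingHom G E n) = HE := by
    intro n hn
    ext i
    rw [coeff_map]
    refine const_fixed (Ω := Ω) i0 hi hfix N hALG ψ.toRingHom hψ (h1.coeff i) (HE.coeff i) ?_ n hn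
    rw [← coeff_map, hHE, coeff_map]; rfl
  have hstab : ∀ n ∈ N, ∀ g ∈ Sg, n * g ∈ Sg := by
    intro n hn g hg
    have h3 : HE.eval (g • y) = 0 := by
      change eval _ (∏ g ∈ Sg, (X - C (g • y))) = 0
      rw [eval_prod]
      exact Finset.prod_eq_zero hg (by simp)
    have h4 : HE.eval (n • g • y) = 0 := by
      have := congrArg (MulSemiringAction.toRingHom G E n) h3
      rw [map_zero, ← eval_map_apply, hcoef n hn] at this
      exact this
    change eval _ (∏ g ∈ Sg, (X - C (g • y))) = 0 at h4
    rw [eval_prod, Finset.prod_eq_zero_iff] at h4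
    obtain ⟨g', hg', h5⟩ := h4
    rw [eval_sub, eval_X, eval_C, sub_eq_zero, ← mul_smul] at h5
    rw [hinj _ _ h5]; exact hg'
  have hne : Sg.Nonempty := by
    rw [← Finset.card_pos, hcard]; exact hpos
  obtain ⟨g0, hg0⟩ := hne
  rw [← hcard, Nat.card_eq_fintype_card, ← Fintype.card_coe]
  exact Fintype.card_le_of_injective (fun n : N => (⟨n.1 * g0, hstab n.1 n.2 g0 hg0⟩ : Sg)) (fun a b hab => Subtype.ext (mul_right_cancel (congrArg Subtype.val hab)))

end C3

section C4
open Polynomial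

noncomputable def HU {R : Type} [CommRing R] (d D : ℕ) (v : Fin d × Fin (D + 1) → R) : R[X][X] :=
  X ^ d + ∑ p, C (C (v p) * X ^ (p.2 : ℕ)) * X ^ (p.1 : ℕ)

theorem HU_map {R R' : Type} [CommRing R] [CommRing R'] (d D : ℕ) (v : Fin d × Fin (D + 1) → R) (ρ : R →+* R') :
    (HU d D v).map (mapRingHom ρ) = HU d D (fun p => ρ (v p)) := by
  simp [HU, Polynomial.map_sum]

theorem HU_deg {R : Type} [CommRing R] [Nontrivial R] (d D : ℕ) (v : Fin d × Fin (D + 1) → R) : 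
    (∑ p, C (C (v p) * X ^ (p.2 : ℕ)) * X ^ (p.1 : ℕ) : R[X][X]).degree < d := by
  apply lt_of_le_of_lt (degree_sum_le _ _)
  refine (Finset.sup_lt_iff (WithBot.bot_lt_coe d)).2 ?_
  intro p _
  exact lt_of_le_of_lt (degree_C_mul_X_pow_le _ _) (WithBot.coe_lt_coe.2 (Nat.cast_lt.2 p.1.2))

theorem HU_monic {R : Type} [CommRing R] [Nontrivial R] (d D : ℕ) (v : Fin d × Fin (D + 1) → R) : (HU d D v).Monic :=
  monic_X_pow_add (HU_deg d D v)

theorem HU_natDegree {R : Type} [CommRing R] [Nontrivial R] (d D : ℕ) (v : Fin d × Fin (D + 1) → R) : (HU d D v).natDegree = d := by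
  rw [HU, natDegree_add_eq_left_of_degree_lt, natDegree_X_pow]
  rw [degree_X_pow]; exact HU_deg d D v

theorem HU_surj {R : Type} [CommRing R] [Nontrivial R] (D : ℕ) (h : R[X][X]) (hm : h.Monic) (hD : ∀ i, (h.coeff i).natDegree ≤ D) :
    HU h.natDegree D (fun p => (h.coeff p.1).coeff p.2) = h := by
  conv_rhs => rw [hm.as_sum]
  rw [HU, Fintype.sum_prod_type, Finset.sum_range]
  congr 1
  apply Finset.sum_congr rfl
  intro i _
  conv_rhs => rw [as_sum_range_C_mul_X_pow' (h.coeff i) (Nat.lt_succ_of_le (hD i)), map_sum, Finset.sum_mul, Finset.sum_range]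

theorem swap_coeff {R : Type} [CommRing R] (p : R[X][X]) (i j : ℕ) : ((Bivariate.swap p).coeff i).coeff j = (p.coeff j).coeff i := by
  induction p using Polynomial.induction_on' with
  | add p q hp hq => rw [map_add, coeff_add, coeff_add, hp, hq, coeff_add, coeff_add]
  | monomial n a =>
    induction a using Polynomial.induction_on' with
    | add p q hp hq => 
      rw [map_add, map_add, coeff_add, coeff_add, hp, hq, coeff_add, coeff_add]
    | monomial m r =>
      rw [Bivariate.swap_monomial_monomial]
      simp only [coeff_monomial]
      by_cases h1 : m = i <;> by_cases h2 : n = j <;> simp [h1, h2, coeff_monomial]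

theorem swap_deg {R : Type} [CommRing R] (p : R[X][X]) (D : ℕ) : (Bivariate.swap p).natDegree ≤ D ↔ ∀ i, (p.coeff i).natDegree ≤ D := by
  simp only [natDegree_le_iff_coeff_eq_zero]
  constructor
  · intro h i N hN
    rw [← swap_coeff, h N hN, coeff_zero]
  · intro h N hN
    ext j
    rw [swap_coeff, h j N hN, coeff_zero]

theorem xdeg_factor {κ : Type} [Field κ] (h1 h2 : κ[X][X]) (n1 : h1 ≠ 0) (n2 : h2 ≠ 0) (D : ℕ) (hD : ∀ i, ((h1 * h2).coeff i).natDegree ≤ D) :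
    (∀ i, (h1.coeff i).natDegree ≤ D) ∧ (∀ i, (h2.coeff i).natDegree ≤ D) := by
  rw [← swap_deg, map_mul, natDegree_mul (by simpa using n1) (by simpa using n2)] at hD
  rw [← swap_deg, ← swap_deg]
  omega

noncomputable def ZU {R : Type} [CommRing R] (d1 d2 D : ℕ) (v : (Fin d1 × Fin (D + 1)) ⊕ (Fin d2 × Fin (D + 1)) → R) : R[X][X] :=
  HU d1 D (fun p => v (Sum.inl p)) * HU d2 D (fun p => v (Sum.inr p))

theorem ZU_map {R R' : Type} [CommRing R] [CommRing R'] (d1 d2 D : ℕ) (v : (Fin d1 × Fin (D + 1)) ⊕ (Fin d2 × Fin (D + 1)) → R) (ρ : R →+* R') :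
    (ZU d1 d2 D v).map (mapRingHom ρ) = ZU d1 d2 D (fun i => ρ (v i)) := by
  rw [ZU, ZU, Polynomial.map_mul, HU_map, HU_map]

noncomputable def eU {A : Type} [CommRing A] (d1 d2 D : ℕ) (f : A[X][X]) (t : ℕ × ℕ) : MvPolynomial ((Fin d1 × Fin (D + 1)) ⊕ (Fin d2 × Fin (D + 1))) A :=
  ((ZU d1 d2 D MvPolynomial.X - f.map (mapRingHom MvPolynomial.C)).coeff t.1).coeff t.2

theorem eU_map {A R : Type} [CommRing A] [CommRing R] (d1 d2 D : ℕ) (f : A[X][X]) (t : ℕ × ℕ)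
    (ρ : MvPolynomial ((Fin d1 × Fin (D + 1)) ⊕ (Fin d2 × Fin (D + 1))) A →+* R) :
    ρ (eU d1 d2 D f t) = ((ZU d1 d2 D (fun i => ρ (MvPolynomial.X i)) - f.map (mapRingHom (ρ.comp MvPolynomial.C))).coeff t.1).coeff t.2 := by
  rw [eU, ← mapRingHom_comp, ← Polynomial.map_map, ← ZU_map, ← Polynomial.map_sub, coeff_map, coe_mapRingHom, coeff_map]

theorem eU_map' {A K : Type} [CommRing A] [CommRing K] (d1 d2 D : ℕ) (f : A[X][X]) (t : ℕ × ℕ)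
    (iA : A →+* K) :
    MvPolynomial.map iA (eU d1 d2 D f t) = eU d1 d2 D (f.map (mapRingHom iA)) t := by
  rw [eU_map, eU, Polynomial.map_map, mapRingHom_comp]
  have : (MvPolynomial.map iA).comp MvPolynomial.C = (MvPolynomial.C : K →+* MvPolynomial ((Fin d1 × Fin (D + 1)) ⊕ (Fin d2 × Fin (D + 1))) K).comp iA := RingHom.ext (fun a => MvPolynomial.map_C _ _)
  rw [this]
  simp only [MvPolynomial.map_X]

theorem cert1 {K : Type} [Field K] (f : K[X][X]) (D d1 d2 : ℕ)
    (hno : ∀ (S : Type) [Field S] [Algebra K S] [Algebra.IsAlgebraic K S] (h1 h2 : S[X][X]), h1.Monic →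
      h1 * h2 = f.map (mapRingHom (algebraMap K S)) → h1.natDegree = d1 → False) :
    ∃ s : Finset K, ∀ (A : Type) [CommRing A] (iA : A →+* K) (_ : Function.Injective iA) (_ : ∀ x ∈ s, ∃ a, iA a = x)
      (fA : A[X][X]) (_ : fA.map (mapRingHom iA) = f) (κ : Type) [Field κ] (ψ : A →+* κ) 
      (v1 : Fin d1 × Fin (D + 1) → κ) (v2 : Fin d2 × Fin (D + 1) → κ),
      HU d1 D v1 * HU d2 D v2 = fA.map (mapRingHom ψ) → False := by
  classical
  have htop : (1 : MvPolynomial ((Fin d1 × Fin (D + 1)) ⊕ (Fin d2 × Fin (D + 1))) K) ∈ Ideal.span (Set.range (eU d1 d2 D f)) := by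
    rw [← Ideal.eq_top_iff_one]
    by_contra hI
    obtain ⟨m, hm, hIm⟩ := Ideal.exists_le_maximal _ hI
    let fS : Field (MvPolynomial ((Fin d1 × Fin (D + 1)) ⊕ (Fin d2 × Fin (D + 1))) K ⧸ m) := Ideal.Quotient.field m
    have hfin : Module.Finite K (MvPolynomial ((Fin d1 × Fin (D + 1)) ⊕ (Fin d2 × Fin (D + 1))) K ⧸ m) := finite_of_finite_type_of_isJacobsonRing K _
    have halg : Algebra.IsAlgebraic K (MvPolynomial ((Fin d1 × Fin (D + 1)) ⊕ (Fin d2 × Fin (D + 1))) K ⧸ m) := Algebra.IsAlgebraic.of_finite K _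
    refine hno (MvPolynomial ((Fin d1 × Fin (D + 1)) ⊕ (Fin d2 × Fin (D + 1))) K ⧸ m) (HU d1 D (fun p => Ideal.Quotient.mk m (MvPolynomial.X (Sum.inl p)))) 
      (HU d2 D (fun p => Ideal.Quotient.mk m (MvPolynomial.X (Sum.inr p)))) (HU_monic _ _ _) ?_ (HU_natDegree _ _ _)
    have h1 : ZU d1 d2 D (fun i => Ideal.Quotient.mk m (MvPolynomial.X i)) - f.map (mapRingHom ((Ideal.Quotient.mk m).comp MvPolynomial.C)) = 0 := by
      ext a b
      rw [← eU_map d1 d2 D f (a, b) (Ideal.Quotient.mk m)]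
      exact Ideal.Quotient.eq_zero_iff_mem.2 (hIm (Ideal.subset_span ⟨(a, b), rfl⟩))
    exact sub_eq_zero.1 h1
  obtain ⟨c, hc⟩ := Finsupp.mem_ideal_span_range_iff_exists_finsupp.1 htop
  refine ⟨c.support.biUnion (fun t => (c t).coeffs), ?_⟩
  intro A _ iA hiA hs fA hfA κ _ ψ v1 v2 hv
  have hl : ∀ t ∈ c.support, ∃ c' : MvPolynomial ((Fin d1 × Fin (D + 1)) ⊕ (Fin d2 × Fin (D + 1))) A, MvPolynomial.map iA c' = c t := by
    intro t ht
    have : c t ∈ Set.range (MvPolynomial.map iA) := by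
      rw [MvPolynomial.mem_range_map_iff_coeffs_subset]
      intro x hx
      exact hs x (Finset.mem_biUnion.2 ⟨t, ht, hx⟩)
    exact this
  choose! c' hc' using hl
  have h1 : ∑ t ∈ c.support, c' t * eU d1 d2 D fA t = 1 := by
    apply MvPolynomial.map_injective iA hiA
    rw [map_sum, map_one, ← hc, Finsupp.sum]
    apply Finset.sum_congr rfl
    intro t ht
    rw [map_mul, hc' t ht, eU_map', hfA]
  have h2 := congrArg (MvPolynomial.eval₂Hom ψ (Sum.elim v1 v2)) h1
  rw [map_sum, map_one] at h2
  apply zero_ne_one (α := κ)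
  rw [← h2]
  symm
  apply Finset.sum_eq_zero
  intro t _
  rw [map_mul, eU_map]
  have h3 : (MvPolynomial.eval₂Hom ψ (Sum.elim v1 v2)).comp MvPolynomial.C = ψ := RingHom.ext (fun a => MvPolynomial.eval₂Hom_C _ _ _)
  rw [h3, ← hv]
  simp only [ZU, MvPolynomial.eval₂Hom_X', Sum.elim_inl, Sum.elim_inr, sub_self, coeff_zero, mul_zero]

theorem cert {K : Type} [Field K] (f : K[X][X]) (hf : f.Monic) (c : ℕ)
    (hno : ∀ (S : Type) [Field S] [Algebra K S] [Algebra.IsAlgebraic K S] (h1 h2 : S[X][X]), h1.Monic →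
      h1 * h2 = f.map (mapRingHom (algebraMap K S)) → 0 < h1.natDegree → c ≤ h1.natDegree) :
    ∃ s : Finset K, ∀ (A : Type) [CommRing A] (iA : A →+* K) (_ : Function.Injective iA) (_ : ∀ x ∈ s, ∃ a, iA a = x)
      (fA : A[X][X]) (_ : fA.map (mapRingHom iA) = f) (κ : Type) [Field κ] (ψ : A →+* κ) (h1 h2 : κ[X][X]),
      h1.Monic → h2.Monic → h1 * h2 = fA.map (mapRingHom ψ) → 0 < h1.natDegree → c ≤ h1.natDegree := by
  classical
  let D := (Bivariate.swap f).natDegree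
  have hD : ∀ i, (f.coeff i).natDegree ≤ D := (swap_deg f D).1 le_rfl
  have h := fun d1 : Fin c => cert1 f D d1 (f.natDegree - d1)
  by_cases hz : ∀ d1 : Fin c, 0 < (d1 : ℕ) → ∃ s : Finset K, ∀ (A : Type) [CommRing A] (iA : A →+* K) (_ : Function.Injective iA) (_ : ∀ x ∈ s, ∃ a, iA a = x)
      (fA : A[X][X]) (_ : fA.map (mapRingHom iA) = f) (κ : Type) [Field κ] (ψ : A →+* κ) 
      (v1 : Fin d1 × Fin (D + 1) → κ) (v2 : Fin (f.natDegree - d1) × Fin (D + 1) → κ),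
      HU d1 D v1 * HU (f.natDegree - d1) D v2 = fA.map (mapRingHom ψ) → False
  · choose! s hs using hz
    refine ⟨Finset.univ.biUnion s, ?_⟩
    intro A _ iA hiA hsA fA hfA κ _ ψ h1 h2 m1 m2 hh hpos
    by_contra hlt
    push Not at hlt
    have hinj2 : Function.Injective (mapRingHom iA) := Polynomial.map_injective iA hiA
    have hinj3 : Function.Injective (Polynomial.map (mapRingHom iA)) := Polynomial.map_injective _ hinj2
    have hfAm : fA.Monic := monic_of_injective hinj2 (by rw [hfA]; exact hf)
    have hfAd : fA.natDegree = f.natDegree := by rw [← hfA, hfAm.natDegree_map]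
    have hfAx : ∀ i, (fA.coeff i).natDegree ≤ D := by
      intro i
      have := hD i
      rw [← hfA, coeff_map, coe_mapRingHom, natDegree_map_eq_of_injective hiA] at this
      exact this
    have hdeg : h1.natDegree + h2.natDegree = f.natDegree := by
      rw [← m1.natDegree_mul m2, hh, hfAm.natDegree_map, hfAd]
    obtain ⟨x1, x2⟩ := xdeg_factor h1 h2 m1.ne_zero m2.ne_zero D (by
      intro i
      rw [hh, coeff_map]
      exact natDegree_map_le.trans (hfAx i))
    have e2 : f.natDegree - h1.natDegree = h2.natDegree := by omega
    have key := hs ⟨h1.natDegree, hlt⟩ hpos A iA hiA (fun x hx => hsA x (Finset.mem_biUnion.2 ⟨_, Finset.mem_univ _, hx⟩)) fA hfA κ ψ 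
      (fun p => (h1.coeff p.1).coeff p.2)
    dsimp only at key
    rw [e2] at key
    refine key (fun p => (h2.coeff p.1).coeff p.2) ?_
    rw [HU_surj D h1 m1 x1, HU_surj D h2 m2 x2, hh]
  · exfalso
    apply hz
    intro d1 hd1
    apply h d1
    intro S _ _ _ h1 h2 m1 hh hd
    have := hno S h1 h2 m1 hh (by omega)
    have := d1.2
    omega

end C4

section C5
open Polynomial

theorem ext_int {R O Ω : Type} [CommRing R] [CommRing O] [Algebra R O] [Algebra.IsIntegral R O]
    (hinj : Function.Injective (algebraMap R O)) [Field Ω] [IsAlgClosed Ω] (ψ : R →+* Ω) :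
    ∃ Ψ : O →+* Ω, ∀ r, Ψ (algebraMap R O r) = ψ r := by
  have hP : (RingHom.ker ψ).IsPrime := RingHom.ker_isPrime ψ
  obtain ⟨Q, -, hQ, hQP⟩ := Ideal.exists_ideal_over_prime_of_isIntegral (RingHom.ker ψ) (⊥ : Ideal O) (by
    intro x hx
    rw [Ideal.mem_comap, Ideal.mem_bot] at hx
    rw [(injective_iff_map_eq_zero _).1 hinj x hx]
    exact zero_mem _)
  let ι : R ⧸ (RingHom.ker ψ) →+* O ⧸ Q := Ideal.quotientMap Q (algebraMap R O) (le_of_eq hQP.symm)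
  have hι : Function.Injective ι := Ideal.quotientMap_injective' (le_of_eq hQP)
  let a1 : Algebra (R ⧸ (RingHom.ker ψ)) (O ⧸ Q) := ι.toAlgebra
  let a2 : Algebra (R ⧸ (RingHom.ker ψ)) Ω := (RingHom.kerLift ψ).toAlgebra
  have f1 : FaithfulSMul (R ⧸ (RingHom.ker ψ)) (O ⧸ Q) := (faithfulSMul_iff_algebraMap_injective _ _).2 hι
  have f2 : FaithfulSMul (R ⧸ (RingHom.ker ψ)) Ω := (faithfulSMul_iff_algebraMap_injective _ _).2 (RingHom.kerLift_injective ψ)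
  have hint : Algebra.IsIntegral (R ⧸ (RingHom.ker ψ)) (O ⧸ Q) := by
    refine ⟨fun z => ?_⟩
    obtain ⟨z, rfl⟩ := Ideal.Quotient.mk_surjective z
    obtain ⟨p, hp, hz⟩ := Algebra.IsIntegral.isIntegral (R := R) z
    refine ⟨p.map (Ideal.Quotient.mk _), hp.map _, ?_⟩
    rw [eval₂_map]
    have : (algebraMap (R ⧸ (RingHom.ker ψ)) (O ⧸ Q)).comp (Ideal.Quotient.mk _) = (Ideal.Quotient.mk Q).comp (algebraMap R O) := by
      apply RingHom.ext; intro x; rfl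
    rw [this, ← hom_eval₂, hz, map_zero]
  have halg : Algebra.IsAlgebraic (R ⧸ (RingHom.ker ψ)) (O ⧸ Q) := Algebra.IsIntegral.isAlgebraic
  let Λ : (O ⧸ Q) →ₐ[R ⧸ (RingHom.ker ψ)] Ω := IsAlgClosed.lift
  refine ⟨Λ.toRingHom.comp (Ideal.Quotient.mk Q), fun r => ?_⟩
  have h := Λ.commutes (Ideal.Quotient.mk _ r)
  exact h

theorem pac_spec {k K : Type} [Field k] [Field K] [Algebra k K] (hk : IsPACField k) 
    (hd : IsDomain (TensorProduct k (AlgebraicClosure k) K)) (s : Finset K) :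
    Nonempty (Algebra.adjoin k (s : Set K) →ₐ[k] k) := by
  refine hk _ (Algebra.FiniteType.adjoin_of_finite s.finite_toSet) ?_
  have hi : Function.Injective (Algebra.TensorProduct.map (AlgHom.id (AlgebraicClosure k) (AlgebraicClosure k)) (Algebra.adjoin k (s : Set K)).val) := by
    exact Module.Flat.lTensor_preserves_injective_linearMap (M := AlgebraicClosure k) (Algebra.adjoin k (s : Set K)).val.toLinearMap Subtype.val_injective
  exact hi.isDomain (Algebra.TensorProduct.map (AlgHom.id (AlgebraicClosure k) (AlgebraicClosure k)) (Algebra.adjoin k (s : Set K)).val).toRingHom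

theorem low0 {S Ω : Type} [Field S] [Field Ω] [Algebra S Ω] (T : Ω) (hT : Transcendental S T) (f1 : S[X][X]) (hf : f1.Monic)
    (y : Ω) (hy : f1.eval₂ (aeval T : S[X] →ₐ[S] Ω).toRingHom y = 0) (c : ℕ)
    (hcert : ∀ h1 h2 : S[X][X], h1.Monic → h2.Monic → h1 * h2 = f1 → 0 < h1.natDegree → c ≤ h1.natDegree)
    (p : S[X][X]) (hp : p.degree < c) (hpy : p.eval₂ (aeval T : S[X] →ₐ[S] Ω).toRingHom y = 0) : p = 0 := by
  let a : Algebra S[X] Ω := (aeval T : S[X] →ₐ[S] Ω).toRingHom.toAlgebra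
  have hf' : FaithfulSMul S[X] Ω := (faithfulSMul_iff_algebraMap_injective _ _).2 (transcendental_iff_injective.1 hT)
  have htf : Module.IsTorsionFree S[X] Ω := inferInstance
  have hint : IsIntegral S[X] y := ⟨f1, hf, hy⟩
  obtain ⟨q, hq⟩ := minpoly.isIntegrallyClosed_dvd hint (p := f1) hy
  have hm := minpoly.monic hint
  have hqm : q.Monic := hm.of_mul_monic_left (by rw [← hq]; exact hf)
  have hc := hcert _ _ hm hqm hq.symm (minpoly.natDegree_pos hint)
  by_contra h0
  have := minpoly.IsIntegrallyClosed.degree_le_of_ne_zero (s := y) h0 hpy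
  rw [degree_eq_natDegree hm.ne_zero] at this
  have h2 : ((minpoly S[X] y).natDegree : WithBot ℕ) < c := lt_of_le_of_lt this hp
  have h3 : (minpoly S[X] y).natDegree < c := by exact_mod_cast h2
  omega

theorem low_lem {k Ω : Type} [Field k] [Field Ω] [Algebra k Ω] (θ : k[X] →+* Ω) (hθ : Function.Injective θ)
    (hC : ∀ x, θ (C x) = algebraMap k Ω x) (f0 : k[X][X]) (hf : f0.Monic) (y : Ω) (hy : f0.eval₂ θ y = 0) (c : ℕ)
    (hcert : ∀ h1 h2 : (algebraicClosure k Ω)[X][X], h1.Monic → h2.Monic → 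
      h1 * h2 = f0.map (mapRingHom (algebraMap k (algebraicClosure k Ω))) → 0 < h1.natDegree → c ≤ h1.natDegree)
    (ι' : Type) [Fintype ι'] (b : ι' → Ω) (hb : LinearIndependent k b) (hba : ∀ i, IsAlgebraic k (b i))
    (a : ι' × Fin c → k[X]) (h0 : ∑ i, θ (a i) * (b i.1 * y ^ (i.2 : ℕ)) = 0) : ∀ i, a i = 0 := by
  classical
  have hθ' : θ = (aeval (θ X) : k[X] →ₐ[k] Ω).toRingHom := by
    ext x
    · simp [hC]
    · simp
  have hTk : Transcendental k (θ X) := by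
    rw [transcendental_iff_injective]
    intro p q hpq
    apply hθ
    rw [hθ']; exact hpq
  have hT : Transcendental (algebraicClosure k Ω) (θ X) := hTk.algebraicClosure
  have hcomp : (aeval (θ X) : (algebraicClosure k Ω)[X] →ₐ[algebraicClosure k Ω] Ω).toRingHom.comp (mapRingHom (algebraMap k (algebraicClosure k Ω))) = θ := by
    conv_rhs => rw [hθ']
    ext x
    · simp [← IsScalarTower.algebraMap_apply]
    · simp
  let b' : ι' → algebraicClosure k Ω := fun i => ⟨b i, by rw [mem_algebraicClosure_iff]; exact hba i⟩
  have hb' : LinearIndependent k b' := 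
    LinearIndependent.of_comp (algebraicClosure k Ω).val.toLinearMap hb
  let q : Fin c → (algebraicClosure k Ω)[X] := fun m => ∑ i, (a (i, m)).map (algebraMap k (algebraicClosure k Ω)) * C (b' i)
  let p : (algebraicClosure k Ω)[X][X] := ∑ m : Fin c, C (q m) * X ^ (m : ℕ)
  have hp0 : p = 0 := by
    apply low0 (θ X) hT _ (hf.map _) y _ c hcert
    · exact degree_sum_fin_lt q
    · simp only [p, q, eval₂_finsetSum, eval₂_mul, eval₂_C, eval₂_X_pow]
      rw [← h0, Fintype.sum_prod_type_right]
      apply Finset.sum_congr rfl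
      intro m _
      rw [map_sum, Finset.sum_mul]
      apply Finset.sum_congr rfl
      intro i _
      rw [map_mul, ← coe_mapRingHom, ← RingHom.comp_apply, hcomp, mul_assoc]
      congr 2
      simp [b', IntermediateField.algebraMap_apply]
    · rw [eval₂_map, hcomp, hy]
  have hq : ∀ m, q m = 0 := by
    intro m
    have := congrArg (fun p => p.coeff (m : ℕ)) hp0
    simp only [p, finsetSum_coeff, coeff_C_mul_X_pow, coeff_zero] at this
    rw [Finset.sum_eq_single m] at this
    · simpa using this
    · intro m' _ hne
      rw [if_neg (fun h => hne (Fin.ext h.symm))]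
    · simp
  rintro ⟨i, m⟩
  ext n
  have h1 := congrArg (fun p => p.coeff n) (hq m)
  simp only [q, finsetSum_coeff, coeff_mul_C, coeff_map, coeff_zero] at h1
  have h2 := Fintype.linearIndependent_iff.1 hb' (fun i => (a (i, m)).coeff n) (by
    rw [← h1]
    apply Finset.sum_congr rfl
    intro i _
    rw [Algebra.smul_def]) i
  rw [coeff_zero]; exact h2

end C5

section C6
open Polynomial

theorem lift1 {A K : Type} [CommRing A] [CommRing K] (iA : A →+* K) (p : K[X]) (h : ∀ x ∈ p.coeffs, ∃ a, iA a = x) :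
    ∃ q : A[X], q.map iA = p := by
  have : p ∈ lifts iA := by
    rw [lifts_iff_coeff_lifts]
    intro n
    by_cases h0 : p.coeff n = 0
    · exact ⟨0, by rw [map_zero, h0]⟩
    · exact h _ (coeff_mem_coeffs h0)
  exact (mem_lifts _).1 this

theorem lift2 {A K : Type} [CommRing A] [CommRing K] [DecidableEq K] (iA : A →+* K) (p : K[X][X]) 
    (h : ∀ x ∈ p.coeffs.biUnion (fun q => q.coeffs), ∃ a, iA a = x) :
    ∃ q : A[X][X], q.map (mapRingHom iA) = p := by
  apply lift1
  intro r hr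
  obtain ⟨q, hq⟩ := lift1 iA r (fun x hx => h x (Finset.mem_biUnion.2 ⟨r, hr, hx⟩))
  exact ⟨q, hq⟩

theorem lift_nz {A K k : Type} [CommRing A] [Field K] [Field k] [DecidableEq K] (iA : A →+* K) (hi : Function.Injective iA)
    (φ : A →+* k) (p : K[X]) (hp : p ≠ 0)
    (h : ∀ x ∈ p.coeffs ∪ {p.leadingCoeff⁻¹}, ∃ a, iA a = x) :
    ∃ q : A[X], q.map iA = p ∧ q.map φ ≠ 0 := by
  obtain ⟨q, hq⟩ := lift1 iA p (fun x hx => h x (Finset.mem_union_left _ hx))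
  refine ⟨q, hq, fun h0 => ?_⟩
  obtain ⟨b, hb⟩ := h p.leadingCoeff⁻¹ (Finset.mem_union_right _ (Finset.mem_singleton_self _))
  have h1 : q.coeff p.natDegree * b = 1 := by
    apply hi
    rw [map_mul, hb, map_one, ← coeff_map, hq, coeff_natDegree, mul_inv_cancel₀ (leadingCoeff_ne_zero.2 hp)]
  have h2 := congrArg φ h1
  rw [map_mul, ← coeff_map, h0, coeff_zero, zero_mul, map_one] at h2
  exact zero_ne_one h2

theorem spec_step {k K E L G A Ω : Type} [Field k] [Field K] [Field E] [Field L] [CommRing A] [Field Ω]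
    [Algebra k K] [Algebra k L] [Algebra k A] [Algebra k Ω] [IsAlgClosed Ω] [FiniteDimensional k L] [Group G] [Fintype G] [DecidableEq G] [MulSemiringAction G E]
    (α : G →* (L ≃ₐ[k] L)) (i0 : K[X] →+* E) (hi0 : Function.Injective i0) (hfix : ∀ (g : G) B, g • i0 B = i0 B) (j : L →+* E)
    (hjg : ∀ g l, g • j l = j (α g l)) (hjk : ∀ x : k, j (algebraMap k L x) = i0 (C (algebraMap k K x)))
    (iA : A →ₐ[k] K) (hiA : Function.Injective iA) (φ : A →ₐ[k] k)
    (θ : k[X] →+* Ω) (hθ : Function.Injective θ) (hC : ∀ x, θ (C x) = algebraMap k Ω x)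
    (y : E) (fA : A[X][X]) (hfm : fA.Monic) (hfA : fA.map (i0.comp (mapRingHom (iA : A →+* K))) = ∏ g : G, (X - C (g • y)))
    (δA : A[X]) (hδ : i0 (δA.map (iA : A →+* K)) = ∏ p ∈ (Finset.univ : Finset G).offDiag, (p.1 • y - p.2 • y)) (hδ0 : δA.map (φ : A →+* k) ≠ 0) :
    ∃ (Yv : G → Ω) (J : L →ₐ[k] Ω), Function.Injective Yv ∧ (∀ g, (fA.map (mapRingHom (φ : A →+* k))).eval₂ θ (Yv g) = 0) ∧
      (∀ (dA : A[X]) (PA : A[X][X]) (g : G), i0 (dA.map (iA : A →+* K)) * (g • y) = eval₂ i0 y (PA.map (mapRingHom (iA : A →+* K))) →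
        ∀ h, θ (dA.map (φ : A →+* k)) * Yv (h * g) = eval₂ θ (Yv h) (PA.map (mapRingHom (φ : A →+* k)))) ∧
      (∀ (dA : A[X]) (PA : A[X][X]) (l : L), i0 (dA.map (iA : A →+* K)) * j l = eval₂ i0 y (PA.map (mapRingHom (iA : A →+* K))) →
        ∀ h, θ (dA.map (φ : A →+* k)) * J (α h l) = eval₂ θ (Yv h) (PA.map (mapRingHom (φ : A →+* k)))) := by
  let r : A[X] →+* E := i0.comp (mapRingHom (iA : A →+* K))
  let aE : Algebra A[X] E := r.toAlgebra
  let O := integralClosure A[X] E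
  have hr : ∀ (g : G) B, g • r B = r B := fun g B => hfix g _
  have hyr : ∀ g : G, eval₂ r (g • y) fA = 0 := by
    intro g
    rw [eval₂_eq_eval_map, hfA, eval_prod]
    exact Finset.prod_eq_zero (Finset.mem_univ g) (by simp)
  have hyO : ∀ g : G, g • y ∈ O := fun g => ⟨fA, hfm, hyr g⟩
  have hjk' : ∀ x : k, j (algebraMap k L x) = r (C (algebraMap k A x)) := by
    intro x
    rw [hjk]
    simp [r]
  have hjO : ∀ l, j l ∈ O := by
    intro l
    refine ⟨(minpoly k l).map ((C : A →+* A[X]).comp (algebraMap k A)), (minpoly.monic (Algebra.IsIntegral.isIntegral l)).map _, ?_⟩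
    have h1 : (algebraMap A[X] E).comp ((C : A →+* A[X]).comp (algebraMap k A)) = j.comp (algebraMap k L) := by
      apply RingHom.ext; intro x; exact (hjk' x).symm
    rw [eval₂_map, h1, ← hom_eval₂]
    have : eval₂ (algebraMap k L) l (minpoly k l) = 0 := minpoly.aeval k l
    rw [this, map_zero]
  have hOinj : Function.Injective (algebraMap A[X] O) := by
    have : Function.Injective r := hi0.comp (Polynomial.map_injective _ hiA)
    intro a b hab
    exact this (congrArg Subtype.val hab)
  obtain ⟨Ψ, hΨ⟩ := ext_int (O := O) hOinj (θ.comp (mapRingHom (φ : A →+* k)))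
  have hΨ' : Ψ.comp (algebraMap A[X] O) = θ.comp (mapRingHom (φ : A →+* k)) := RingHom.ext hΨ
  have hrO : ∀ (P : A[X][X]) (w : O), Ψ (eval₂ (algebraMap A[X] O) w P) = eval₂ θ (Ψ w) (P.map (mapRingHom (φ : A →+* k))) := by
    intro P w
    rw [hom_eval₂, hΨ', eval₂_map]
  have hval : ∀ (P : A[X][X]) (w : O), ((eval₂ (algebraMap A[X] O) w P : O) : E) = eval₂ r w P := by
    intro P w
    exact hom_eval₂ P (algebraMap A[X] O) (O.val : O →+* E) w
  let jO : L →+* O := j.codRestrict O hjO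
  let J : L →ₐ[k] Ω := { Ψ.comp jO with 
    commutes' := by
      intro x
      have : jO (algebraMap k L x) = algebraMap A[X] O (C (algebraMap k A x)) := Subtype.ext (hjk' x)
      change Ψ (jO (algebraMap k L x)) = _
      rw [this, hΨ]
      simp [hC] }
  let Yv : G → Ω := fun g => Ψ ⟨g • y, hyO g⟩
  have hsm : ∀ (h : G) (P : A[X][X]), h • eval₂ r y P = eval₂ r (h • y) P := by
    intro h P
    have := hom_eval₂ P r (MulSemiringAction.toRingHom G E h) y
    have h2 : (MulSemiringAction.toRingHom G E h).comp r = r := RingHom.ext (fun B => hr h B)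
    rw [h2] at this
    exact this
  have hPA : ∀ PA : A[X][X], eval₂ i0 y (PA.map (mapRingHom (iA : A →+* K))) = eval₂ r y PA := fun PA => eval₂_map _ _ _
  refine ⟨Yv, J, ?_, ?_, ?_, ?_⟩
  · intro g h hgh
    by_contra hne
    have h1 : Ψ (∏ p ∈ (Finset.univ : Finset G).offDiag, ((⟨p.1 • y, hyO p.1⟩ : O) - ⟨p.2 • y, hyO p.2⟩)) = θ (δA.map (φ : A →+* k)) := by
      rw [← coe_mapRingHom, ← RingHom.comp_apply, ← hΨ]
      congr 1
      apply Subtype.ext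
      change O.val _ = _
      rw [map_prod]
      exact hδ.symm
    rw [map_prod, Finset.prod_eq_zero (i := (g, h))] at h1
    · exact hδ0 (hθ (by rw [map_zero, ← h1]))
    · simp [hne]
    · rw [map_sub]; exact sub_eq_zero.2 hgh
  · intro g
    rw [← hrO]
    have : eval₂ (algebraMap A[X] O) (⟨g • y, hyO g⟩ : O) fA = 0 := Subtype.ext (by rw [hval]; exact hyr g)
    rw [this, map_zero]
  · intro dA PA g hrel h
    rw [hPA] at hrel
    have h1 := congrArg (fun z => h • z) hrel
    simp only [smul_mul'] at h1
    rw [hsm, hfix, smul_smul] at h1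
    rw [← hrO, ← coe_mapRingHom, ← RingHom.comp_apply, ← hΨ, ← map_mul]
    congr 1
    apply Subtype.ext
    rw [hval]
    exact h1
  · intro dA PA l hrel h
    rw [hPA] at hrel
    have h1 := congrArg (fun z => h • z) hrel
    simp only [smul_mul'] at h1
    rw [hsm, hfix, hjg] at h1
    change _ * Ψ (jO _) = _
    rw [← hrO, ← coe_mapRingHom, ← RingHom.comp_apply, ← hΨ, ← map_mul]
    congr 1
    apply Subtype.ext
    rw [hval]
    exact h1

end C6

section C7
open Polynomial

theorem core {k L G F Ω : Type} [Field k] (hk : IsPACField k) [Field L] [Algebra k L] [FiniteDimensional k L] [IsGalois k L] [Group G] [Finite G]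
    (α : G →* (L ≃ₐ[k] L)) (hα : Function.Surjective α) [Field F] [Field Ω] [Algebra k F] [Algebra F Ω] [Algebra k Ω] [IsScalarTower k F Ω] [IsAlgClosed Ω]
    (ev : k[X] →+* F) (hfrac : ∀ z : F, ∃ a b, b ≠ 0 ∧ ev b * z = ev a) (hev : Function.Injective ev)
    (hC : ∀ x, ev (C x) = algebraMap k F x) :
    ∃ (J : L →ₐ[k] Ω) (E : IntermediateField F Ω) (hJ : ∀ l, J l ∈ E), FiniteDimensional F E ∧ IsGalois F E ∧ 
      (∀ x ∈ E, IsAlgebraic k x → ∃ l, J l = x) ∧ ∃ e : G ≃* (E ≃ₐ[F] E), ∀ g l, ((e g ⟨J l, hJ l⟩ : E) : Ω) = J (α g l) := by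
  classical
  let _ : Fintype G := Fintype.ofFinite G
  obtain ⟨K, E, _, _, _, _, i0, j, hdom, hi0, hfaith, hfix, hfr, hjg, hjk, hALG⟩ := geom_out k L G α hα
  obtain ⟨y, f, δ, hfm, hfd, hfprod, hδ0, hδ, hgen⟩ := alg_data i0 hi0 hfix hfr
  have hinj : ∀ g h : G, g • y = h • y → g = h := by
    intro g h hgh
    by_contra hne
    rw [Finset.prod_eq_zero (i := (g, h)) (by simp [hne]) (sub_eq_zero.2 hgh)] at hδ
    exact hδ0 (hi0 (by rw [hδ, map_zero]))
  obtain ⟨s0, hs0⟩ := cert f hfm (Nat.card α.ker) (geom_factor i0 hi0 hfix α.ker hALG y f hfprod hinj)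
  let B := Module.finBasis k L
  choose dd PP hd0 hrel using hgen
  let cf : K[X] → Finset K := fun p => p.coeffs ∪ {p.leadingCoeff⁻¹}
  let cf2 : K[X][X] → Finset K := fun p => p.coeffs.biUnion (fun q => q.coeffs)
  let zs : Finset E := (Finset.univ.image (fun g : G => g • y)) ∪ (Finset.univ.image (fun i => j (B i)))
  let s : Finset K := s0 ∪ cf2 f ∪ cf δ ∪ zs.biUnion (fun z => cf (dd z) ∪ cf2 (PP z))
  obtain ⟨φ⟩ := pac_spec hk hdom s
  let A := Algebra.adjoin k (s : Set K)
  let iA : A →ₐ[k] K := A.val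
  have hiA : Function.Injective iA := Subtype.val_injective
  have hsA : ∀ x ∈ s, ∃ a, (iA : A →+* K) a = x := fun x hx => ⟨⟨x, Algebra.subset_adjoin hx⟩, rfl⟩
  have m1 : ∀ x ∈ s0, x ∈ s := fun x hx => by simp [s, hx]
  have m2 : ∀ x ∈ cf2 f, x ∈ s := fun x hx => Finset.mem_union_left _ (Finset.mem_union_left _ (Finset.mem_union_right _ hx))
  have m3 : ∀ x ∈ cf δ, x ∈ s := fun x hx => Finset.mem_union_left _ (Finset.mem_union_right _ hx)
  have m4 : ∀ z ∈ zs, ∀ x ∈ cf (dd z), x ∈ s := fun z hz x hx => 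
    Finset.mem_union_right _ (Finset.mem_biUnion.2 ⟨z, hz, Finset.mem_union_left _ hx⟩)
  have m5 : ∀ z ∈ zs, ∀ x ∈ cf2 (PP z), x ∈ s := fun z hz x hx => 
    Finset.mem_union_right _ (Finset.mem_biUnion.2 ⟨z, hz, Finset.mem_union_right _ hx⟩)
  obtain ⟨fA, hfA⟩ := lift2 (iA : A →+* K) f (fun x hx => hsA x (m2 x hx))
  obtain ⟨δA, hδA, hδA0⟩ := lift_nz (iA : A →+* K) hiA (φ : A →+* k) δ hδ0 (fun x hx => hsA x (m3 x hx))
  have hdl : ∀ z ∈ zs, ∃ q : A[X], q.map (iA : A →+* K) = dd z ∧ q.map (φ : A →+* k) ≠ 0 := fun z hz => 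
    lift_nz (iA : A →+* K) hiA (φ : A →+* k) _ (hd0 z) (fun x hx => hsA x (m4 z hz x hx))
  have hPl : ∀ z ∈ zs, ∃ q : A[X][X], q.map (mapRingHom (iA : A →+* K)) = PP z := fun z hz => 
    lift2 (iA : A →+* K) _ (fun x hx => hsA x (m5 z hz x hx))
  have hfAm : fA.Monic := monic_of_injective (Polynomial.map_injective (iA : A →+* K) hiA : Function.Injective (mapRingHom (iA : A →+* K))) (by rw [hfA]; exact hfm)
  have hfAd : fA.natDegree = Nat.card G := by rw [← hfd, ← hfA, hfAm.natDegree_map]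
  let θ : k[X] →+* Ω := (algebraMap F Ω).comp ev
  have hθ : Function.Injective θ := (algebraMap F Ω).injective.comp hev
  have hθC : ∀ x, θ (C x) = algebraMap k Ω x := by
    intro x
    change algebraMap F Ω (ev (C x)) = _
    rw [hC, ← IsScalarTower.algebraMap_apply]
  obtain ⟨Yv, J, hYi, hY0, hR1, hR2⟩ := spec_step α i0 hi0 hfix j hjg hjk iA hiA φ θ hθ hθC y fA hfAm
    (by rw [← Polynomial.map_map, hfA, hfprod]) δA (by rw [hδA, hδ]) hδA0
  have hf0m : (fA.map (mapRingHom (φ : A →+* k))).Monic := hfAm.map _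
  refine ⟨J, final_field ev hfrac hev α hα Yv hYi J (fA.map (mapRingHom (φ : A →+* k))) hf0m
    (by rw [hfAm.natDegree_map, hfAd]) hY0 ?_ (Fin (Module.finrank k L)) B ?_ ?_⟩
  · intro g
    have hz : g • y ∈ zs := Finset.mem_union_left _ (Finset.mem_image_of_mem _ (Finset.mem_univ g))
    obtain ⟨dA, hdA, hdA0⟩ := hdl _ hz
    obtain ⟨PA, hPA⟩ := hPl _ hz
    refine ⟨_, _, hdA0, hR1 dA PA g ?_⟩
    rw [hdA, hPA]; exact hrel _
  · intro i
    have hz : j (B i) ∈ zs := Finset.mem_union_right _ (Finset.mem_image_of_mem _ (Finset.mem_univ i))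
    obtain ⟨dA, hdA, hdA0⟩ := hdl _ hz
    obtain ⟨PA, hPA⟩ := hPl _ hz
    refine ⟨_, _, hdA0, hR2 dA PA (B i) ?_⟩
    rw [hdA, hPA]; exact hrel _
  · apply low_lem θ hθ hθC _ hf0m (Yv 1) (hY0 1)
    intro h1 h2 mm1 mm2 hh hpos
    refine hs0 A (iA : A →+* K) hiA (fun x hx => hsA x (m1 x hx)) fA hfA _ ((algebraMap k (algebraicClosure k Ω)).comp (φ : A →+* k)) h1 h2 mm1 mm2 ?_ hpos
    rw [hh, Polynomial.map_map, mapRingHom_comp]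

theorem main_aux (k : Type) [Field k] (hk : IsPACField k)
    (G : Type) [Group G] [Finite G]
    (L : IntermediateField k (AlgebraicClosure (RatFunc k)))
    [FiniteDimensional k L] [IsGalois k L]
    (α : G →* (L ≃ₐ[k] L)) (hα : Function.Surjective α) :
    ∃ (E : IntermediateField (RatFunc k) (AlgebraicClosure (RatFunc k)))
      (hLE : (L : Set (AlgebraicClosure (RatFunc k))) ⊆ E),
      FiniteDimensional (RatFunc k) E ∧ IsGalois (RatFunc k) E ∧
      (∀ x : AlgebraicClosure (RatFunc k), x ∈ E → IsAlgebraic k x → x ∈ L) ∧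
      ∃ β : (E ≃ₐ[RatFunc k] E) ≃* G,
        ∀ (σ : E ≃ₐ[RatFunc k] E) (x : AlgebraicClosure (RatFunc k)) (hx : x ∈ L),
          ((σ ⟨x, hLE hx⟩ : E) : AlgebraicClosure (RatFunc k)) =
            ((α (β σ) ⟨x, hx⟩ : L) : AlgebraicClosure (RatFunc k)) := by
  obtain ⟨J, E, hJ, hfin, hgal, halg, e, he⟩ := core (F := RatFunc k) (Ω := AlgebraicClosure (RatFunc k)) hk α hα
    (algebraMap k[X] (RatFunc k)) (by
      intro z
      obtain ⟨a, b, hb, rfl⟩ := IsFractionRing.div_surjective (A := k[X]) z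
      have hb' : b ≠ 0 := nonZeroDivisors.ne_zero hb
      have hb2 : algebraMap k[X] (RatFunc k) b ≠ 0 := by
        rw [Ne, map_eq_zero_iff _ (IsFractionRing.injective k[X] (RatFunc k))]
        exact hb'
      exact ⟨a, b, hb', by field_simp⟩) (IsFractionRing.injective k[X] (RatFunc k)) (by
      intro x
      rw [RatFunc.algebraMap_C]; rfl)
  let γ : L ≃ₐ[k] L := Normal.algHomEquivAut k (AlgebraicClosure (RatFunc k)) L J
  have hγ : ∀ l, J l = (γ l : AlgebraicClosure (RatFunc k)) := by
    intro l
    have h1 : (Normal.algHomEquivAut k (AlgebraicClosure (RatFunc k)) L).symm γ = J := Equiv.symm_apply_apply _ _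
    conv_lhs => rw [← h1]
    rfl
  obtain ⟨g0, hg0⟩ := hα γ
  have hJ2 : ∀ l : L, (l : AlgebraicClosure (RatFunc k)) = J (γ.symm l) := by
    intro l
    rw [hγ, AlgEquiv.apply_symm_apply]
  refine ⟨E, ?_, hfin, hgal, ?_, e.symm.trans (MulAut.conj g0), ?_⟩
  · intro x hx
    have := hJ2 ⟨x, hx⟩
    change x = _ at this
    rw [this]; exact hJ _
  · intro x hx hxa
    obtain ⟨l, rfl⟩ := halg x hx hxa
    rw [hγ]; exact (γ l).2
  · intro σ x hx
    obtain ⟨g, rfl⟩ := e.surjective σ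
    have h1 := he g (γ.symm ⟨x, hx⟩)
    have hxJ : x = J (γ.symm ⟨x, hx⟩) := hJ2 ⟨x, hx⟩
    have hxE : x ∈ E := by rw [hxJ]; exact hJ _
    have h2 : (⟨J (γ.symm ⟨x, hx⟩), hJ _⟩ : E) = ⟨x, hxE⟩ := Subtype.ext hxJ.symm
    rw [h2] at h1
    rw [h1, hγ, MulEquiv.trans_apply, MulEquiv.symm_apply_apply, MulAut.conj_apply, map_mul, map_mul, map_inv, hg0]
    rfl

end C7

/-- **Every finite Galois embedding problem over a PAC field has a geometric Galois
solution.**  Let `k` be PAC, `L/k` a finite Galois extension (realized inside a fixed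
algebraic closure `Ω` of `k(T) = RatFunc k`), `G` a finite group and
`α : G → Gal(L/k)` surjective.  Then there are a finite Galois extension `E/k(T)` with
`L(T) ⊆ E` such that every element of `E` algebraic over `k` lies in `L`
(`E ∩ k̄ = L`), and an isomorphism `β : Gal(E/k(T)) ≃ G` such that every
`σ ∈ Gal(E/k(T))` maps `L` onto itself and `σ|_L = α (β σ)`. -/
theorem statement_7 (k : Type) [Field k] (hk : IsPACField k)
    (G : Type) [Group G] [Finite G]
    (L : IntermediateField k (AlgebraicClosure (RatFunc k)))
    [FiniteDimensional k L] [IsGalois k L]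
    (α : G →* (L ≃ₐ[k] L)) (hα : Function.Surjective α) :
    ∃ (E : IntermediateField (RatFunc k) (AlgebraicClosure (RatFunc k)))
      (hLE : (L : Set (AlgebraicClosure (RatFunc k))) ⊆ E),
      FiniteDimensional (RatFunc k) E ∧ IsGalois (RatFunc k) E ∧
      (∀ x : AlgebraicClosure (RatFunc k), x ∈ E → IsAlgebraic k x → x ∈ L) ∧
      ∃ β : (E ≃ₐ[RatFunc k] E) ≃* G,
        ∀ (σ : E ≃ₐ[RatFunc k] E) (x : AlgebraicClosure (RatFunc k)) (hx : x ∈ L),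
          ((σ ⟨x, hLE hx⟩ : E) : AlgebraicClosure (RatFunc k)) =
            ((α (β σ) ⟨x, hx⟩ : L) : AlgebraicClosure (RatFunc k)) := by
  exact main_aux k hk G L α hα
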